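/- Let H be a complex Hilbert space, V ⊆ B(H) a linear subspace, e ∈ V with ‖e‖ = 1, D ⊆ V × V a domain, and m : D → V a partial product. Then m is completely contractive (i.e. ‖A ⊙_m B‖ ≤ ‖A‖ ‖B‖ for every valid pair (A, B) of matrices over V) if and only if there exist a complex Hilbert space K and a linear map π : V → B(K) that is completely isometric and satisfies π(e) = I_K and π(m(a,b)) = π(a)π(b) for all (a,b) ∈ D. -/

import Mathlib

noncomputable section

open scoped BigOperators

/-- A partial product on a complex vector space `V` with distinguished element `e`:
a domain `D ⊆ V × V` together with subspaces `R x` and `L x` (each containing `e`) witnessing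
the domain conditions, and a (partially meaningful) product `m` which is unital and bilinear
where defined. -/
structure PartialProduct (V : Type*) [AddCommGroup V] [Module ℂ V] (e : V) where
  /-- The domain of the partial product. -/
  D : Set (V × V)
  /-- The partial product (as a total function; only its values on `D` are meaningful). -/
  m : V → V → V
  /-- For each `x`, a unital subspace `R x` with `ℂx × R x ⊆ D`. -/
  R : V → Submodule ℂ V
  /-- For each `y`, a unital subspace `L y` with `L y × ℂy ⊆ D`. -/
  L : V → Submodule ℂ V
  unit_left : ∀ (c : ℂ) (x : V), (c • e, x) ∈ D
  unit_right : ∀ (c : ℂ) (x : V), (x, c • e) ∈ D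
  e_mem_R : ∀ x : V, e ∈ R x
  e_mem_L : ∀ y : V, e ∈ L y
  mem_right : ∀ (x : V) (c : ℂ) (r : V), r ∈ R x → (c • x, r) ∈ D
  mem_left : ∀ (y : V) (c : ℂ) (l : V), l ∈ L y → (l, c • y) ∈ D
  m_unital_left : ∀ x : V, m e x = x
  m_unital_right : ∀ x : V, m x e = x
  m_add_left : ∀ (x y z : V) (c : ℂ), y ∈ L x → z ∈ L x →
    m (y + c • z) x = m y x + c • m z x
  m_add_right : ∀ (x y z : V) (c : ℂ), y ∈ R x → z ∈ R x →
    m x (y + c • z) = m x y + c • m x z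

/-- A pair of matrices over `V` is a valid pair for a partial product when all the relevant
entry pairs lie in the domain. -/
def PartialProduct.ValidPair {V : Type*} [AddCommGroup V] [Module ℂ V] {e : V}
    (P : PartialProduct V e) {n k l : ℕ}
    (A : Matrix (Fin n) (Fin k) V) (B : Matrix (Fin k) (Fin l) V) : Prop :=
  ∀ (i : Fin n) (r : Fin k) (j : Fin l), (A i r, B r j) ∈ P.D

/-- The matrix product `A ⊙_m B` of a valid pair. -/
def PartialProduct.odot {V : Type*} [AddCommGroup V] [Module ℂ V] {e : V}
    (P : PartialProduct V e) {n k l : ℕ}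
    (A : Matrix (Fin n) (Fin k) V) (B : Matrix (Fin k) (Fin l) V) :
    Matrix (Fin n) (Fin l) V :=
  Matrix.of fun i j => ∑ r, P.m (A i r) (B r j)

variable {H : Type} [NormedAddCommGroup H] [InnerProductSpace ℂ H] [CompleteSpace H]

/-- A matrix over `B(H)` viewed as a bounded operator between the `ℓ²`-direct sums `H^κ → H^ι`. -/
noncomputable def opMatCLM {ι κ : Type} [Fintype ι] [Fintype κ]
    (A : Matrix ι κ (H →L[ℂ] H)) :
    PiLp 2 (fun _ : κ => H) →L[ℂ] PiLp 2 (fun _ : ι => H) :=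
  ((PiLp.continuousLinearEquiv 2 ℂ (fun _ : ι => H)).symm.toContinuousLinearMap) ∘L
    (ContinuousLinearMap.pi fun i => ∑ j, (A i j).comp (ContinuousLinearMap.proj j)) ∘L
    ((PiLp.continuousLinearEquiv 2 ℂ (fun _ : κ => H)).toContinuousLinearMap)

/-- The operator norm of a matrix over `B(H)`, viewed as an operator `H^κ → H^ι`. -/
noncomputable def opMatNorm {ι κ : Type} [Fintype ι] [Fintype κ]
    (A : Matrix ι κ (H →L[ℂ] H)) : ℝ := ‖opMatCLM A‖

/-- The norm of a matrix over a subspace `V ⊆ B(H)`, computed in `B(H)`. -/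
noncomputable def subMatNorm {V : Submodule ℂ (H →L[ℂ] H)} {ι κ : Type} [Fintype ι] [Fintype κ]
    (A : Matrix ι κ ↥V) : ℝ := opMatNorm (A.map (fun v => (v : H →L[ℂ] H)))

/-! ### Bounds and positivity for matrices of operators -/

set_option linter.unusedSectionVars false

/-- The matrix `A` of operators, acting from `H^κ` to `H^ι`, has norm at most `c`
(for nonnegative `c`). -/
def MatBound {ι κ : Type} [Fintype ι] [Fintype κ] (A : ι → κ → (H →L[ℂ] H)) (c : ℝ) : Prop :=
  ∀ ξ : κ → H, ∑ i, ‖∑ j, A i j (ξ j)‖ ^ 2 ≤ c ^ 2 * ∑ j, ‖ξ j‖ ^ 2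

theorem opMatCLM_apply {ι κ : Type} [Fintype ι] [Fintype κ]
    (A : Matrix ι κ (H →L[ℂ] H)) (ξ : PiLp 2 (fun _ : κ => H)) (i : ι) :
    opMatCLM A ξ i = ∑ j, A i j (ξ j) := by
  simp [opMatCLM]

theorem opMatNorm_nonneg {ι κ : Type} [Fintype ι] [Fintype κ]
    (A : Matrix ι κ (H →L[ℂ] H)) : 0 ≤ opMatNorm A :=
  norm_nonneg (opMatCLM A)

theorem opMatNorm_le_iff {ι κ : Type} [Fintype ι] [Fintype κ]
    (A : Matrix ι κ (H →L[ℂ] H)) {c : ℝ} (hc : 0 ≤ c) :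
    opMatNorm A ≤ c ↔ MatBound A c := by
  unfold opMatNorm
  rw [ContinuousLinearMap.opNorm_le_iff hc]
  constructor
  · intro h ξ
    have h1 := h (WithLp.toLp 2 ξ)
    have h2 := pow_le_pow_left₀ (norm_nonneg _) h1 2
    rw [mul_pow, PiLp.norm_sq_eq_of_L2, PiLp.norm_sq_eq_of_L2] at h2
    simpa [opMatCLM_apply] using h2
  · intro h ξ
    have h1 := h (fun j => ξ j)
    refine (pow_le_pow_iff_left₀ (norm_nonneg _) (by positivity) two_ne_zero).1 ?_
    rw [mul_pow, PiLp.norm_sq_eq_of_L2, PiLp.norm_sq_eq_of_L2]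
    simpa [opMatCLM_apply] using h1

theorem matBound_opMatNorm {ι κ : Type} [Fintype ι] [Fintype κ]
    (A : Matrix ι κ (H →L[ℂ] H)) : MatBound A (opMatNorm A) :=
  (opMatNorm_le_iff A (opMatNorm_nonneg A)).1 le_rfl

theorem MatBound.mono {ι κ : Type} [Fintype ι] [Fintype κ] {A : ι → κ → (H →L[ℂ] H)} {c d : ℝ}
    (h : MatBound A c) (hc : 0 ≤ c) (hd : c ≤ d) : MatBound A d := fun ξ =>
  (h ξ).trans (mul_le_mul_of_nonneg_right (pow_le_pow_left₀ hc hd 2) (by positivity))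

theorem MatBound.of_reindex {ι κ ι' κ' : Type} [Fintype ι] [Fintype κ] [Fintype ι'] [Fintype κ']
    {A : ι → κ → (H →L[ℂ] H)} {c : ℝ} (f : ι' ≃ ι) (g : κ' ≃ κ)
    (h : MatBound (fun i j => A (f i) (g j)) c) : MatBound A c := by
  intro ξ
  have h1 := h (fun j => ξ (g j))
  rw [g.sum_comp (fun j => ‖ξ j‖ ^ 2)] at h1
  refine le_trans (le_of_eq ?_) h1
  rw [← f.sum_comp]
  refine Finset.sum_congr rfl fun i _ => ?_
  rw [g.sum_comp (fun j => A (f i) j (ξ j))]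

theorem MatBound.reindex {ι κ ι' κ' : Type} [Fintype ι] [Fintype κ] [Fintype ι'] [Fintype κ']
    {A : ι → κ → (H →L[ℂ] H)} {c : ℝ} (f : ι' ≃ ι) (g : κ' ≃ κ)
    (h : MatBound A c) : MatBound (fun i j => A (f i) (g j)) c := by
  refine MatBound.of_reindex f.symm g.symm ?_
  simpa using h

/-- Complete contractivity of a partial product, for matrices with arbitrary finite index types. -/
def PartialProduct.Contractive {V : Submodule ℂ (H →L[ℂ] H)} {e : V}
    (P : PartialProduct V e) : Prop :=
  ∀ (ι κ μ : Type) [Fintype ι] [Fintype κ] [Fintype μ] (A : ι → κ → V) (B : κ → μ → V) (a b : ℝ),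
    0 ≤ a → 0 ≤ b → (∀ i r j, (A i r, B r j) ∈ P.D) →
    MatBound (fun i j => (A i j : H →L[ℂ] H)) a → MatBound (fun i j => (B i j : H →L[ℂ] H)) b →
    MatBound (fun i j => ((∑ r, P.m (A i r) (B r j) : V) : H →L[ℂ] H)) (a * b)

theorem PartialProduct.contractive_of_forall_fin {V : Submodule ℂ (H →L[ℂ] H)} {e : V}
    (P : PartialProduct V e)
    (h : ∀ (n k l : ℕ) (A : Matrix (Fin n) (Fin k) ↥V) (B : Matrix (Fin k) (Fin l) ↥V),
        P.ValidPair A B → subMatNorm (P.odot A B) ≤ subMatNorm A * subMatNorm B) :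
    P.Contractive := by
  intro ι κ μ _ _ _ A B a b ha hb hD hA hB
  let f := (Fintype.equivFin ι).symm
  let g := (Fintype.equivFin κ).symm
  let u := (Fintype.equivFin μ).symm
  refine MatBound.of_reindex f u ?_
  have h1 := h _ _ _ (Matrix.of fun i j => A (f i) (g j)) (Matrix.of fun i j => B (g i) (u j))
    (fun i r j => hD _ _ _)
  have hA' : subMatNorm (Matrix.of fun i j => A (f i) (g j)) ≤ a :=
    (opMatNorm_le_iff _ ha).2 (hA.reindex f g)
  have hB' : subMatNorm (Matrix.of fun i j => B (g i) (u j)) ≤ b :=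
    (opMatNorm_le_iff _ hb).2 (hB.reindex g u)
  have h2 := h1.trans (mul_le_mul hA' hB' (opMatNorm_nonneg _) ha)
  have h3 := (opMatNorm_le_iff _ (mul_nonneg ha hb)).1 h2
  have h4 : (fun i j => ((∑ r, P.m (A (f i) r) (B r (u j)) : V) : H →L[ℂ] H)) =
      fun i j => ((∑ r, P.m (A (f i) (g r)) (B (g r) (u j)) : V) : H →L[ℂ] H) := by
    funext i j
    rw [← g.sum_comp]
  rw [h4]
  exact h3

theorem opMatNorm_sum_mul_le {ι κ μ : Type} [Fintype ι] [Fintype κ] [Fintype μ]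
    (A : Matrix ι κ (H →L[ℂ] H)) (B : Matrix κ μ (H →L[ℂ] H)) :
    opMatNorm (Matrix.of fun i j => ∑ r, A i r * B r j) ≤ opMatNorm A * opMatNorm B := by
  have : opMatCLM (Matrix.of fun i j => ∑ r, A i r * B r j) = opMatCLM A ∘L opMatCLM B := by
    ext ξ i
    simp only [opMatCLM_apply, ContinuousLinearMap.comp_apply, Matrix.of_apply,
      sum_apply, mul_apply_eq_comp, map_sum]
    rw [Finset.sum_comm]
  unfold opMatNorm
  rw [this]
  exact ContinuousLinearMap.opNorm_comp_le _ _

theorem PartialProduct.contractive_of_representation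
    {V : Submodule ℂ (H →L[ℂ] H)} {e : V} (P : PartialProduct V e)
    {K : Type} [NormedAddCommGroup K] [InnerProductSpace ℂ K] [CompleteSpace K]
    (π : V →ₗ[ℂ] (K →L[ℂ] K))
    (hπ : ∀ (n k : ℕ) (A : Matrix (Fin n) (Fin k) ↥V), opMatNorm (A.map ⇑π) = subMatNorm A)
    (hm : ∀ a b : ↥V, (a, b) ∈ P.D → π (P.m a b) = π a * π b)
    (n k l : ℕ) (A : Matrix (Fin n) (Fin k) ↥V) (B : Matrix (Fin k) (Fin l) ↥V)
    (hD : P.ValidPair A B) : subMatNorm (P.odot A B) ≤ subMatNorm A * subMatNorm B := by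
  rw [← hπ, ← hπ, ← hπ]
  convert opMatNorm_sum_mul_le (A.map π) (B.map π) using 2
  refine Matrix.ext fun i j => ?_
  simp only [PartialProduct.odot, Matrix.map_apply, Matrix.of_apply, map_sum]
  exact Finset.sum_congr rfl fun r _ => hm _ _ (hD i r j)

section Stinespring

open scoped InnerProductSpace ComplexConjugate

/-! ### Hilbert space completions and a Stinespring-type dilation -/

/-- A square matrix of operators is accretive. -/
def MatAcc {ι : Type} [Fintype ι] (A : ι → ι → (H →L[ℂ] H)) : Prop :=
  ∀ ξ : ι → H, 0 ≤ (∑ i, ∑ j, ⟪ξ i, A i j (ξ j)⟫_ℂ).re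

theorem Finset.sum_comm_pair {α β γ δ M : Type} [AddCommMonoid M] (s : Finset α) (t : Finset β)
    (p : Finset γ) (q : Finset δ) (f : α → β → γ → δ → M) :
    ∑ i ∈ s, ∑ j ∈ t, ∑ a ∈ p, ∑ b ∈ q, f i j a b =
      ∑ a ∈ p, ∑ b ∈ q, ∑ i ∈ s, ∑ j ∈ t, f i j a b := by
  have h : ∀ i, ∑ j ∈ t, ∑ a ∈ p, ∑ b ∈ q, f i j a b = ∑ a ∈ p, ∑ b ∈ q, ∑ j ∈ t, f i j a b :=
    fun i => by
      rw [Finset.sum_comm]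
      exact Finset.sum_congr rfl fun a _ => Finset.sum_comm
  simp only [h]
  rw [Finset.sum_comm]
  exact Finset.sum_congr rfl fun a _ => Finset.sum_comm

theorem PreInnerProductSpace.Core.exists_completion {E : Type} [AddCommGroup E] [Module ℂ E]
    (c : PreInnerProductSpace.Core ℂ E) :
    ∃ (K : Type) (_ : NormedAddCommGroup K) (_ : InnerProductSpace ℂ K) (_ : CompleteSpace K)
      (u : E →ₗ[ℂ] K), (∀ x y, ⟪u x, u y⟫_ℂ = c.inner x y) ∧ DenseRange u := by
  let : SeminormedAddCommGroup E := InnerProductSpace.Core.toSeminormedAddCommGroup (c := c)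
  let : InnerProductSpace ℂ E := InnerProductSpace.ofCore c
  refine ⟨UniformSpace.Completion E, inferInstance, inferInstance, inferInstance,
    (UniformSpace.Completion.toComplL (𝕜 := ℂ) (E := E)).toLinearMap, fun x y => ?_, ?_⟩
  · exact UniformSpace.Completion.inner_coe x y
  · exact UniformSpace.Completion.denseRange_coe

theorem LinearMap.exists_extend_of_denseRange {E : Type} [AddCommGroup E] [Module ℂ E]
    {K L : Type} [NormedAddCommGroup K] [InnerProductSpace ℂ K]
    [NormedAddCommGroup L] [InnerProductSpace ℂ L] [CompleteSpace L]
    (u : E →ₗ[ℂ] K) (hu : DenseRange u) (f : E →ₗ[ℂ] L) (C : ℝ)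
    (hf : ∀ x, ‖f x‖ ≤ C * ‖u x‖) : ∃ T : K →L[ℂ] L, ∀ x, T (u x) = f x :=
  ⟨f.extendOfNorm u, fun x => LinearMap.extendOfNorm_eq hu ⟨C, hf⟩ x⟩

theorem ContinuousLinearMap.ext_of_denseRange {E : Type} [AddCommGroup E] [Module ℂ E]
    {K L : Type} [NormedAddCommGroup K] [InnerProductSpace ℂ K]
    [NormedAddCommGroup L] [InnerProductSpace ℂ L]
    {u : E →ₗ[ℂ] K} (hu : DenseRange u) {S T : K →L[ℂ] L} (h : ∀ x, S (u x) = T (u x)) : S = T :=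
  ContinuousLinearMap.ext fun x =>
    congrFun (hu.equalizer S.continuous T.continuous (funext h)) x

section Dilation

variable {I : Type} (F : I → I → ((H →L[ℂ] H) →ₗ[ℂ] ℂ))

/-- The sesquilinear form on finitely supported operator-valued functions given by a kernel. -/
def kernelForm (ξ η : I →₀ (H →L[ℂ] H)) : ℂ :=
  ξ.sum fun i a => η.sum fun j b => F i j (star a * b)

theorem kernelForm_eq (ξ η : I →₀ (H →L[ℂ] H)) (s t : Finset I) (hs : ξ.support ⊆ s)
    (ht : η.support ⊆ t) :
    kernelForm F ξ η = ∑ i ∈ s, ∑ j ∈ t, F i j (star (ξ i) * η j) := by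
  unfold kernelForm
  rw [Finsupp.sum_of_support_subset _ hs _ (by simp)]
  refine Finset.sum_congr rfl fun i _ => ?_
  rw [Finsupp.sum_of_support_subset _ ht _ (by simp)]

/-- Positivity of a kernel on accretive matrices. -/
def KernelPos : Prop :=
  ∀ (t : Finset I) (A : I → I → (H →L[ℂ] H)),
    (∀ ξ : I → H, 0 ≤ (∑ i ∈ t, ∑ j ∈ t, ⟪ξ i, A i j (ξ j)⟫_ℂ).re) →
    0 ≤ (∑ i ∈ t, ∑ j ∈ t, F i j (A i j)).re

/-- Left multiplication on operator-valued functions. -/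
def leftMul (a : H →L[ℂ] H) : (I →₀ (H →L[ℂ] H)) →ₗ[ℂ] (I →₀ (H →L[ℂ] H)) :=
  Finsupp.mapRange.linearMap (LinearMap.mulLeft ℂ a)

@[simp] theorem leftMul_apply (a : H →L[ℂ] H) (ξ : I →₀ (H →L[ℂ] H)) (i : I) :
    leftMul a ξ i = a * ξ i := rfl

theorem leftMul_support (a : H →L[ℂ] H) (ξ : I →₀ (H →L[ℂ] H)) :
    (leftMul a ξ).support ⊆ ξ.support := by
  intro i hi
  rw [Finsupp.mem_support_iff] at hi ⊢
  contrapose! hi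
  simp [hi]

variable {F}

theorem KernelPos.matrix_nonneg (hF : KernelPos F) {κ : Type} [Fintype κ]
    {A : κ → κ → (H →L[ℂ] H)} (hA : MatAcc A) (ξ : κ → (I →₀ (H →L[ℂ] H))) :
    0 ≤ (∑ a, ∑ b, kernelForm F (ξ a) (leftMul (A a b) (ξ b))).re := by
  classical
  set t : Finset I := Finset.univ.biUnion fun a => (ξ a).support
  have ht : ∀ a, (ξ a).support ⊆ t := fun a =>
    Finset.subset_biUnion_of_mem (fun a => (ξ a).support) (Finset.mem_univ a)
  have h1 := hF t (fun i j => ∑ a, ∑ b, star (ξ a i) * (A a b * ξ b j)) ?_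
  · convert h1 using 2
    simp only [map_sum]
    have : ∀ a b, kernelForm F (ξ a) (leftMul (A a b) (ξ b)) =
        ∑ i ∈ t, ∑ j ∈ t, F i j (star (ξ a i) * (A a b * ξ b j)) := fun a b => by
      rw [kernelForm_eq F _ _ t t (ht a) ((leftMul_support _ _).trans (ht b))]
      simp
    simp only [this]
    exact Finset.sum_comm_pair _ _ _ _ _
  · intro h
    have h2 := hA (fun a => ∑ i ∈ t, ξ a i (h i))
    convert h2 using 2
    simp only [sum_apply, mul_apply_eq_comp, inner_sum,
      ContinuousLinearMap.star_eq_adjoint, ContinuousLinearMap.adjoint_inner_right]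
    rw [Finset.sum_comm_pair]
    refine Finset.sum_congr rfl fun a _ => Finset.sum_congr rfl fun b _ => ?_
    rw [sum_inner]
    simp only [map_sum, inner_sum]

theorem kernelForm_leftMul (a : H →L[ℂ] H) (ξ η : I →₀ (H →L[ℂ] H)) :
    kernelForm F (leftMul a ξ) η = kernelForm F ξ (leftMul (star a) η) := by
  rw [kernelForm_eq F _ _ ξ.support η.support (leftMul_support _ _) subset_rfl,
    kernelForm_eq F _ _ ξ.support η.support subset_rfl (leftMul_support _ _)]
  simp [mul_assoc]

theorem leftMul_mul (a b : H →L[ℂ] H) (ξ : I →₀ (H →L[ℂ] H)) :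
    leftMul (a * b) ξ = leftMul a (leftMul b ξ) := by
  ext1 i
  simp [mul_assoc]

theorem leftMul_one (ξ : I →₀ (H →L[ℂ] H)) : leftMul 1 ξ = ξ := by
  ext1 i
  simp

theorem leftMul_add (a b : H →L[ℂ] H) (ξ : I →₀ (H →L[ℂ] H)) :
    leftMul (a + b) ξ = leftMul a ξ + leftMul b ξ := by
  ext1 i
  simp [add_mul]

theorem leftMul_smul (c : ℂ) (a : H →L[ℂ] H) (ξ : I →₀ (H →L[ℂ] H)) :
    leftMul (c • a) ξ = c • leftMul a ξ := by
  ext1 i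
  simp

/-- The positive semidefinite form attached to a positive kernel. -/
@[reducible] def KernelPos.core (hF : KernelPos F)
    (hF' : ∀ i j a, F j i (star a) = conj (F i j a)) :
    PreInnerProductSpace.Core ℂ (I →₀ (H →L[ℂ] H)) where
  inner := kernelForm F
  conj_inner_symm ξ η := by
    rw [kernelForm_eq F _ _ η.support ξ.support subset_rfl subset_rfl,
      kernelForm_eq F _ _ ξ.support η.support subset_rfl subset_rfl, Finset.sum_comm]
    simp only [map_sum, ← hF', star_mul, star_star]
  re_inner_nonneg ξ := by
    have := hF.matrix_nonneg (κ := Unit) (A := fun _ _ => 1) (fun h => ?_) (fun _ => ξ)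
    · simpa [leftMul_one] using this
    · simpa using inner_self_nonneg (𝕜 := ℂ) (x := h ())
  add_left ξ η ζ := by
    classical
    rw [kernelForm_eq F _ _ (ξ.support ∪ η.support) ζ.support Finsupp.support_add subset_rfl,
      kernelForm_eq F _ _ (ξ.support ∪ η.support) ζ.support Finset.subset_union_left subset_rfl,
      kernelForm_eq F _ _ (ξ.support ∪ η.support) ζ.support Finset.subset_union_right subset_rfl]
    simp [add_mul, Finset.sum_add_distrib]
  smul_left ξ η c := by
    rw [kernelForm_eq F _ _ ξ.support η.support Finsupp.support_smul subset_rfl,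
      kernelForm_eq F _ _ ξ.support η.support subset_rfl subset_rfl]
    simp [Finset.mul_sum]

theorem re_inner_self_complex {E : Type} [NormedAddCommGroup E] [InnerProductSpace ℂ E] (x : E) :
    (⟪x, x⟫_ℂ).re = ‖x‖ ^ 2 := inner_self_eq_norm_sq (𝕜 := ℂ) x

theorem re_inner_star_mul_self_le (a : H →L[ℂ] H) (x : H) :
    (⟪x, (star a * a) x⟫_ℂ).re ≤ ‖a‖ ^ 2 * ‖x‖ ^ 2 := by
  rw [mul_apply_eq_comp, ContinuousLinearMap.star_eq_adjoint,
    ContinuousLinearMap.adjoint_inner_right]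
  rw [re_inner_self_complex, ← mul_pow]
  exact pow_le_pow_left₀ (norm_nonneg _) (a.le_opNorm x) 2

theorem KernelPos.exists_dilation (hF : KernelPos F)
    (hF' : ∀ i j a, F j i (star a) = conj (F i j a)) :
    ∃ (L : Type) (_ : NormedAddCommGroup L) (_ : InnerProductSpace ℂ L) (_ : CompleteSpace L)
      (v : I → L) (ρ : (H →L[ℂ] H) →⋆ₐ[ℂ] (L →L[ℂ] L)),
      (∀ i j a, ⟪v i, ρ a (v j)⟫_ℂ = F i j a) ∧
      ∀ (κ : Type) [Fintype κ] (A : κ → κ → (H →L[ℂ] H)), MatAcc A →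
        MatAcc fun i j => ρ (A i j) := by
  classical
  obtain ⟨L, _, _, _, u, hu, hd⟩ := (hF.core hF').exists_completion
  replace hu : ∀ ξ η, ⟪u ξ, u η⟫_ℂ = kernelForm F ξ η := hu
  have hbd : ∀ (a : H →L[ℂ] H) ξ, ‖u (leftMul a ξ)‖ ≤ ‖a‖ * ‖u ξ‖ := by
    intro a ξ
    refine (pow_le_pow_iff_left₀ (norm_nonneg _) (by positivity) two_ne_zero).1 ?_
    have h1 := hF.matrix_nonneg (κ := Unit)
      (A := fun _ _ => ((‖a‖ ^ 2 : ℝ) : ℂ) • 1 - star a * a) (fun h => ?_) (fun _ => ξ)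
    · have h2 : leftMul (((‖a‖ ^ 2 : ℝ) : ℂ) • 1 - star a * a) ξ =
          ((‖a‖ ^ 2 : ℝ) : ℂ) • ξ - leftMul (star a) (leftMul a ξ) := by
        ext1 i
        simp [sub_mul, mul_assoc]
      simp only [Finset.univ_unique, Finset.sum_singleton, h2] at h1
      rw [← hu, map_sub, inner_sub_right, map_smul, inner_smul_right, hu ξ (leftMul _ _),
        ← kernelForm_leftMul, ← hu, Complex.sub_re, Complex.re_ofReal_mul, re_inner_self_complex,
        re_inner_self_complex, sub_nonneg] at h1
      rwa [mul_pow]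
    · have h3 := re_inner_star_mul_self_le a (h ())
      simp only [Finset.univ_unique, Finset.sum_singleton, sub_apply, inner_sub_right,
        smul_apply, inner_smul_right, one_apply_eq_self, Complex.sub_re, sub_nonneg,
        Complex.re_ofReal_mul,
        re_inner_self_complex]
      exact h3
  choose R hR using fun a => LinearMap.exists_extend_of_denseRange u hd (u.comp (leftMul a)) ‖a‖
    (hbd a)
  replace hR : ∀ a ξ, R a (u ξ) = u (leftMul a ξ) := hR
  let ρ : (H →L[ℂ] H) →⋆ₐ[ℂ] (L →L[ℂ] L) :=
    { toFun := R
      map_one' := ContinuousLinearMap.ext_of_denseRange hd fun ξ => by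
        simp [hR, leftMul_one]
      map_mul' := fun a b => ContinuousLinearMap.ext_of_denseRange hd fun ξ => by
        simp [hR, leftMul_mul]
      map_zero' := ContinuousLinearMap.ext_of_denseRange hd fun ξ => by
        have : leftMul (0 : H →L[ℂ] H) ξ = 0 := by ext1 i; simp
        simp [hR, this]
      map_add' := fun a b => ContinuousLinearMap.ext_of_denseRange hd fun ξ => by
        simp [hR, leftMul_add]
      commutes' := fun c => ContinuousLinearMap.ext_of_denseRange hd fun ξ => by
        simp [hR, Algebra.algebraMap_eq_smul_one, leftMul_smul, leftMul_one]
      map_star' := fun a => by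
        refine (ContinuousLinearMap.eq_adjoint_iff _ _).2 ?_
        refine fun x y => hd.induction_on₂ (p := fun x y => ⟪R (star a) x, y⟫_ℂ = ⟪x, R a y⟫_ℂ)
          (isClosed_eq (by fun_prop) (by fun_prop)) (fun ξ η => ?_) x y
        rw [hR, hR, hu, hu, kernelForm_leftMul, star_star] }
  refine ⟨L, inferInstance, inferInstance, inferInstance, fun i => u (Finsupp.single i 1), ρ,
    fun i j a => ?_, fun κ _ A hA => ?_⟩
  · change ⟪_, R a _⟫_ℂ = _
    rw [hR, hu, kernelForm_eq F _ _ {i} {j} Finsupp.support_single_subset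
      ((leftMul_support _ _).trans Finsupp.support_single_subset)]
    simp
  · intro η
    have hd' : DenseRange fun ξ : κ → (I →₀ (H →L[ℂ] H)) => fun a => u (ξ a) :=
      DenseRange.piMap fun _ => hd
    refine hd'.induction_on (p := fun η : κ → L =>
      0 ≤ (∑ i, ∑ j, ⟪η i, ρ (A i j) (η j)⟫_ℂ).re) η ?_ fun ξ => ?_
    · refine isClosed_le continuous_const (Complex.continuous_re.comp ?_)
      fun_prop
    · convert hF.matrix_nonneg hA ξ using 6 with a _ b _
      change ⟪_, R _ _⟫_ℂ = _
      rw [hR, hu]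

end Dilation

end Stinespring

section UnitalMaps

open scoped InnerProductSpace ComplexConjugate
open Filter Topology

/-! ### Unital completely positive maps fixing a set, and minimal ones -/

theorem exists_ultrafilter_limit {ι : Type} (U : Ultrafilter ι) (a : ι → (H →L[ℂ] H)) (C : ℝ)
    (ha : ∀ i, ‖a i‖ ≤ C) :
    ∃ b : H →L[ℂ] H, ∀ h k, Tendsto (fun i => ⟪h, a i k⟫_ℂ) U (𝓝 ⟪h, b k⟫_ℂ) := by
  have hb : ∀ i h k, ‖⟪h, a i k⟫_ℂ‖ ≤ C * ‖h‖ * ‖k‖ := fun i h k =>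
    calc ‖⟪h, a i k⟫_ℂ‖ ≤ ‖h‖ * ‖a i k‖ := norm_inner_le_norm _ _
      _ ≤ ‖h‖ * (C * ‖k‖) := by
        gcongr
        exact (a i).le_of_opNorm_le (ha i) k
      _ = C * ‖h‖ * ‖k‖ := by ring
  have hlim : ∀ h k, ∃ z : ℂ, Tendsto (fun i => ⟪h, a i k⟫_ℂ) U (𝓝 z) := fun h k => by
    obtain ⟨z, -, hz⟩ := (isCompact_closedBall (0 : ℂ) (C * ‖h‖ * ‖k‖)).ultrafilter_le_nhds
      (U.map fun i => ⟪h, a i k⟫_ℂ) (by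
        simp only [Ultrafilter.coe_map, le_principal_iff, mem_map]
        exact Filter.univ_mem' fun i => by simpa using hb i h k)
    exact ⟨z, hz⟩
  choose f hf using hlim
  let B : H →ₗ⋆[ℂ] H →ₗ[ℂ] ℂ := LinearMap.mk₂'ₛₗ (starRingEnd ℂ) (RingHom.id ℂ) f
    (fun x y z => tendsto_nhds_unique (hf _ _) (by
      simpa only [inner_add_left] using (hf x z).add (hf y z)))
    (fun c x y => tendsto_nhds_unique (hf _ _) (by
      simpa only [inner_smul_left, smul_eq_mul] using (hf x y).const_mul (conj c)))
    (fun x y z => tendsto_nhds_unique (hf _ _) (by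
      simpa only [inner_add_right, map_add] using (hf x y).add (hf x z)))
    (fun c x y => tendsto_nhds_unique (hf _ _) (by
      simpa only [inner_smul_right, map_smul, smul_eq_mul, RingHom.id_apply]
        using (hf x y).const_mul c))
  let B' : H →L⋆[ℂ] H →L[ℂ] ℂ := B.mkContinuous₂ C fun x y =>
    le_of_tendsto (hf x y).norm (Eventually.of_forall fun i => hb i x y)
  refine ⟨ContinuousLinearMap.adjoint (InnerProductSpace.continuousLinearMapOfBilin B'),
    fun h k => ?_⟩
  rw [ContinuousLinearMap.adjoint_inner_right,
    InnerProductSpace.continuousLinearMapOfBilin_apply]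
  exact hf h k

theorem norm_le_of_inner_le {b : H →L[ℂ] H} {C : ℝ} (hC : 0 ≤ C)
    (h : ∀ x y, ‖⟪x, b y⟫_ℂ‖ ≤ C * ‖x‖ * ‖y‖) : ‖b‖ ≤ C := by
  refine b.opNorm_le_bound hC fun y => ?_
  have h1 := h (b y) y
  rw [inner_self_eq_norm_sq_to_K] at h1
  have h2 : ‖b y‖ * ‖b y‖ ≤ ‖b y‖ * (C * ‖y‖) := by
    have : ‖((‖b y‖ : ℝ) : ℂ) ^ 2‖ = ‖b y‖ * ‖b y‖ := by
      rw [norm_pow, Complex.norm_real, norm_norm, sq]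
    linarith [this.symm.le.trans h1]
  rcases (norm_nonneg (b y)).eq_or_lt with h3 | h3
  · rw [← h3]
    positivity
  · exact le_of_mul_le_mul_left h2 h3

/-- Unital completely positive (and contractive) maps on `B(H)`. -/
structure IsUCP (Φ : Module.End ℂ (H →L[ℂ] H)) : Prop where
  map_one : Φ 1 = 1
  map_star : ∀ a, Φ (star a) = star (Φ a)
  norm_le : ∀ a, ‖Φ a‖ ≤ ‖a‖
  acc : ∀ (κ : Type) [Fintype κ] (A : κ → κ → (H →L[ℂ] H)), MatAcc A →
    MatAcc fun i j => Φ (A i j)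

/-- Unital completely positive maps fixing a given set of operators. -/
structure IsFixingUCP (W : Set (H →L[ℂ] H)) (Φ : Module.End ℂ (H →L[ℂ] H)) : Prop
    extends IsUCP Φ where
  fix : ∀ a ∈ W, Φ a = a

variable {W : Set (H →L[ℂ] H)} {Φ Ψ : Module.End ℂ (H →L[ℂ] H)}

theorem IsFixingUCP.id (W : Set (H →L[ℂ] H)) : IsFixingUCP W 1 where
  map_one := rfl
  map_star _ := rfl
  norm_le _ := le_rfl
  acc _ _ _ h := h
  fix _ _ := rfl

theorem IsFixingUCP.mul (hΦ : IsFixingUCP W Φ) (hΨ : IsFixingUCP W Ψ) :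
    IsFixingUCP W (Φ * Ψ) where
  map_one := by rw [Module.End.mul_apply, hΨ.map_one, hΦ.map_one]
  map_star a := by simp only [Module.End.mul_apply, hΨ.map_star, hΦ.map_star]
  norm_le a := (hΦ.norm_le _).trans (hΨ.norm_le a)
  acc κ _ A hA := hΦ.acc κ _ (hΨ.acc κ A hA)
  fix a ha := by rw [Module.End.mul_apply, hΨ.fix a ha, hΦ.fix a ha]

theorem IsFixingUCP.pow (hΦ : IsFixingUCP W Φ) (n : ℕ) : IsFixingUCP W (Φ ^ n) := by
  induction n with
  | zero => exact IsFixingUCP.id W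
  | succ n ih => rw [pow_succ]; exact ih.mul hΦ

theorem IsFixingUCP.average (Θ : ℕ → Module.End ℂ (H →L[ℂ] H)) (hΘ : ∀ n, IsFixingUCP W (Θ n))
    (n : ℕ) : IsFixingUCP W (((n + 1 : ℝ)⁻¹ : ℂ) • ∑ k ∈ Finset.range (n + 1), Θ k) := by
  have hn : (n + 1 : ℂ) ≠ 0 := Nat.cast_add_one_ne_zero n
  refine ⟨⟨?_, fun a => ?_, fun a => ?_, fun κ _ A hA ξ => ?_⟩, fun a ha => ?_⟩
  · simp [(hΘ _).map_one, hn, ← Nat.cast_smul_eq_nsmul ℂ, smul_smul]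
  · simp [(hΘ _).map_star, star_smul, star_sum]
  · simp only [LinearMap.smul_apply, LinearMap.sum_apply, norm_smul]
    have : ‖∑ k ∈ Finset.range (n + 1), Θ k a‖ ≤ (n + 1) * ‖a‖ := by
      refine (norm_sum_le_of_le _ fun k _ => (hΘ k).norm_le a).trans ?_
      simp
    have h2 : ‖(((n + 1 : ℝ) : ℂ)⁻¹)‖ = (n + 1 : ℝ)⁻¹ := by
      rw [norm_inv, Complex.norm_real, Real.norm_of_nonneg (by positivity)]
    push_cast at h2 ⊢
    rw [h2, inv_mul_le_iff₀ (by positivity)]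
    exact this
  · have h1 : ∀ k, 0 ≤ (∑ i, ∑ j, ⟪ξ i, Θ k (A i j) (ξ j)⟫_ℂ).re := fun k => (hΘ k).acc κ A hA ξ
    have h2 : ∑ i, ∑ j, ⟪ξ i, ((((n + 1 : ℝ)⁻¹ : ℂ) • ∑ k ∈ Finset.range (n + 1), Θ k) (A i j))
        (ξ j)⟫_ℂ = (((n + 1 : ℝ)⁻¹ : ℝ) : ℂ) * ∑ k ∈ Finset.range (n + 1),
          ∑ i, ∑ j, ⟪ξ i, Θ k (A i j) (ξ j)⟫_ℂ := by
      simp only [LinearMap.smul_apply, LinearMap.sum_apply, smul_apply, inner_smul_right,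
        sum_apply, inner_sum, ← Finset.mul_sum]
      rw [Finset.sum_comm (s := Finset.range (n + 1))]
      congr 1
      · push_cast; rfl
      · refine Finset.sum_congr rfl fun i _ => ?_
        rw [Finset.sum_comm]
    rw [h2, Complex.re_ofReal_mul, Complex.re_sum]
    exact mul_nonneg (by positivity) (Finset.sum_nonneg fun k _ => h1 k)
  · simp [(hΘ _).fix a ha, hn, ← Nat.cast_smul_eq_nsmul ℂ, smul_smul]

theorem eq_of_inner_tendsto {ι : Type} {l : Filter ι} [l.NeBot] {a : ι → (H →L[ℂ] H)}
    {b b' : H →L[ℂ] H} (h : ∀ x y, Tendsto (fun i => ⟪x, a i y⟫_ℂ) l (𝓝 ⟪x, b y⟫_ℂ))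
    (h' : ∀ x y, Tendsto (fun i => ⟪x, a i y⟫_ℂ) l (𝓝 ⟪x, b' y⟫_ℂ)) : b = b' :=
  ContinuousLinearMap.ext fun y => ext_inner_left ℂ fun x => tendsto_nhds_unique (h x y) (h' x y)

theorem IsFixingUCP.exists_ultrafilter_limit {ι : Type} (U : Ultrafilter ι)
    (Θ : ι → Module.End ℂ (H →L[ℂ] H)) (hΘ : ∀ i, IsFixingUCP W (Θ i)) :
    ∃ Φ, IsFixingUCP W Φ ∧ ∀ a (C : ℝ), (∀ᶠ i in U, ‖Θ i a‖ ≤ C) → ‖Φ a‖ ≤ C := by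
  choose f hf using fun a =>
    _root_.exists_ultrafilter_limit U (fun i => Θ i a) ‖a‖ fun i => (hΘ i).norm_le a
  have hC : ∀ a (C : ℝ), (∀ᶠ i in U, ‖Θ i a‖ ≤ C) → ‖f a‖ ≤ C := fun a C h => by
    refine norm_le_of_inner_le ?_ fun x y => le_of_tendsto (hf a x y).norm ?_
    · obtain ⟨i, hi⟩ := h.exists
      exact (norm_nonneg _).trans hi
    · filter_upwards [h] with i hi
      calc ‖⟪x, Θ i a y⟫_ℂ‖ ≤ ‖x‖ * ‖Θ i a y‖ := norm_inner_le_norm _ _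
        _ ≤ ‖x‖ * (C * ‖y‖) := by
          gcongr
          exact (Θ i a).le_of_opNorm_le hi y
        _ = C * ‖x‖ * ‖y‖ := by ring
  have hconst : ∀ a b, (∀ i, Θ i a = b) → f a = b := fun a b h =>
    eq_of_inner_tendsto (hf a) fun x y => by simp only [h]; exact tendsto_const_nhds
  refine ⟨{ toFun := f, map_add' := fun a b => ?_, map_smul' := fun c a => ?_ },
    ⟨⟨hconst _ _ fun i => (hΘ i).map_one, fun a => ?_, fun a => hC a _ ?_, fun κ _ A hA ξ => ?_⟩,
      fun a ha => hconst _ _ fun i => (hΘ i).fix a ha⟩, hC⟩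
  · refine eq_of_inner_tendsto (hf _) fun x y => ?_
    simpa only [map_add, add_apply, inner_add_right] using (hf a x y).add (hf b x y)
  · refine eq_of_inner_tendsto (hf _) fun x y => ?_
    simpa only [map_smul, smul_apply, inner_smul_right, RingHom.id_apply]
      using (hf a x y).const_mul c
  · refine eq_of_inner_tendsto (hf _) fun x y => ?_
    have h1 := (Complex.continuous_conj.tendsto _).comp (hf a y x)
    simp only [LinearMap.coe_mk, AddHom.coe_mk]
    convert h1 using 2 with i
    · rw [(hΘ i).map_star]
      simp [ContinuousLinearMap.star_eq_adjoint, ContinuousLinearMap.adjoint_inner_right]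
    · rw [inner_conj_symm]
      exact ContinuousLinearMap.adjoint_inner_right _ _ _
  · exact Eventually.of_forall fun i => (hΘ i).norm_le a
  · refine ge_of_tendsto' (x := (U : Filter ι)) ((Complex.continuous_re.tendsto _).comp
      (tendsto_finsetSum _ fun i _ => tendsto_finsetSum _ fun j _ => hf (A i j) (ξ i) (ξ j)))
      fun i => (hΘ i).acc κ A hA ξ

/-- A minimal element among the unital completely positive maps fixing `W`. -/
structure IsMinimalUCP (W : Set (H →L[ℂ] H)) (Φ : Module.End ℂ (H →L[ℂ] H)) : Prop
    extends IsFixingUCP W Φ where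
  minimal : ∀ Ψ, IsFixingUCP W Ψ → (∀ a, ‖Ψ a‖ ≤ ‖Φ a‖) → ∀ a, ‖Φ a‖ ≤ ‖Ψ a‖

theorem exists_isMinimalUCP (W : Set (H →L[ℂ] H)) : ∃ Φ, IsMinimalUCP W Φ := by
  let r : {Φ // IsFixingUCP W Φ} → {Φ // IsFixingUCP W Φ} → Prop :=
    fun Φ Ψ => ∀ a, ‖Ψ.1 a‖ ≤ ‖Φ.1 a‖
  have hch : ∀ c, IsChain r c → ∃ ub, ∀ a ∈ c, r a ub := by
    intro c hc
    rcases c.eq_empty_or_nonempty with rfl | hne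
    · exact ⟨⟨1, IsFixingUCP.id W⟩, by simp⟩
    have : Nonempty c := hne.to_subtype
    let f : c → Filter c := fun Φ => 𝓟 {Ψ | r Φ.1 Ψ.1}
    have hr : ∀ Φ, r Φ Φ := fun Φ a => le_rfl
    have hf : (⨅ Φ, f Φ).NeBot := by
      refine iInf_neBot_of_directed' (fun Φ Ψ => ?_) fun Φ => ?_
      · have htot : r Φ.1 Ψ.1 ∨ r Ψ.1 Φ.1 := by
          by_cases hne : Φ.1 = Ψ.1
          · exact Or.inl (hne ▸ hr _)
          · exact hc Φ.2 Ψ.2 hne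
        rcases htot with h | h
        · exact ⟨Ψ, principal_mono.2 fun Θ hΘ a => (hΘ a).trans (h a), le_rfl⟩
        · exact ⟨Φ, le_rfl, principal_mono.2 fun Θ hΘ a => (hΘ a).trans (h a)⟩
      · exact principal_neBot_iff.2 ⟨Φ, hr _⟩
    obtain ⟨Θ, hΘ, hle⟩ := IsFixingUCP.exists_ultrafilter_limit (Ultrafilter.of (⨅ Φ, f Φ))
      (fun Φ => Φ.1.1) fun Φ => Φ.1.2
    refine ⟨⟨Θ, hΘ⟩, fun Φ hΦ a => hle a _ ?_⟩
    have h1 : (Ultrafilter.of (⨅ Φ, f Φ) : Filter c) ≤ f ⟨Φ, hΦ⟩ :=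
      (Ultrafilter.of_le _).trans (iInf_le _ _)
    filter_upwards [h1 (mem_principal_self _)] with Ψ hΨ using hΨ a
  obtain ⟨Φ, hΦ⟩ := exists_maximal_of_chains_bounded hch fun h1 h2 a => (h2 a).trans (h1 a)
  exact ⟨Φ.1, Φ.2, fun Ψ hΨ h => hΦ ⟨Ψ, hΨ⟩ h⟩

theorem IsMinimalUCP.idem (h : IsMinimalUCP W Φ) (b : H →L[ℂ] H) : Φ (Φ b) = Φ b := by
  have hF := h.toIsFixingUCP
  have key : ∀ n : ℕ, ‖Φ (b - Φ b)‖ ≤ (2 * ‖b‖) * ((n : ℝ) + 1)⁻¹ := by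
    intro n
    have h1 := h.minimal _ (IsFixingUCP.average (fun k => Φ ^ (k + 1)) (fun k => hF.pow _) n)
      (fun a => ?_) (b - Φ b)
    · refine h1.trans ?_
      have h2 : (∑ k ∈ Finset.range (n + 1), Φ ^ (k + 1)) (b - Φ b) =
          Φ b - (Φ ^ (n + 1 + 1)) b := by
        rw [LinearMap.sum_apply]
        have : ∀ k, (Φ ^ (k + 1)) (b - Φ b) = (Φ ^ (k + 1)) b - (Φ ^ (k + 1 + 1)) b := fun k => by
          rw [map_sub, pow_succ _ (k + 1), Module.End.mul_apply]
        simp only [this]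
        rw [Finset.sum_range_sub' (fun k => (Φ ^ (k + 1)) b)]
        simp
      have h3 : ‖(((n + 1 : ℝ) : ℂ)⁻¹)‖ = (n + 1 : ℝ)⁻¹ := by
        rw [norm_inv, Complex.norm_real, Real.norm_of_nonneg (by positivity)]
      rw [LinearMap.smul_apply, h2, norm_smul, mul_comm]
      push_cast at h3 ⊢
      rw [h3]
      gcongr
      have h4 := hF.norm_le b
      have h5 := (hF.pow (n + 1 + 1)).norm_le b
      exact (norm_sub_le _ _).trans (by linarith)
    · have h3 : ‖(((n + 1 : ℝ) : ℂ)⁻¹)‖ = (n + 1 : ℝ)⁻¹ := by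
        rw [norm_inv, Complex.norm_real, Real.norm_of_nonneg (by positivity)]
      rw [LinearMap.smul_apply, norm_smul, LinearMap.sum_apply]
      push_cast at h3 ⊢
      rw [h3, inv_mul_le_iff₀ (by positivity)]
      refine (norm_sum_le_of_le (n := fun _ => ‖Φ a‖) _ fun k _ => ?_).trans (by simp)
      rw [pow_succ, Module.End.mul_apply]
      exact (hF.pow k).norm_le _
  have h0 : Tendsto (fun n : ℕ => (2 * ‖b‖) * ((n : ℝ) + 1)⁻¹) atTop (𝓝 0) := by
    have := (tendsto_one_div_add_atTop_nhds_zero_nat (𝕜 := ℝ)).const_mul (2 * ‖b‖)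
    simpa using this
  have h1 := ge_of_tendsto' h0 key
  have h2 := norm_le_zero_iff.1 h1
  rw [map_sub, sub_eq_zero] at h2
  exact h2.symm

theorem IsMinimalUCP.rigid (h : IsMinimalUCP W Φ) (hΨ : IsFixingUCP W Ψ) (a : H →L[ℂ] H) :
    Φ (Ψ (Φ a)) = Φ a := by
  have hF := h.toIsFixingUCP
  have hθ : IsFixingUCP W (Φ * Ψ * Φ) := (hF.mul hΨ).mul hF
  have hle : ∀ a, ‖(Φ * Ψ * Φ) a‖ ≤ ‖Φ a‖ := fun a => (hF.mul hΨ).norm_le _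
  have hge := h.minimal _ hθ hle
  have hmin : IsMinimalUCP W (Φ * Ψ * Φ) := ⟨hθ, fun Ψ' hΨ' hle' a =>
    (hle a).trans (h.minimal Ψ' hΨ' (fun a => (hle' a).trans (hle a)) a)⟩
  have h1 := hge ((Φ * Ψ * Φ) a - Φ a)
  have h2 : (Φ * Ψ * Φ) ((Φ * Ψ * Φ) a - Φ a) = 0 := by
    rw [map_sub, hmin.idem, sub_eq_zero]
    simp only [Module.End.mul_apply, h.idem]
  rw [h2, norm_zero, map_sub, h.idem] at h1
  simp only [Module.End.mul_apply, h.idem] at h1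
  exact sub_eq_zero.1 (norm_le_zero_iff.1 h1)

end UnitalMaps

section Idempotent

open scoped InnerProductSpace ComplexConjugate

/-! ### Idempotent completely positive maps -/

theorem matAcc_gram {κ : Type} [Fintype κ] {L : Type} [NormedAddCommGroup L]
    [InnerProductSpace ℂ L] [CompleteSpace L] (d : κ → (H →L[ℂ] L)) :
    MatAcc fun i j => (ContinuousLinearMap.adjoint (d i)) ∘L (d j) := by
  intro ξ
  have : ∑ i, ∑ j, ⟪ξ i, ((ContinuousLinearMap.adjoint (d i)) ∘L (d j)) (ξ j)⟫_ℂ =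
      ⟪∑ i, d i (ξ i), ∑ j, d j (ξ j)⟫_ℂ := by
    rw [sum_inner]
    simp only [ContinuousLinearMap.comp_apply, ContinuousLinearMap.adjoint_inner_right, inner_sum]
  rw [this, re_inner_self_complex]
  positivity

theorem eq_zero_of_two_by_two {p b b' d : H →L[ℂ] H} (hb : b' = star b)
    (hp : ∀ ξ, (⟪ξ, p ξ⟫_ℂ).re ≤ 0)
    (h : ∀ ξ η, 0 ≤ (⟪ξ, p ξ⟫_ℂ + ⟪ξ, b η⟫_ℂ + ⟪η, b' ξ⟫_ℂ + ⟪η, d η⟫_ℂ).re) : b = 0 := by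
  ext η
  have key : ∀ t : ℝ, 2 * t * ‖b η‖ ^ 2 ≤ (⟪η, d η⟫_ℂ).re := fun t => by
    have h1 := h ((-(t : ℂ)) • b η) η
    have h2 := hp ((-(t : ℂ)) • b η)
    have h3 : (⟪(-(t : ℂ)) • b η, b η⟫_ℂ).re = -t * ‖b η‖ ^ 2 := by
      rw [inner_smul_left, map_neg, Complex.conj_ofReal, ← Complex.ofReal_neg,
        Complex.re_ofReal_mul, re_inner_self_complex]
    have h4 : (⟪η, b' ((-(t : ℂ)) • b η)⟫_ℂ).re = -t * ‖b η‖ ^ 2 := by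
      rw [hb, ContinuousLinearMap.star_eq_adjoint, ContinuousLinearMap.adjoint_inner_right,
        inner_smul_right, ← Complex.ofReal_neg, Complex.re_ofReal_mul, re_inner_self_complex]
    simp only [Complex.add_re, h3, h4] at h1
    linarith
  by_contra hne
  have hpos : 0 < ‖b η‖ ^ 2 := by
    have : b η ≠ 0 := by simpa using hne
    positivity
  have h5 := key (((⟪η, d η⟫_ℂ).re + 1) / ‖b η‖ ^ 2)
  have h6 := key 1
  rw [mul_assoc, div_mul_cancel₀ _ hpos.ne'] at h5
  linarith

variable {Φ : Module.End ℂ (H →L[ℂ] H)}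

theorem IsUCP.map_star_mul_eq_zero (hΦ : IsUCP Φ) (hi : ∀ b, Φ (Φ b) = Φ b) {a c : H →L[ℂ] H}
    (ha : Φ a = a) (hc : Φ c = 0) : Φ (star a * c) = 0 := by
  have h1 := hΦ.acc _ _ (matAcc_gram ![1, a, c])
  have h2 : ∀ ξ η, 0 ≤ (⟪ξ, (Φ (star a * a) - star a * a) ξ⟫_ℂ + ⟪ξ, Φ (star a * c) η⟫_ℂ +
      ⟪η, Φ (star c * a) ξ⟫_ℂ + ⟪η, Φ (star c * c) η⟫_ℂ).re := fun ξ η => by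
    have h3 := h1 ![-(a ξ), ξ, η]
    simp only [Fin.sum_univ_three, ← ContinuousLinearMap.star_eq_adjoint,
      Matrix.cons_val_zero, Matrix.cons_val_one, Matrix.cons_val] at h3
    have e1 : star (1 : H →L[ℂ] H) ∘L (1 : H →L[ℂ] H) = 1 := by rw [star_one]; rfl
    have e2 : star (1 : H →L[ℂ] H) ∘L a = a := by rw [star_one]; rfl
    have e3 : star (1 : H →L[ℂ] H) ∘L c = c := by rw [star_one]; rfl
    have e4 : star a ∘L (1 : H →L[ℂ] H) = star a := rfl
    have e5 : star c ∘L (1 : H →L[ℂ] H) = star c := rfl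
    rw [e1, e2, e3, e4, e5, hΦ.map_one, hΦ.map_star, hΦ.map_star, ha, hc] at h3
    convert h3 using 1
    simp only [Complex.add_re, sub_apply, inner_sub_right, mul_apply_eq_comp,
      ContinuousLinearMap.star_eq_adjoint, ContinuousLinearMap.adjoint_inner_right,
      one_apply_eq_self, inner_neg_right, inner_neg_left, Complex.sub_re, Complex.neg_re,
      map_neg, map_zero, zero_apply, inner_zero_right, Complex.zero_re, neg_zero, neg_neg]
    simp only [← ContinuousLinearMap.mul_def]
    ring
  have h4 := hΦ.acc (Fin 2) ![![Φ (star a * a) - star a * a, Φ (star a * c)],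
    ![Φ (star c * a), Φ (star c * c)]] (fun ξ => by
      simpa [Fin.sum_univ_two, add_assoc] using h2 (ξ 0) (ξ 1))
  refine eq_zero_of_two_by_two (p := 0) (b' := Φ (star c * a)) (d := Φ (star c * c)) ?_ (by simp)
    fun ξ η => ?_
  · rw [← hΦ.map_star, star_mul, star_star]
  · have h5 := h4 ![ξ, η]
    simpa [Fin.sum_univ_two, hi, add_assoc] using h5

theorem IsUCP.map_mul_map (hΦ : IsUCP Φ) (hi : ∀ b, Φ (Φ b) = Φ b) {b : H →L[ℂ] H}
    (hb : Φ b = b) (d : H →L[ℂ] H) : Φ (b * Φ d) = Φ (b * d) := by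
  have h := hΦ.map_star_mul_eq_zero hi (a := star b) (c := Φ d - d) (by rw [hΦ.map_star, hb])
    (by rw [map_sub, hi, sub_self])
  rwa [star_star, mul_sub, map_sub, sub_eq_zero] at h

theorem IsUCP.map_map_mul (hΦ : IsUCP Φ) (hi : ∀ b, Φ (Φ b) = Φ b) {b : H →L[ℂ] H}
    (hb : Φ b = b) (d : H →L[ℂ] H) : Φ (Φ d * b) = Φ (d * b) := by
  have h := hΦ.map_mul_map hi (b := star b) (by rw [hΦ.map_star, hb]) (star d)
  rw [hΦ.map_star, ← star_mul, ← star_mul, hΦ.map_star, hΦ.map_star] at h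
  exact star_injective h

end Idempotent

section ChoiEffrosProduct

open scoped InnerProductSpace ComplexConjugate

/-! ### Representing the product induced by an idempotent completely positive map -/

theorem exists_clm_of_inner {L : Type} [NormedAddCommGroup L] [InnerProductSpace ℂ L]
    (q : H →L[ℂ] H) (v : H → L) (hv : ∀ h k, ⟪v h, v k⟫_ℂ = ⟪h, q k⟫_ℂ) :
    ∃ T : H →L[ℂ] L, ∀ h, T h = v h := by
  have hlin : ∀ (c : ℂ) h k, v (c • h + k) = c • v h + v k := fun c h k => by
    have h1 : ⟪v (c • h + k) - (c • v h + v k), v (c • h + k) - (c • v h + v k)⟫_ℂ = 0 := by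
      simp only [inner_sub_left, inner_sub_right, inner_add_left, inner_add_right,
        inner_smul_left, inner_smul_right, hv, map_add, map_smul]
      ring
    exact sub_eq_zero.1 (inner_self_eq_zero.1 h1)
  have h0 : v 0 = 0 := by
    have h2 := hv 0 0
    simpa using h2
  let T : H →ₗ[ℂ] L :=
    { toFun := v
      map_add' := fun h k => by simpa using hlin 1 h k
      map_smul' := fun c h => by simpa [h0] using hlin c h 0 }
  refine ⟨T.mkContinuous (Real.sqrt ‖q‖) fun h => ?_, fun h => rfl⟩
  · refine (pow_le_pow_iff_left₀ (norm_nonneg _) (by positivity) two_ne_zero).1 ?_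
    rw [mul_pow, Real.sq_sqrt (norm_nonneg _), ← re_inner_self_complex]
    change (⟪v h, v h⟫_ℂ).re ≤ _
    rw [hv]
    calc (⟪h, q h⟫_ℂ).re ≤ ‖⟪h, q h⟫_ℂ‖ := Complex.re_le_norm _
      _ ≤ ‖h‖ * ‖q h‖ := norm_inner_le_norm _ _
      _ ≤ ‖h‖ * (‖q‖ * ‖h‖) := by
        gcongr
        exact q.le_opNorm h
      _ = ‖q‖ * ‖h‖ ^ 2 := by ring

theorem matBound_iff_matAcc {ι κ : Type} [Fintype ι] [Fintype κ] [DecidableEq κ]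
    (C : ι → κ → (H →L[ℂ] H)) (c : ℝ) :
    MatBound C c ↔ MatAcc fun j j' : κ =>
      (if j = j' then ((c ^ 2 : ℝ) : ℂ) • (1 : H →L[ℂ] H) else 0) -
        ∑ i, star (C i j) * C i j' := by
  refine forall_congr' fun ξ => ?_
  rw [← sub_nonneg]
  have h1 : ∀ i, ‖∑ j, C i j (ξ j)‖ ^ 2 =
      (∑ j, ∑ j', ⟪ξ j, (star (C i j) * C i j') (ξ j')⟫_ℂ).re := fun i => by
    rw [← re_inner_self_complex, sum_inner]
    simp only [inner_sum, mul_apply_eq_comp, ContinuousLinearMap.star_eq_adjoint,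
      ContinuousLinearMap.adjoint_inner_right]
  have h2 : (∑ j, ∑ j', ⟪ξ j, ((if j = j' then ((c ^ 2 : ℝ) : ℂ) • (1 : H →L[ℂ] H) else 0) -
        ∑ i, star (C i j) * C i j') (ξ j')⟫_ℂ).re =
      c ^ 2 * ∑ j, ‖ξ j‖ ^ 2 - ∑ i, ‖∑ j, C i j (ξ j)‖ ^ 2 := by
    simp only [h1]
    rw [← Complex.re_sum, Finset.sum_comm (s := Finset.univ (α := ι))]
    simp only [Finset.sum_comm (s := Finset.univ (α := ι))]
    simp only [sub_apply, inner_sub_right, Finset.sum_sub_distrib, Complex.sub_re, sum_apply,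
      inner_sum]
    congr 1
    have : ∀ j, ∑ j', ⟪ξ j, (if j = j' then ((c ^ 2 : ℝ) : ℂ) • (1 : H →L[ℂ] H) else 0)
        (ξ j')⟫_ℂ = ((c ^ 2 : ℝ) : ℂ) * ⟪ξ j, ξ j⟫_ℂ := fun j => by
      rw [Finset.sum_eq_single j]
      · simp
      · intro j' _ hne
        simp [hne.symm]
      · simp
    simp only [this, ← Finset.mul_sum]
    rw [Complex.re_ofReal_mul, Complex.re_sum]
    simp only [re_inner_self_complex]
  rw [h2]

theorem MatBound.compress {L : Type} [NormedAddCommGroup L] [InnerProductSpace ℂ L]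
    [CompleteSpace L] {ι κ : Type} [Fintype ι] [Fintype κ] {A : ι → κ → (L →L[ℂ] L)} {c : ℝ}
    (h : MatBound A c) (T : H →L[ℂ] L) (hT : ∀ x, ‖T x‖ ≤ ‖x‖) :
    MatBound (fun i j => (ContinuousLinearMap.adjoint T) ∘L (A i j) ∘L T) c := by
  intro ξ
  have h1 := h fun j => T (ξ j)
  have hT' : ∀ x, ‖ContinuousLinearMap.adjoint T x‖ ≤ ‖x‖ := fun x => by
    have h2 : ‖T‖ ≤ 1 := T.opNorm_le_bound zero_le_one (by simpa using hT)
    rw [← LinearIsometryEquiv.norm_map ContinuousLinearMap.adjoint] at h2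
    simpa using (ContinuousLinearMap.adjoint T).le_of_opNorm_le h2 x
  refine le_trans ?_ (h1.trans ?_)
  · refine Finset.sum_le_sum fun i _ => ?_
    simp only [ContinuousLinearMap.comp_apply]
    rw [← map_sum]
    exact pow_le_pow_left₀ (norm_nonneg _) (hT' _) 2
  · gcongr with j _
    exact hT _

/-- The kernel associated with a linear map on `B(H)`. -/
def endKernel (Φ : Module.End ℂ (H →L[ℂ] H)) (h k : H) : (H →L[ℂ] H) →ₗ[ℂ] ℂ where
  toFun a := ⟪h, Φ a k⟫_ℂ
  map_add' a b := by rw [map_add, add_apply, inner_add_right]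
  map_smul' c a := by rw [map_smul, smul_apply, inner_smul_right]; rfl

variable {Φ : Module.End ℂ (H →L[ℂ] H)}

theorem IsUCP.kernelPos (hΦ : IsUCP Φ) : KernelPos (endKernel Φ) := by
  classical
  intro t A hA
  have h1 := hΦ.acc t (fun h k => A h k) (fun ξ => by
    have h2 := hA (fun h => if hh : h ∈ t then ξ ⟨h, hh⟩ else 0)
    rw [← Finset.sum_coe_sort] at h2
    simpa [← Finset.sum_coe_sort t] using h2)
  have h3 := h1 fun h => h
  rw [Finset.sum_coe_sort t (fun h => ∑ k : t, ⟪h, Φ (A h k) k⟫_ℂ)] at h3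
  have h4 : ∀ h : H, ∑ k : t, ⟪h, Φ (A h k) k⟫_ℂ = ∑ k ∈ t, ⟪h, Φ (A h k) k⟫_ℂ :=
    fun h => Finset.sum_coe_sort t fun k => ⟪h, Φ (A h k) k⟫_ℂ
  simp only [h4] at h3
  exact h3

theorem IsUCP.endKernel_star (hΦ : IsUCP Φ) (h k : H) (a : H →L[ℂ] H) :
    endKernel Φ k h (star a) = conj (endKernel Φ h k a) := by
  change ⟪k, Φ (star a) h⟫_ℂ = conj ⟪h, Φ a k⟫_ℂ
  rw [hΦ.map_star, ContinuousLinearMap.star_eq_adjoint, ContinuousLinearMap.adjoint_inner_right,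
    inner_conj_symm]

theorem IsUCP.exists_representation (hΦ : IsUCP Φ) (hi : ∀ b, Φ (Φ b) = Φ b) {V : Type}
    [AddCommGroup V] [Module ℂ V] (j : V →ₗ[ℂ] (H →L[ℂ] H)) (hj : ∀ x, Φ (j x) = j x) :
    ∃ (K : Type) (_ : NormedAddCommGroup K) (_ : InnerProductSpace ℂ K) (_ : CompleteSpace K)
      (π : V →ₗ[ℂ] (K →L[ℂ] K)), (∀ e, j e = 1 → π e = 1) ∧
      (∀ (ι κ : Type) [Fintype ι] [Fintype κ] (A : ι → κ → V) (c : ℝ),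
        MatBound (fun i k => π (A i k)) c ↔ MatBound (fun i k => j (A i k)) c) ∧
      ∀ x y w, j w = Φ (j x * j y) → π w = π x * π y := by
  classical
  obtain ⟨L, _, _, _, v, ρ, hv, hρ⟩ := hΦ.kernelPos.exists_dilation hΦ.endKernel_star
  replace hv : ∀ h k a, ⟪v h, ρ a (v k)⟫_ℂ = ⟪h, Φ a k⟫_ℂ := hv
  obtain ⟨T₀, hT₀⟩ := exists_clm_of_inner 1 v fun h k => by
    simpa [hΦ.map_one] using hv h k 1
  let G : Set L := {x | ∃ a h, Φ a = a ∧ x = ρ a (v h)}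
  let K : Submodule ℂ L := (Submodule.span ℂ G).topologicalClosure
  have hGK : ∀ a h, Φ a = a → ρ a (v h) ∈ K := fun a h ha =>
    Submodule.le_topologicalClosure _ (Submodule.subset_span ⟨a, h, ha, rfl⟩)
  have hK : CompleteSpace K :=
    (Submodule.isClosed_topologicalClosure (Submodule.span ℂ G)).completeSpace_coe
  let S : K →L[ℂ] L := K.subtypeL
  let p : (H →L[ℂ] H) →ₗ[ℂ] (K →L[ℂ] K) :=
    { toFun := fun a => (ContinuousLinearMap.adjoint S) ∘L (ρ a) ∘L S
      map_add' := fun a b => by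
        ext x
        simp
      map_smul' := fun c a => by
        ext x
        simp }
  have hext : ∀ f g : K →L[ℂ] K, (∀ a h (ha : Φ a = a),
      f ⟨ρ a (v h), hGK a h ha⟩ = g ⟨ρ a (v h), hGK a h ha⟩) → f = g := by
    intro f g hfg
    have h1 : ∀ x ∈ Submodule.span ℂ G, ∀ hx : x ∈ K, f ⟨x, hx⟩ = g ⟨x, hx⟩ := by
      intro x hx
      induction hx using Submodule.span_induction with
      | mem x hx =>
        obtain ⟨a, h, ha, rfl⟩ := hx
        exact fun _ => hfg a h ha
      | zero =>
        intro hx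
        have : (⟨0, hx⟩ : K) = 0 := rfl
        rw [this, map_zero, map_zero]
      | add x y hx hy ihx ihy =>
        intro h
        have hx' := Submodule.le_topologicalClosure _ hx
        have hy' := Submodule.le_topologicalClosure _ hy
        have : (⟨x + y, h⟩ : K) = ⟨x, hx'⟩ + ⟨y, hy'⟩ := rfl
        rw [this, map_add, map_add, ihx hx', ihy hy']
      | smul c x hx ih =>
        intro h
        have hx' := Submodule.le_topologicalClosure _ hx
        have : (⟨c • x, h⟩ : K) = c • ⟨x, hx'⟩ := rfl
        rw [this, map_smul, map_smul, ih hx']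
    ext x
    congr 1
    have hd : Dense {x : K | (x : L) ∈ Submodule.span ℂ G} := by
      intro x
      rw [closure_subtype]
      have : (Subtype.val '' {x : K | (x : L) ∈ Submodule.span ℂ G}) = Submodule.span ℂ G := by
        ext y
        constructor
        · rintro ⟨z, hz, rfl⟩
          exact hz
        · exact fun hy => ⟨⟨y, Submodule.le_topologicalClosure _ hy⟩, hy, rfl⟩
      rw [this]
      exact x.2
    exact congrFun (Continuous.ext_on hd f.continuous g.continuous fun y hy => h1 y hy y.2) x
  have hp : ∀ c a h (ha : Φ a = a), p c ⟨ρ a (v h), hGK a h ha⟩ =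
      ⟨ρ (Φ (c * a)) (v h), hGK _ h (hi _)⟩ := by
    intro c a h ha
    have h1 : K ≤ (ℂ ∙ (ρ (c * a) (v h) - ρ (Φ (c * a)) (v h)))ᗮ := by
      refine Submodule.topologicalClosure_minimal _ (Submodule.span_le.2 ?_)
        (Submodule.isClosed_orthogonal _)
      rintro _ ⟨b, k, hb, rfl⟩
      rw [SetLike.mem_coe, Submodule.mem_orthogonal_singleton_iff_inner_left]
      have h2 : ∀ d, ⟪ρ b (v k), ρ d (v h)⟫_ℂ = ⟪k, Φ (star b * d) h⟫_ℂ := fun d => by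
        rw [← hv, map_mul, StarHomClass.map_star, mul_apply_eq_comp,
          ContinuousLinearMap.star_eq_adjoint,
          ContinuousLinearMap.adjoint_inner_right]
      rw [inner_sub_right, h2, h2, hΦ.map_mul_map hi (by rw [hΦ.map_star, hb]), sub_self]
    refine ext_inner_left ℂ fun z => ?_
    have h3 := Submodule.mem_orthogonal_singleton_iff_inner_left.1 (h1 z.2)
    rw [inner_sub_right, sub_eq_zero] at h3
    change ⟪z, ContinuousLinearMap.adjoint S (ρ c (ρ a (v h)))⟫_ℂ = ⟪(z : L), _⟫_ℂ
    rw [ContinuousLinearMap.adjoint_inner_right, ← mul_apply_eq_comp, ← map_mul]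
    exact h3
  have hpj : ∀ c, Φ c = c → ∀ h k, ⟪h, c k⟫_ℂ = ⟪v h, ρ c (v k)⟫_ℂ := fun c hc h k => by
    rw [hv, hc]
  refine ⟨K, inferInstance, inferInstance, hK, p ∘ₗ j, fun e he => ?_, fun ι κ _ _ A c => ⟨?_, ?_⟩,
    fun x y w hw => ?_⟩
  · refine hext _ _ fun a h ha => ?_
    simp [he, hp, ha]
  · intro h
    let T : H →L[ℂ] K := T₀.codRestrict K fun h => by
      have := hGK 1 h hΦ.map_one
      simpa [hT₀] using this
    have h1 := h.compress T fun x => le_of_eq (by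
      change ‖T₀ x‖ = ‖x‖
      refine (pow_left_inj₀ (norm_nonneg _) (norm_nonneg _) two_ne_zero).1 ?_
      rw [← re_inner_self_complex, ← re_inner_self_complex, hT₀]
      simpa [hΦ.map_one] using congrArg Complex.re (hv x x 1))
    convert h1 using 3 with i k
    refine ContinuousLinearMap.ext fun x => ext_inner_left ℂ fun y => ?_
    rw [hpj _ (hj _)]
    simp only [ContinuousLinearMap.comp_apply, ContinuousLinearMap.adjoint_inner_right, p,
      LinearMap.comp_apply, LinearMap.coe_mk, AddHom.coe_mk, ← hT₀]
    rfl
  · intro h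
    refine MatBound.compress ?_ S fun x => le_rfl
    rw [matBound_iff_matAcc] at h ⊢
    have h1 := hρ _ _ h
    convert h1 using 3 with i k
    rw [map_sub, map_sum]
    simp only [map_mul, StarHomClass.map_star]
    split_ifs <;> simp
  · refine hext _ _ fun a h ha => ?_
    have h2 : Φ (j w * a) = Φ (j x * Φ (j y * a)) := by
      rw [hw, hΦ.map_map_mul hi ha, hΦ.map_mul_map hi (hj x), mul_assoc]
    change p (j w) _ = p (j x) (p (j y) _)
    rw [hp _ _ _ ha, hp _ _ _ ha, hp _ _ _ (hi _)]
    simp only [h2]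

end ChoiEffrosProduct

section Cone

open scoped InnerProductSpace ComplexConjugate

/-! ### Extension of positive functionals to positive kernels -/

theorem LinearMap.exists_extend_of_re_nonneg {E N X : Type} [AddCommGroup E] [Module ℂ E]
    [AddCommGroup N] [Module ℂ N] (Q : X → (N →ₗ[ℂ] ℂ)) (p : E →ₗ[ℂ] N) (g : E →ₗ[ℂ] ℂ)
    (hpos : ∀ u, (∀ ξ, 0 ≤ (Q ξ (p u)).re) → 0 ≤ (g u).re)
    (hdom : ∀ y, ∃ u, ∀ ξ, 0 ≤ (Q ξ (p u + y)).re) :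
    ∃ F : N →ₗ[ℂ] ℂ, (∀ u, F (p u) = g u) ∧ ∀ y, (∀ ξ, 0 ≤ (Q ξ y).re) → 0 ≤ (F y).re := by
  let s : PointedCone ℝ N :=
    { carrier := {y | ∀ ξ, 0 ≤ (Q ξ y).re}
      add_mem' := fun {a b} ha hb ξ => by
        simpa using add_nonneg (ha ξ) (hb ξ)
      zero_mem' := fun ξ => by simp
      smul_mem' := fun c a ha ξ => by
        have h1 : Q ξ (c • a) = ((c : ℝ) : ℂ) * Q ξ a := by
          change Q ξ ((c : ℝ) • a) = _
          rw [← Complex.coe_smul, map_smul, smul_eq_mul]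
        rw [h1, Complex.re_ofReal_mul]
        exact mul_nonneg c.2 (ha ξ) }
  have hs : ∀ y, y ∈ s ↔ ∀ ξ, 0 ≤ (Q ξ y).re := fun y => Iff.rfl
  have hker : ∀ u, p u = 0 → (g u).re = 0 := fun u hu => by
    refine le_antisymm ?_ (hpos u fun ξ => by simp [hu])
    simpa using hpos (-u) fun ξ => by simp [hu]
  let g₀ : E →ₗ[ℝ] ℝ := Complex.reLm ∘ₗ g.restrictScalars ℝ
  let p₀ : E →ₗ[ℝ] N := p.restrictScalars ℝ
  have hg₀ : ∀ u u', p u = p u' → g₀ u = g₀ u' := fun u u' h => by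
    have h1 := hker (u - u') (by rw [map_sub, h, sub_self])
    rw [map_sub, Complex.sub_re, sub_eq_zero] at h1
    exact h1
  choose σ hσ using fun x : LinearMap.range p₀ => x.2
  let f : N →ₗ.[ℝ] ℝ :=
    { domain := LinearMap.range p₀
      toFun :=
        { toFun := fun x => g₀ (σ x)
          map_add' := fun x y => by
            rw [← map_add]
            refine hg₀ _ _ ?_
            rw [map_add]
            exact (hσ (x + y)).trans (congrArg₂ (· + ·) (hσ x) (hσ y)).symm
          map_smul' := fun c x => by
            rw [RingHom.id_apply, ← map_smul]
            refine hg₀ _ _ ((hσ (c • x)).trans ?_)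
            change _ = p₀ (c • σ x)
            rw [map_smul, hσ]
            rfl } }
  have hf : ∀ x : f.domain, f x = g₀ (σ x) := fun x => rfl
  obtain ⟨F, hF, hFs⟩ := riesz_extension s f (fun x hx => by
      rw [hf]
      refine hpos _ ?_
      rw [← hs]
      have := hσ x
      change p (σ x) = x at this
      rwa [this]) fun y => by
      obtain ⟨u, hu⟩ := hdom y
      exact ⟨⟨p u, u, rfl⟩, hu⟩
  have hFp : ∀ u, F (p u) = (g u).re := fun u => by
    have h1 := hF ⟨p u, u, rfl⟩
    rw [hf] at h1
    exact h1.trans (hg₀ _ _ (hσ ⟨p u, u, rfl⟩))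
  refine ⟨Module.Dual.extendRCLike (𝕜 := ℂ) F, fun u => ?_, fun y hy => ?_⟩
  · rw [Module.Dual.extendRCLike_apply]
    have h1 : F ((RCLike.I : ℂ) • p u) = -(g u).im := by
      rw [← map_smul, hFp, map_smul]
      simp
    rw [hFp, h1]
    apply Complex.ext <;> simp
  · have h1 := Module.Dual.re_extendRCLike_apply (𝕜 := ℂ) F y
    rw [RCLike.re_eq_complex_re] at h1
    rw [h1]
    exact hFs y hy

theorem KernelPos.map_star {I : Type} {F : I → I → ((H →L[ℂ] H) →ₗ[ℂ] ℂ)} (hF : KernelPos F)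
    (i j : I) (a : H →L[ℂ] H) : F j i (star a) = conj (F i j a) := by
  classical
  have hsum : ∀ (G : I → I → ((H →L[ℂ] H) →ₗ[ℂ] ℂ)) (b : H →L[ℂ] H),
      ∑ k ∈ {i, j}, ∑ l ∈ {i, j}, G k l ((if k = i then if l = j then b else 0 else 0) -
        (if k = j then if l = i then star b else 0 else 0)) = G i j b - G j i (star b) := by
    intro G b
    have h1 : ∀ (x y : I) (d : H →L[ℂ] H) (k l : I),
        G k l (if k = x then if l = y then d else 0 else 0) =
        if k = x then if l = y then G k l d else 0 else 0 := fun x y d k l => by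
      split_ifs <;> simp
    have h2 : ∀ (x y : I) (d : H →L[ℂ] H) (k : I),
        ∑ l ∈ {i, j}, (if k = x then if l = y then G k l d else 0 else 0) =
        if k = x then ∑ l ∈ {i, j}, if l = y then G k l d else 0 else 0 := fun x y d k => by
      split_ifs <;> simp
    simp only [map_sub, Finset.sum_sub_distrib, h1, h2, Finset.sum_ite_eq', Finset.mem_insert,
      Finset.mem_singleton, true_or, or_true, if_true]
  have key : ∀ b : H →L[ℂ] H, 0 ≤ (F i j b - F j i (star b)).re := fun b => by
    rw [← hsum F b]
    refine hF {i, j} _ fun ξ => ?_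
    have h1 := hsum (fun k l => (innerSL ℂ (ξ k)).toLinearMap ∘ₗ
      (ContinuousLinearMap.apply ℂ H (ξ l)).toLinearMap) b
    have h2 : (⟪ξ i, b (ξ j)⟫_ℂ - ⟪ξ j, star b (ξ i)⟫_ℂ).re = 0 := by
      rw [ContinuousLinearMap.star_eq_adjoint, ContinuousLinearMap.adjoint_inner_right,
        Complex.sub_re, ← inner_conj_symm (ξ i), Complex.conj_re, sub_self]
    exact le_of_eq (h2.symm.trans (congrArg Complex.re h1.symm))
  have hneg : ∀ b : H →L[ℂ] H, (F i j b - F j i (star b)).re = 0 := fun b => by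
    refine le_antisymm ?_ (key b)
    have := key (-b)
    simp only [map_neg, star_neg, Complex.sub_re, Complex.neg_re] at this ⊢
    linarith
  have h1 := hneg a
  have h2 := hneg (Complex.I • a)
  rw [star_smul, map_smul, map_smul] at h2
  simp at h1 h2
  apply Complex.ext
  · simp; linarith
  · simp; linarith

theorem exists_kernel_extension {M S : Type} [AddCommGroup M] [Module ℂ M] [Fintype S]
    (P : S → S → (M →ₗ[ℂ] (H →L[ℂ] H))) (r : M →ₗ[ℂ] (H →L[ℂ] H))
    (hunit : ∀ a, ∃ d, P a a d = 1 ∧ ∀ b c, ¬ (b = a ∧ c = a) → P b c d = 0)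
    (hpos : ∀ (t : Finset H) (u : t → t → M),
      MatAcc (fun i j : S × t => P i.1 j.1 (u i.2 j.2)) →
      0 ≤ (∑ h : t, ∑ k : t, ⟪(h : H), r (u h k) k⟫_ℂ).re) :
    ∃ F : S × H → S × H → ((H →L[ℂ] H) →ₗ[ℂ] ℂ), KernelPos F ∧
      ∀ h k m, ∑ a, ∑ b, F (a, h) (b, k) (P a b m) = ⟪h, r m k⟫_ℂ := by
  classical
  let ev : H → H → ((H →L[ℂ] H) →ₗ[ℂ] ℂ) := fun h k =>
    { toFun := fun g => ⟪h, g k⟫_ℂ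
      map_add' := fun a b => by rw [add_apply, inner_add_right]
      map_smul' := fun c a => by rw [smul_apply, inner_smul_right]; rfl }
  let Q : (S × H → H) → (((S × H) × (S × H) →₀ (H →L[ℂ] H)) →ₗ[ℂ] ℂ) := fun ξ =>
    Finsupp.lsum ℂ fun q => ev (ξ q.1) (ξ q.2)
  have hQ : ∀ ξ i j g, Q ξ (Finsupp.single (i, j) g) = ⟪ξ i, g (ξ j)⟫_ℂ := fun ξ i j g => by
    simp [Q, ev]
  let p : ((H × H) →₀ M) →ₗ[ℂ] ((S × H) × (S × H) →₀ (H →L[ℂ] H)) :=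
    Finsupp.lsum ℂ fun q => ∑ a, ∑ b, Finsupp.lsingle ((a, q.1), (b, q.2)) ∘ₗ P a b
  have hp : ∀ h k m, p (Finsupp.single (h, k) m) =
      ∑ a, ∑ b, Finsupp.single ((a, h), (b, k)) (P a b m) := fun h k m => by
    simp [p]
  let g : ((H × H) →₀ M) →ₗ[ℂ] ℂ := Finsupp.lsum ℂ fun q => ev q.1 q.2 ∘ₗ r
  have hg : ∀ h k m, g (Finsupp.single (h, k) m) = ⟪h, r m k⟫_ℂ := fun h k m => by
    simp [g, ev]
  have hdecomp : ∀ u : (H × H) →₀ M, ∃ t : Finset H,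
      u = ∑ h ∈ t, ∑ k ∈ t, Finsupp.single (h, k) (u (h, k)) := fun u => by
    refine ⟨u.support.image Prod.fst ∪ u.support.image Prod.snd, ?_⟩
    rw [← Finset.sum_product']
    conv_lhs => rw [← u.sum_single]
    refine Finset.sum_subset (fun q hq => ?_) fun q _ hq => ?_
    · rw [Finset.mem_product]
      exact ⟨Finset.mem_union_left _ (Finset.mem_image_of_mem _ hq),
        Finset.mem_union_right _ (Finset.mem_image_of_mem _ hq)⟩
    · simp [Finsupp.notMem_support_iff.1 hq]
  have hupos : ∀ u, (∀ ξ, 0 ≤ (Q ξ (p u)).re) → 0 ≤ (g u).re := by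
    intro u hu
    obtain ⟨t, ht⟩ := hdecomp u
    have h1 := hpos t (fun h k => u (h, k)) fun ξ => by
      have h2 := hu fun q => if hq : q.2 ∈ t then ξ (q.1, ⟨q.2, hq⟩) else 0
      rw [ht] at h2
      simp only [map_sum, hp, hQ] at h2
      rw [← Finset.sum_coe_sort] at h2
      simp only [← Finset.sum_coe_sort t] at h2
      have hξ : ∀ a (i : t), (if h : (i : H) ∈ t then ξ (a, ⟨i, h⟩) else 0) = ξ (a, i) :=
        fun a i => dif_pos i.2
      simp only [hξ] at h2
      rw [Finset.sum_comm_pair] at h2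
      simp only [Fintype.sum_prod_type]
      convert h2 using 4 with a _
      rw [Finset.sum_comm]
    rw [ht]
    simp only [map_sum, hg]
    rw [← Finset.sum_coe_sort]
    simp only [← Finset.sum_coe_sort t]
    exact h1
  have hdom : ∀ y, ∃ u, ∀ ξ, 0 ≤ (Q ξ (p u + y)).re := by
    intro y
    induction y using Finsupp.induction_linear with
    | zero => exact ⟨0, fun ξ => by simp⟩
    | add y z hy hz =>
      obtain ⟨u, hu⟩ := hy
      obtain ⟨v, hv⟩ := hz
      refine ⟨u + v, fun ξ => ?_⟩
      have h1 := add_nonneg (hu ξ) (hv ξ)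
      rw [← Complex.add_re, ← map_add] at h1
      rwa [p.map_add, add_add_add_comm]
    | single q x =>
      obtain ⟨⟨a, h⟩, ⟨b, k⟩⟩ := q
      obtain ⟨d, hd, hd'⟩ := hunit a
      obtain ⟨d', hb, hb'⟩ := hunit b
      have hpd : ∀ a h d (c : ℂ), P a a d = 1 → (∀ b c, ¬ (b = a ∧ c = a) → P b c d = 0) →
          ∀ ξ, Q ξ (p (Finsupp.single (h, h) (c • d))) = c * ⟪ξ (a, h), ξ (a, h)⟫_ℂ := by
        intro a h d c hd hd' ξ
        rw [hp]
        simp only [map_sum, hQ]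
        rw [Finset.sum_eq_single a, Finset.sum_eq_single a]
        · simp [hd]
        · intro b _ hb
          simp [hd' a b fun h => hb h.2]
        · simp
        · intro b _ hb
          exact Finset.sum_eq_zero fun c _ => by simp [hd' b c fun h => hb h.1]
        · simp
      refine ⟨Finsupp.single (h, h) ((‖x‖ : ℂ) • d) + Finsupp.single (k, k) ((‖x‖ : ℂ) • d'),
        fun ξ => ?_⟩
      rw [map_add, map_add, map_add, hpd _ _ _ _ hd hd', hpd _ _ _ _ hb hb', hQ]
      simp only [Complex.add_re, Complex.re_ofReal_mul, re_inner_self_complex]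
      have h1 : -(‖ξ (a, h)‖ * (‖x‖ * ‖ξ (b, k)‖)) ≤ (⟪ξ (a, h), x (ξ (b, k))⟫_ℂ).re := by
        refine (abs_le.1 ((Complex.abs_re_le_norm _).trans ((norm_inner_le_norm _ _).trans ?_))).1
        gcongr
        exact x.le_opNorm _
      nlinarith [mul_nonneg (norm_nonneg x) (sq_nonneg (‖ξ (a, h)‖ - ‖ξ (b, k)‖)),
        mul_nonneg (norm_nonneg x) (add_nonneg (sq_nonneg ‖ξ (a, h)‖) (sq_nonneg ‖ξ (b, k)‖))]
  obtain ⟨F, hF, hFpos⟩ := LinearMap.exists_extend_of_re_nonneg Q p g hupos hdom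
  refine ⟨fun i j => F ∘ₗ Finsupp.lsingle (i, j), fun t A hA => ?_, fun h k m => ?_⟩
  · have h1 := hFpos (∑ i ∈ t, ∑ j ∈ t, Finsupp.single (i, j) (A i j)) fun ξ => by
      simpa [map_sum, hQ] using hA ξ
    simpa [map_sum] using h1
  · have h1 := hF (Finsupp.single (h, k) m)
    rw [hp, hg] at h1
    simpa [map_sum] using h1

end Cone

section Homogenization

open scoped InnerProductSpace ComplexConjugate ComplexOrder

/-! ### Positivity of the functional attached to a homogenized contraction -/

section ScalarAction

variable {ι κ μ : Type} [Fintype ι] [Fintype κ] [Fintype μ]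

/-- The action of a scalar matrix on tuples of vectors. -/
def scalarAct {W : Type} [AddCommGroup W] [Module ℂ W] (R : Matrix ι κ ℂ) (ξ : κ → W) : ι → W :=
  fun i => ∑ j, R i j • ξ j

theorem scalarAct_scalarAct {W : Type} [AddCommGroup W] [Module ℂ W] (R : Matrix ι κ ℂ)
    (S : Matrix κ μ ℂ) (ξ : μ → W) :
    scalarAct R (scalarAct S ξ) = scalarAct (R * S) ξ := by
  funext i
  simp only [scalarAct, Matrix.mul_apply, Finset.smul_sum, Finset.sum_smul, smul_smul]
  exact Finset.sum_comm

theorem scalarAct_one [DecidableEq ι] {W : Type} [AddCommGroup W] [Module ℂ W] (ξ : ι → W) :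
    scalarAct 1 ξ = ξ := by
  funext i
  simp [scalarAct, Matrix.one_apply]

open scoped MatrixOrder in
theorem exists_factor [Nontrivial H] [DecidableEq ι] (C : Matrix ι ι ℂ)
    (hC : ∀ ξ : ι → H, 0 ≤ (∑ i, ∑ k, C i k * ⟪ξ i, ξ k⟫_ℂ).re) {ε : ℝ} (hε : 0 < ε) :
    ∃ R S : Matrix ι ι ℂ, R * S = 1 ∧ S * R = 1 ∧ ∀ ξ : ι → H,
      (∑ i, ∑ k, C i k * ⟪ξ i, ξ k⟫_ℂ).re + ε * ∑ i, ‖ξ i‖ ^ 2 =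
        ∑ i, ‖scalarAct R ξ i‖ ^ 2 := by
  have hherm : ∀ ξ : ι → H, (∑ i, ∑ k, ((1 / 2 : ℂ) • (C + C.conjTranspose)) i k * ⟪ξ i, ξ k⟫_ℂ) =
      ((∑ i, ∑ k, C i k * ⟪ξ i, ξ k⟫_ℂ).re : ℂ) := fun ξ => by
    rw [Complex.re_eq_add_conj, map_sum]
    simp only [map_sum, map_mul, inner_conj_symm]
    rw [Finset.sum_comm (f := fun i k => conj (C i k) * _), ← Finset.sum_add_distrib,
      Finset.sum_div]
    refine Finset.sum_congr rfl fun i _ => ?_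
    rw [← Finset.sum_add_distrib, Finset.sum_div]
    refine Finset.sum_congr rfl fun k _ => ?_
    simp only [Matrix.smul_apply, Matrix.add_apply, Matrix.conjTranspose_apply, smul_eq_mul,
      RCLike.star_def]
    ring
  obtain ⟨e, he⟩ := exists_norm_eq H zero_le_one
  have hpsd : ((1 / 2 : ℂ) • (C + C.conjTranspose)).PosSemidef := by
    refine Matrix.PosSemidef.of_dotProduct_mulVec_nonneg ?_ fun a => ?_
    · rw [Matrix.IsHermitian, Matrix.conjTranspose_smul, Matrix.conjTranspose_add,
        Matrix.conjTranspose_conjTranspose, add_comm]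
      simp
    · have h1 := hherm fun i => a i • e
      have h2 := hC fun i => a i • e
      have h3 : star a ⬝ᵥ (((1 / 2 : ℂ) • (C + C.conjTranspose)).mulVec a) =
          ∑ i, ∑ k, ((1 / 2 : ℂ) • (C + C.conjTranspose)) i k * ⟪a i • e, a k • e⟫_ℂ := by
        simp only [dotProduct, Matrix.mulVec, Finset.mul_sum]
        refine Finset.sum_congr rfl fun i _ => Finset.sum_congr rfl fun k _ => ?_
        rw [inner_smul_left, inner_smul_right, inner_self_eq_norm_sq_to_K, he]
        simp
        ring
      rw [h3, h1]
      exact_mod_cast h2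
  have hpd : ((1 / 2 : ℂ) • (C + C.conjTranspose) + (ε : ℂ) • 1).PosDef := by
    refine Matrix.PosDef.posSemidef_add hpsd ?_
    exact Matrix.PosDef.one.smul (by exact_mod_cast hε)
  obtain ⟨R, hR⟩ := CStarAlgebra.nonneg_iff_eq_star_mul_self.1 hpd.posSemidef.nonneg
  have hRu : IsUnit R := by
    have h1 := hpd.isUnit
    rw [hR, Matrix.isUnit_iff_isUnit_det, Matrix.det_mul, IsUnit.mul_iff] at h1
    exact (Matrix.isUnit_iff_isUnit_det R).2 h1.2
  have hdet := (Matrix.isUnit_iff_isUnit_det R).1 hRu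
  refine ⟨R, R⁻¹, Matrix.mul_nonsing_inv R hdet, Matrix.nonsing_inv_mul R hdet, fun ξ => ?_⟩
  have h1 : (((∑ i, ∑ k, C i k * ⟪ξ i, ξ k⟫_ℂ).re + ε * ∑ i, ‖ξ i‖ ^ 2 : ℝ) : ℂ) =
      ∑ i, ∑ k, (star R * R) i k * ⟪ξ i, ξ k⟫_ℂ := by
    rw [← hR, Complex.ofReal_add, ← hherm]
    simp only [Matrix.add_apply, add_mul, Finset.sum_add_distrib]
    congr 1
    simp [Matrix.one_apply, Finset.mul_sum, inner_self_eq_norm_sq_to_K]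
  have h2 : ((∑ i, ‖scalarAct R ξ i‖ ^ 2 : ℝ) : ℂ) =
      ∑ i, ∑ k, (star R * R) i k * ⟪ξ i, ξ k⟫_ℂ := by
    have : ∀ i, ((‖scalarAct R ξ i‖ ^ 2 : ℝ) : ℂ) = ⟪scalarAct R ξ i, scalarAct R ξ i⟫_ℂ :=
      fun i => by
        rw [inner_self_eq_norm_sq_to_K]
        simp
    rw [Complex.ofReal_sum]
    simp only [this]
    simp only [scalarAct, sum_inner, inner_sum, inner_smul_left,
      inner_smul_right, Matrix.mul_apply, Finset.sum_mul, Matrix.star_apply, Finset.mul_sum]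
    rw [Finset.sum_comm]
    conv_rhs => rw [Finset.sum_comm]
    refine Finset.sum_congr rfl fun i _ => ?_
    rw [Finset.sum_comm]
    refine Finset.sum_congr rfl fun k _ => Finset.sum_congr rfl fun l _ => ?_
    rw [RCLike.star_def]
    ring
  exact_mod_cast h1.trans h2.symm

/-- The congruence `Sᴴ G T` of a matrix with entries in a vector space by scalar matrices. -/
def scalarConj {W : Type} [AddCommGroup W] [Module ℂ W] (S T : Matrix ι ι ℂ) (G : ι → ι → W) :
    ι → ι → W :=
  fun i l => ∑ j, ∑ k, (conj (S j i) * T k l) • G j k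

theorem inner_scalarConj (S T : Matrix ι ι ℂ) (G : ι → ι → (H →L[ℂ] H)) (η η' : ι → H) :
    ∑ i, ∑ l, ⟪η i, scalarConj S T G i l (η' l)⟫_ℂ =
      ∑ j, ∑ k, ⟪scalarAct S η j, G j k (scalarAct T η' k)⟫_ℂ := by
  simp only [scalarConj, scalarAct, sum_apply, smul_apply, map_sum, map_smul, sum_inner, inner_sum,
    inner_smul_left, inner_smul_right, Finset.mul_sum]
  rw [Finset.sum_comm_pair]
  refine Finset.sum_congr rfl fun j _ => Finset.sum_congr rfl fun k _ => ?_
  rw [Finset.sum_comm]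
  refine Finset.sum_congr rfl fun i _ => Finset.sum_congr rfl fun l _ => ?_
  ring

theorem map_scalarConj {W W' : Type} [AddCommGroup W] [Module ℂ W] [AddCommGroup W'] [Module ℂ W']
    (f : W →ₗ[ℂ] W') (S T : Matrix ι ι ℂ) (G : ι → ι → W) (i l : ι) :
    f (scalarConj S T G i l) = scalarConj S T (fun j k => f (G j k)) i l := by
  simp [scalarConj, map_sum]

theorem scalarConj_smul_add {W : Type} [AddCommGroup W] [Module ℂ W] (S T : Matrix ι ι ℂ)
    (α β : ι → ι → ℂ) (x y : W) (i l : ι) :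
    scalarConj S T (fun j k => α j k • x + β j k • y) i l =
      scalarConj S T α i l • x + scalarConj S T β i l • y := by
  simp only [scalarConj, Finset.sum_smul, smul_add, Finset.sum_add_distrib, smul_smul, smul_eq_mul]

end ScalarAction

section Homogenized

variable {V : Type} [AddCommGroup V] [Module ℂ V] (j : V →ₗ[ℂ] (H →L[ℂ] H))

/-- The column of a homogenized matrix `α ⊗ a + β ⊗ b` and a matrix `z`. -/
def homogMatrix {ι κ : Type} (a b : V) (α β : ι → ι → ℂ) (z : κ → ι → V) : ι ⊕ κ → ι → V :=
  fun r i => r.elim (fun i' => α i' i • a + β i' i • b) fun l => z l i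

/-- Multiplication of the homogenized columns by `diag(x, …, x, c e, …, c e)` is bounded by `c`. -/
def IsHomogContraction (e x y w : V) (c : ℝ) : Prop :=
  ∀ (ι κ : Type) [Fintype ι] [Fintype κ] (α β : ι → ι → ℂ) (z : κ → ι → V) (b : ℝ), 0 ≤ b →
    MatBound (fun r i => j (homogMatrix e y α β z r i)) b →
    MatBound (fun r i => j (homogMatrix x w α β ((c : ℂ) • z) r i)) (c * b)

variable {j}

theorem IsHomogContraction.re_nonneg {e x y w : V} {c : ℝ} (hg : IsHomogContraction j e x y w c)
    (hc : 0 < c) {ι : Type} [Fintype ι] (C₀ C₁ C₂ : Matrix ι ι ℂ) (α β : ι → ι → ℂ)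
    (z : ι → ι → V)
    (hacc : ∀ ξ₀ ξ₁ ξ₂ : ι → H, 0 ≤ (∑ i, ∑ k, C₀ i k * ⟪ξ₀ i, ξ₀ k⟫_ℂ).re +
      (∑ i, ∑ k, C₁ i k * ⟪ξ₁ i, ξ₁ k⟫_ℂ).re + (∑ i, ∑ k, C₂ i k * ⟪ξ₂ i, ξ₂ k⟫_ℂ).re +
      (∑ i, ∑ k, ⟪ξ₀ i, j (α i k • e + β i k • y) (ξ₂ k)⟫_ℂ).re +
      (∑ i, ∑ k, ⟪ξ₁ i, j (z i k) (ξ₂ k)⟫_ℂ).re) (h : ι → H) :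
    0 ≤ c ^ 2 * (∑ i, ∑ k, C₀ i k * ⟪h i, h k⟫_ℂ).re +
      (∑ i, ∑ k, C₁ i k * ⟪h i, h k⟫_ℂ).re + (∑ i, ∑ k, C₂ i k * ⟪h i, h k⟫_ℂ).re +
      (∑ i, ∑ k, ⟪h i, j (α i k • x + β i k • w) (h k)⟫_ℂ).re +
      (∑ i, ∑ k, ⟪h i, j (z i k) (h k)⟫_ℂ).re := by
  classical
  rcases subsingleton_or_nontrivial H with hH | hH
  · simp [Subsingleton.elim (h _) 0]
  set s := ∑ i, ‖h i‖ ^ 2 with hs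
  have hs0 : 0 ≤ s := Finset.sum_nonneg fun i _ => sq_nonneg _
  refine le_of_forall_pos_le_add fun δ hδ => ?_
  have hε : 0 < δ / ((c ^ 2 + 2) * s + 1) := by positivity
  set ε := δ / ((c ^ 2 + 2) * s + 1) with hε'
  have hεδ : ε * ((c ^ 2 + 2) * s) ≤ δ := by
    have h1 : ε * ((c ^ 2 + 2) * s + 1) = δ := div_mul_cancel₀ _ (by positivity)
    nlinarith
  obtain ⟨R₀, S₀, hRS₀, hSR₀, hC₀⟩ := exists_factor (H := H) C₀
    (fun ξ => by simpa using hacc ξ 0 0) hε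
  obtain ⟨R₁, S₁, hRS₁, hSR₁, hC₁⟩ := exists_factor (H := H) C₁
    (fun ξ => by simpa using hacc 0 ξ 0) hε
  obtain ⟨R₂, S₂, hRS₂, hSR₂, hC₂⟩ := exists_factor (H := H) C₂
    (fun ξ => by simpa using hacc 0 0 ξ) hε
  have hRS : ∀ {R S : Matrix ι ι ℂ}, R * S = 1 → ∀ ξ : ι → H, scalarAct R (scalarAct S ξ) = ξ :=
    fun hR ξ => by rw [scalarAct_scalarAct, hR, scalarAct_one]
  let α' := scalarConj S₀ S₂ α
  let β' := scalarConj S₀ S₂ β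
  let z' := scalarConj S₁ S₂ z
  have hY : ∀ (a b : V) (η η' : ι → H), ∑ i, ∑ k, ⟪η i, j (α' i k • a + β' i k • b) (η' k)⟫_ℂ =
      ∑ i, ∑ k, ⟪scalarAct S₀ η i, j (α i k • a + β i k • b) (scalarAct S₂ η' k)⟫_ℂ :=
    fun a b η η' => by
      simp only [α', β', ← scalarConj_smul_add, map_scalarConj]
      exact inner_scalarConj _ _ _ _ _
  have hZ : ∀ η η' : ι → H, ∑ i, ∑ k, ⟪η i, j (z' i k) (η' k)⟫_ℂ =
      ∑ i, ∑ k, ⟪scalarAct S₁ η i, j (z i k) (scalarAct S₂ η' k)⟫_ℂ := fun η η' => by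
    simp only [z', map_scalarConj]
    exact inner_scalarConj _ _ _ _ _
  have hpos : ∀ η₀ η₁ η₂ : ι → H, 0 ≤ ∑ i, ‖η₀ i‖ ^ 2 + ∑ i, ‖η₁ i‖ ^ 2 + ∑ i, ‖η₂ i‖ ^ 2 +
      (∑ i, ⟪η₀ i, ∑ k, j (α' i k • e + β' i k • y) (η₂ k)⟫_ℂ).re +
      (∑ i, ⟪η₁ i, ∑ k, j (z' i k) (η₂ k)⟫_ℂ).re := fun η₀ η₁ η₂ => by
    have h1 := hacc (scalarAct S₀ η₀) (scalarAct S₁ η₁) (scalarAct S₂ η₂)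
    rw [← hY, ← hZ] at h1
    have h2 := hC₀ (scalarAct S₀ η₀)
    have h3 := hC₁ (scalarAct S₁ η₁)
    have h4 := hC₂ (scalarAct S₂ η₂)
    rw [hRS hRS₀] at h2
    rw [hRS hRS₁] at h3
    rw [hRS hRS₂] at h4
    have hn : ∀ ξ : ι → H, 0 ≤ ε * ∑ i, ‖ξ i‖ ^ 2 := fun ξ =>
      mul_nonneg hε.le (Finset.sum_nonneg fun i _ => sq_nonneg _)
    simp only [inner_sum]
    linarith [hn (scalarAct S₀ η₀), hn (scalarAct S₁ η₁), hn (scalarAct S₂ η₂)]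
  have hb : MatBound (fun r i => j (homogMatrix e y α' β' z' r i)) 2 := fun η => by
    rw [Fintype.sum_sum_type]
    simp only [homogMatrix, Sum.elim_inl, Sum.elim_inr]
    have h1 := hpos (fun i => (-(1 / 2) : ℂ) • ∑ k, j (α' i k • e + β' i k • y) (η k))
      (fun i => (-(1 / 2) : ℂ) • ∑ k, j (z' i k) (η k)) η
    simp only [norm_smul, inner_smul_left, Complex.re_sum] at h1
    have h2 : ∀ u : H, (conj (-(1 / 2) : ℂ) * ⟪u, u⟫_ℂ).re = -(1 / 2) * ‖u‖ ^ 2 := fun u => by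
      rw [← re_inner_self_complex]
      simp
    have h3 : ‖(-(1 / 2) : ℂ)‖ ^ 2 = 1 / 4 := by norm_num
    simp only [h2, mul_pow, ← Finset.mul_sum, h3] at h1
    linarith
  have hb' := hg ι ι α' β' z' 2 zero_le_two hb (scalarAct R₂ h)
  rw [Fintype.sum_sum_type] at hb'
  simp only [homogMatrix, Sum.elim_inl, Sum.elim_inr, Pi.smul_apply] at hb'
  have hcz : ∀ i, ‖∑ k, j ((c : ℂ) • z' i k) (scalarAct R₂ h k)‖ ^ 2 =
      c ^ 2 * ‖∑ k, j (z' i k) (scalarAct R₂ h k)‖ ^ 2 := fun i => by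
    simp only [map_smul, smul_apply, ← Finset.smul_sum, norm_smul, mul_pow, Complex.norm_real,
      Real.norm_eq_abs, sq_abs]
  simp only [hcz, ← Finset.mul_sum] at hb'
  have h1 := hC₀ h
  have h2 := hC₁ h
  have h3 := hC₂ h
  have h4 := hY x w (scalarAct R₀ h) (scalarAct R₂ h)
  have h5 := hZ (scalarAct R₁ h) (scalarAct R₂ h)
  rw [hRS hSR₀, hRS hSR₂] at h4
  rw [hRS hSR₁, hRS hSR₂] at h5
  have hre : ∀ (R : ι → H) (G : ι → ι → H) (q : ℂ), ∑ i, ∑ k, ⟪R i, G i k⟫_ℂ = q →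
      q.re = ∑ i, (⟪R i, ∑ k, G i k⟫_ℂ).re := fun R G q hq => by
    simp only [← hq, Complex.re_sum, inner_sum]
  rw [hre _ _ _ h4, hre _ _ _ h5]
  have hyoung : ∀ (d : ℝ) (_ : 0 < d) (u v : ι → H),
      -(d * ∑ i, ‖u i‖ ^ 2 + 1 / (4 * d) * ∑ i, ‖v i‖ ^ 2) ≤ ∑ i, (⟪u i, v i⟫_ℂ).re :=
    fun d hd u v => by
      rw [Finset.mul_sum, Finset.mul_sum, ← Finset.sum_add_distrib, ← Finset.sum_neg_distrib]
      refine Finset.sum_le_sum fun i _ => ?_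
      have h6 := (abs_le.1 ((Complex.abs_re_le_norm _).trans (norm_inner_le_norm (𝕜 := ℂ)
        (u i) (v i)))).1
      have h7 : d * ‖u i‖ ^ 2 + 1 / (4 * d) * ‖v i‖ ^ 2 - ‖u i‖ * ‖v i‖ =
          d * (‖u i‖ - 1 / (2 * d) * ‖v i‖) ^ 2 := by
        field_simp
        ring
      nlinarith [mul_nonneg hd.le (sq_nonneg (‖u i‖ - 1 / (2 * d) * ‖v i‖))]
  have h6 := hyoung (c ^ 2) (by positivity) (scalarAct R₀ h)
    fun i => ∑ k, j (α' i k • x + β' i k • w) (scalarAct R₂ h k)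
  have h7 := hyoung 1 one_pos (scalarAct R₁ h) fun i => ∑ k, j (z' i k) (scalarAct R₂ h k)
  set X := ∑ i, ‖∑ k, j (α' i k • x + β' i k • w) (scalarAct R₂ h k)‖ ^ 2
  set Z := ∑ i, ‖∑ k, j (z' i k) (scalarAct R₂ h k)‖ ^ 2
  have h8 : 1 / (4 * c ^ 2) * X + 1 / 4 * Z ≤ ∑ i, ‖scalarAct R₂ h i‖ ^ 2 := by
    have h9 : 1 / (4 * c ^ 2) * X + 1 / 4 * Z = (X + c ^ 2 * Z) / (4 * c ^ 2) := by
      field_simp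
    rw [h9, div_le_iff₀ (by positivity)]
    linarith
  have h9 := congrArg (c ^ 2 * ·) h1
  simp only [← hs] at h9 h2 h3
  linarith

end Homogenized

end Homogenization

section Extension

open scoped InnerProductSpace ComplexConjugate

variable {V : Type} [AddCommGroup V] [Module ℂ V] {j : V →ₗ[ℂ] (H →L[ℂ] H)}

/-- The matrix of linear maps sending `((C₀, C₁, C₂, α, β), z)` to
`[[C₀, 0, α + β b], [0, C₁, j z], [0, 0, C₂]]`. -/
def homogPencil (j : V →ₗ[ℂ] (H →L[ℂ] H)) (b : H →L[ℂ] H) :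
    Fin 3 → Fin 3 → ((Fin 5 → ℂ) × V →ₗ[ℂ] (H →L[ℂ] H)) :=
  let p : Fin 5 → (Fin 5 → ℂ) × V →ₗ[ℂ] ℂ := fun a => LinearMap.proj a ∘ₗ LinearMap.fst ℂ _ _
  ![![(p 0).smulRight 1, 0, (p 3).smulRight 1 + (p 4).smulRight b],
    ![0, (p 1).smulRight 1, j ∘ₗ LinearMap.snd ℂ _ _], ![0, 0, (p 2).smulRight 1]]

/-- The linear map sending `((C₀, C₁, C₂, α, β), z)` to
`c² C₀ + C₁ + C₂ + α a + β b + j z`. -/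
def homogValue (j : V →ₗ[ℂ] (H →L[ℂ] H)) (a b : H →L[ℂ] H) (c : ℝ) :
    (Fin 5 → ℂ) × V →ₗ[ℂ] (H →L[ℂ] H) :=
  let p : Fin 5 → (Fin 5 → ℂ) × V →ₗ[ℂ] ℂ := fun a => LinearMap.proj a ∘ₗ LinearMap.fst ℂ _ _
  (p 0).smulRight (((c : ℂ) ^ 2) • 1) + (p 1).smulRight 1 + (p 2).smulRight 1 +
    (p 3).smulRight a + (p 4).smulRight b + j ∘ₗ LinearMap.snd ℂ _ _

theorem IsHomogContraction.exists_kernel {e x y w : V} {c : ℝ} (he : j e = 1)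
    (hg : IsHomogContraction j e x y w c) (hc : 0 < c) :
    ∃ F : Fin 3 × H → Fin 3 × H → ((H →L[ℂ] H) →ₗ[ℂ] ℂ), KernelPos F ∧
      ∀ h k m, ∑ a, ∑ b, F (a, h) (b, k) (homogPencil j (j y) a b m) =
        ⟪h, homogValue j (j x) (j w) c m k⟫_ℂ := by
  refine exists_kernel_extension _ _ (fun a => ?_) fun t u hu => ?_
  · refine ⟨(Pi.single (Fin.castLE (by norm_num) a) 1, 0), ?_, fun b c hbc => ?_⟩
    · fin_cases a <;> simp [homogPencil]
    · fin_cases a <;> fin_cases b <;> fin_cases c <;> simp [homogPencil, Fin.ext_iff] at hbc ⊢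
  · have h1 := hg.re_nonneg hc (fun i k => (u i k).1 0) (fun i k => (u i k).1 1)
      (fun i k => (u i k).1 2) (fun i k => (u i k).1 3) (fun i k => (u i k).1 4)
      (fun i k => (u i k).2) (fun ξ₀ ξ₁ ξ₂ => ?_) (fun i => (i : H))
    · refine h1.trans (le_of_eq ?_)
      have hcc : ∀ z : ℂ, c ^ 2 * z.re = ((c : ℂ) ^ 2 * z).re := fun z => by
        rw [← Complex.ofReal_pow, Complex.re_ofReal_mul]
      rw [hcc]
      simp only [← Complex.add_re, Finset.mul_sum, ← Finset.sum_add_distrib]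
      congr 1
      refine Finset.sum_congr rfl fun h _ => Finset.sum_congr rfl fun k _ => ?_
      simp [homogValue]
      ring
    · have h2 := hu fun i => ![ξ₀, ξ₁, ξ₂] i.1 i.2
      refine h2.trans (le_of_eq ?_)
      simp only [Fintype.sum_prod_type, Fin.sum_univ_three]
      simp only [← Complex.add_re, ← Finset.sum_add_distrib]
      congr 1
      refine Finset.sum_congr rfl fun h _ => Finset.sum_congr rfl fun k _ => ?_
      simp [homogPencil, he]
      ring

theorem IsHomogContraction.exists_extension {e x y w : V} {c : ℝ} (he : j e = 1)
    (hg : IsHomogContraction j e x y w c) (hc : 0 < c) :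
    ∃ (L : Type) (_ : NormedAddCommGroup L) (_ : InnerProductSpace ℂ L) (_ : CompleteSpace L)
      (S T : H →L[ℂ] L) (ρ : (H →L[ℂ] H) →⋆ₐ[ℂ] (L →L[ℂ] L)),
      (∀ (κ : Type) [Fintype κ] (A : κ → κ → (H →L[ℂ] H)), MatAcc A →
        MatAcc fun i j => ρ (A i j)) ∧
      (∀ h k v, ⟪T h, ρ (j v) (T k)⟫_ℂ = ⟪h, j v k⟫_ℂ) ∧
      (∀ h k, ⟪S h, ρ (j y) (T k)⟫_ℂ = ⟪h, j w k⟫_ℂ) ∧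
      ∀ h k, ⟪S h, T k⟫_ℂ = ⟪h, j x k⟫_ℂ := by
  obtain ⟨F, hF, hval⟩ := hg.exists_kernel he hc
  obtain ⟨L, _, _, _, v, ρ, hv, hρ⟩ := hF.exists_dilation hF.map_star
  have hv1 : ∀ i k, ⟪v i, v k⟫_ℂ = F i k 1 := fun i k => by
    rw [← hv, map_one, one_apply_eq_self]
  have h0 : ∀ h k, ⟪v (0, h), v (0, k)⟫_ℂ = ⟪h, (((c : ℂ) ^ 2) • (1 : H →L[ℂ] H)) k⟫_ℂ :=
    fun h k => by
      rw [hv1]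
      simpa [Fin.sum_univ_three, homogPencil, homogValue] using hval h k (Pi.single 0 1, 0)
  have h1 : ∀ h k, ⟪v (1, h), v (1, k)⟫_ℂ = ⟪h, k⟫_ℂ := fun h k => by
    rw [hv1]
    simpa [Fin.sum_univ_three, homogPencil, homogValue] using hval h k (Pi.single 1 1, 0)
  have h2 : ∀ h k, ⟪v (2, h), v (2, k)⟫_ℂ = ⟪h, k⟫_ℂ := fun h k => by
    rw [hv1]
    simpa [Fin.sum_univ_three, homogPencil, homogValue] using hval h k (Pi.single 2 1, 0)
  have h02 : ∀ h k, ⟪v (0, h), v (2, k)⟫_ℂ = ⟪h, j x k⟫_ℂ := fun h k => by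
    rw [hv1]
    simpa [Fin.sum_univ_three, homogPencil, homogValue] using hval h k (Pi.single 3 1, 0)
  have h02' : ∀ h k, ⟪v (0, h), ρ (j y) (v (2, k))⟫_ℂ = ⟪h, j w k⟫_ℂ := fun h k => by
    rw [hv]
    simpa [Fin.sum_univ_three, homogPencil, homogValue] using hval h k (Pi.single 4 1, 0)
  have h12 : ∀ h k z, ⟪v (1, h), ρ (j z) (v (2, k))⟫_ℂ = ⟪h, j z k⟫_ℂ := fun h k z => by
    rw [hv]
    simpa [Fin.sum_univ_three, homogPencil, homogValue] using hval h k (0, z)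
  have h12' : ∀ h, v (1, h) = v (2, h) := fun h => by
    have h3 : ⟪v (1, h), v (2, h)⟫_ℂ = ⟪h, h⟫_ℂ := by
      have := h12 h h e
      rwa [he, map_one, one_apply_eq_self, one_apply_eq_self] at this
    have h4 : ⟪v (2, h), v (1, h)⟫_ℂ = ⟪h, h⟫_ℂ := by
      rw [← inner_conj_symm, h3, inner_conj_symm]
    rw [← sub_eq_zero, ← inner_self_eq_zero (𝕜 := ℂ)]
    simp only [inner_sub_left, inner_sub_right, h1, h2, h3, h4, sub_self]
  obtain ⟨S, hS⟩ := exists_clm_of_inner _ _ h0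
  obtain ⟨T, hT⟩ := exists_clm_of_inner 1 (fun h => v (2, h)) (by simpa using h2)
  refine ⟨L, _, _, _, S, T, ρ, hρ, fun h k z => ?_, fun h k => ?_, fun h k => ?_⟩
  · rw [hT, hT, ← h12', h12]
  · rw [hS, hT, h02']
  · rw [hS, hT, h02]

end Extension

section Core

open scoped InnerProductSpace ComplexConjugate

open ContinuousLinearMap (adjoint)

variable {L : Type} [NormedAddCommGroup L] [InnerProductSpace ℂ L] [CompleteSpace L]

/-- The compression `a ↦ T† ρ(a) T` of a representation. -/
def compression (ρ : (H →L[ℂ] H) →⋆ₐ[ℂ] (L →L[ℂ] L)) (T : H →L[ℂ] L) :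
    Module.End ℂ (H →L[ℂ] H) where
  toFun a := adjoint T ∘L ρ a ∘L T
  map_add' a b := by
    rw [map_add, ContinuousLinearMap.add_comp, ContinuousLinearMap.comp_add]
  map_smul' c a := by
    rw [map_smul, ContinuousLinearMap.smul_comp, ContinuousLinearMap.comp_smul, RingHom.id_apply]

theorem inner_compression (ρ : (H →L[ℂ] H) →⋆ₐ[ℂ] (L →L[ℂ] L)) (T : H →L[ℂ] L)
    (a : H →L[ℂ] H) (h k : H) : ⟪h, compression ρ T a k⟫_ℂ = ⟪T h, ρ a (T k)⟫_ℂ := by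
  change ⟪h, adjoint T (ρ a (T k))⟫_ℂ = _
  rw [ContinuousLinearMap.adjoint_inner_right]

theorem isFixingUCP_compression {W : Set (H →L[ℂ] H)} {ρ : (H →L[ℂ] H) →⋆ₐ[ℂ] (L →L[ℂ] L)}
    (hρ : ∀ (κ : Type) [Fintype κ] (A : κ → κ → (H →L[ℂ] H)), MatAcc A →
      MatAcc fun i j => ρ (A i j)) {T : H →L[ℂ] L} (hT : ∀ h k, ⟪T h, T k⟫_ℂ = ⟪h, k⟫_ℂ)
    (hW : ∀ a ∈ W, ∀ h k, ⟪T h, ρ a (T k)⟫_ℂ = ⟪h, a k⟫_ℂ) :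
    IsFixingUCP W (compression ρ T) := by
  have hTn : ∀ h, ‖T h‖ = ‖h‖ := fun h => by
    have h1 := congrArg Complex.re (hT h h)
    rw [re_inner_self_complex, re_inner_self_complex] at h1
    exact (pow_left_inj₀ (norm_nonneg _) (norm_nonneg _) two_ne_zero).1 h1
  have hext : ∀ {a b : H →L[ℂ] H}, (∀ h k, ⟪h, a k⟫_ℂ = ⟪h, b k⟫_ℂ) → a = b := fun hab =>
    ContinuousLinearMap.ext fun k => ext_inner_left ℂ fun h => hab h k
  refine ⟨⟨?_, fun a => ?_, fun a => ?_, fun κ _ A hA ξ => ?_⟩, fun a ha => ?_⟩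
  · refine hext fun h k => ?_
    rw [inner_compression, map_one, one_apply_eq_self, one_apply_eq_self, hT]
  · refine hext fun h k => ?_
    rw [inner_compression, map_star, ContinuousLinearMap.star_eq_adjoint,
      ContinuousLinearMap.star_eq_adjoint, ContinuousLinearMap.adjoint_inner_right,
      ContinuousLinearMap.adjoint_inner_right, ← inner_conj_symm, ← inner_compression,
      inner_conj_symm]
  · refine norm_le_of_inner_le (norm_nonneg _) fun h k => ?_
    rw [inner_compression]
    calc ‖⟪T h, ρ a (T k)⟫_ℂ‖ ≤ ‖T h‖ * ‖ρ a (T k)‖ := norm_inner_le_norm _ _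
      _ ≤ ‖T h‖ * (‖a‖ * ‖T k‖) := by
        gcongr
        exact (ρ a).le_of_opNorm_le (NonUnitalStarAlgHom.norm_apply_le ρ a) _
      _ = ‖a‖ * ‖h‖ * ‖k‖ := by rw [hTn, hTn]; ring
  · simp only [inner_compression]
    exact hρ κ A hA fun i => T (ξ i)
  · refine hext fun h k => ?_
    rw [inner_compression, hW a ha]

theorem IsUCP.matAcc_map_star_mul_sub {Φ : Module.End ℂ (H →L[ℂ] H)} (hΦ : IsUCP Φ)
    {y : H →L[ℂ] H} (hy : Φ y = y) :
    MatAcc fun _ _ : Unit => Φ (star y * y) - star y * y := by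
  intro ξ
  have h1 := hΦ.acc _ _ (matAcc_gram ![1, y]) ![-(y (ξ ())), ξ ()]
  have h2 : Φ (star y) = star y := by rw [hΦ.map_star, hy]
  refine h1.trans (le_of_eq ?_)
  simp only [Fin.sum_univ_two, ← ContinuousLinearMap.star_eq_adjoint, Matrix.cons_val_zero,
    Matrix.cons_val_one, star_one]
  have h3 : Φ ((1 : H →L[ℂ] H) ∘L 1) = 1 := hΦ.map_one
  have h4 : Φ ((1 : H →L[ℂ] H) ∘L y) = y := hy
  have h5 : Φ (star y ∘L (1 : H →L[ℂ] H)) = star y := h2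
  have h6 : Φ (star y ∘L y) = Φ (star y * y) := rfl
  rw [h3, h4, h5, h6]
  simp [ContinuousLinearMap.star_eq_adjoint, ContinuousLinearMap.adjoint_inner_right]
  exact neg_add_eq_sub _ _

variable {V : Type} [AddCommGroup V] [Module ℂ V] {j : V →ₗ[ℂ] (H →L[ℂ] H)}

theorem IsMinimalUCP.map_mul_eq {Φ : Module.End ℂ (H →L[ℂ] H)}
    (hΦ : IsMinimalUCP (Set.range j) Φ) {e x y w : V} {c : ℝ} (he : j e = 1)
    (hg : IsHomogContraction j e x y w c) (hc : 0 < c) : j w = Φ (j x * j y) := by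
  obtain ⟨L, _, _, _, S, T, ρ, hρ, hT, hw, hx⟩ := hg.exists_extension he hc
  have hT1 : ∀ h k, ⟪T h, T k⟫_ℂ = ⟪h, k⟫_ℂ := fun h k => by
    have := hT h k e
    rwa [he, map_one, one_apply_eq_self, one_apply_eq_self] at this
  have hΨ : IsFixingUCP (Set.range j) (compression ρ T) :=
    isFixingUCP_compression hρ hT1 (by rintro _ ⟨v, rfl⟩ h k; exact hT h k v)
  have hU := hΦ.toIsUCP
  have hfix : ∀ v, Φ (j v) = j v := fun v => hΦ.fix _ ⟨v, rfl⟩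
  let X : H →L[ℂ] L := ρ (j y) ∘L T - T ∘L j y
  have hXX : adjoint X ∘L X = compression ρ T (star (j y) * j y) - star (j y) * j y := by
    refine ContinuousLinearMap.ext fun k => ext_inner_left ℂ fun h => ?_
    have h1 : ⟪ρ (j y) (T h), T (j y k)⟫_ℂ = ⟪j y h, j y k⟫_ℂ := by
      rw [← inner_conj_symm, hT, inner_conj_symm]
    rw [sub_apply, inner_sub_right, inner_compression, map_mul, map_star, mul_apply_eq_comp,
      mul_apply_eq_comp, ContinuousLinearMap.star_eq_adjoint, ContinuousLinearMap.star_eq_adjoint,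
      ContinuousLinearMap.adjoint_inner_right, ContinuousLinearMap.adjoint_inner_right,
      ContinuousLinearMap.comp_apply, ContinuousLinearMap.adjoint_inner_right]
    simp only [X, sub_apply, ContinuousLinearMap.comp_apply, inner_sub_left, inner_sub_right, h1,
      hT, hT1]
    ring
  have hSX : adjoint S ∘L X = j w - j x * j y := by
    refine ContinuousLinearMap.ext fun k => ext_inner_left ℂ fun h => ?_
    rw [ContinuousLinearMap.comp_apply, ContinuousLinearMap.adjoint_inner_right]
    simp only [X, sub_apply, ContinuousLinearMap.comp_apply, inner_sub_right, hw, hx,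
      mul_apply_eq_comp]
  have hle : MatAcc fun _ _ : Unit =>
      Φ (star (j y) * j y) - Φ (compression ρ T (star (j y) * j y)) := by
    have h1 := hU.acc _ _ (hΨ.acc _ _ (hU.matAcc_map_star_mul_sub (hfix y)))
    simpa only [map_sub, hΦ.rigid hΨ] using h1
  have h0 : Φ (adjoint S ∘L X) = 0 := by
    have h1 := hU.acc _ _ (matAcc_gram ![S, X])
    have h2 : Φ (adjoint X ∘L S) = star (Φ (adjoint S ∘L X)) := by
      rw [← hU.map_star, ContinuousLinearMap.star_eq_adjoint, ContinuousLinearMap.adjoint_comp,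
        ContinuousLinearMap.adjoint_adjoint]
    have h3 := eq_zero_of_two_by_two (p := Φ (adjoint X ∘L X)) (b := Φ (adjoint X ∘L S))
      (b' := Φ (adjoint S ∘L X)) (d := Φ (adjoint S ∘L S)) (by rw [h2, star_star])
      (fun ξ => ?_) (fun ξ η => ?_)
    · rw [h2, star_eq_zero] at h3
      exact h3
    · have h4 := hle fun _ => ξ
      simp only [Finset.univ_unique, Finset.sum_singleton, sub_apply, inner_sub_right,
        Complex.sub_re] at h4
      rw [hXX, map_sub, sub_apply, inner_sub_right, Complex.sub_re]
      linarith
    · have h4 := h1 ![η, ξ]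
      simp only [Fin.sum_univ_two, Matrix.cons_val_zero, Matrix.cons_val_one] at h4
      refine h4.trans (le_of_eq (congrArg Complex.re ?_))
      ring
  rw [hSX, map_sub, hfix, sub_eq_zero] at h0
  exact h0

theorem exists_representation_of_isHomogContraction (j : V →ₗ[ℂ] (H →L[ℂ] H)) {e : V}
    (he : j e = 1) :
    ∃ (K : Type) (_ : NormedAddCommGroup K) (_ : InnerProductSpace ℂ K) (_ : CompleteSpace K)
      (π : V →ₗ[ℂ] (K →L[ℂ] K)), π e = 1 ∧
      (∀ (ι κ : Type) [Fintype ι] [Fintype κ] (A : ι → κ → V) (c : ℝ),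
        MatBound (fun i k => π (A i k)) c ↔ MatBound (fun i k => j (A i k)) c) ∧
      ∀ x y w c, 0 < c → IsHomogContraction j e x y w c → π w = π x * π y := by
  obtain ⟨Φ, hΦ⟩ := exists_isMinimalUCP (Set.range j)
  obtain ⟨K, _, _, _, π, h1, h2, h3⟩ := hΦ.toIsUCP.exists_representation hΦ.idem j
    fun v => hΦ.fix _ ⟨v, rfl⟩
  exact ⟨K, _, _, inferInstance, π, h1 e he, h2,
    fun x y w c hc hg => h3 x y w (hΦ.map_mul_eq he hg hc)⟩

end Core

section UnitaryReduction

open scoped InnerProductSpace ComplexConjugate Matrix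
open Filter Topology

section ScalarIsometry

variable {ι κ I : Type} [Fintype ι] [Fintype κ] [Fintype I]

theorem map_scalarAct {W W' : Type} [AddCommGroup W] [Module ℂ W] [AddCommGroup W'] [Module ℂ W']
    (f : W →ₗ[ℂ] W') (R : Matrix ι κ ℂ) (ξ : κ → W) (i : ι) :
    f (scalarAct R ξ i) = scalarAct R (fun k => f (ξ k)) i := by
  simp [scalarAct]

theorem scalarAct_add {W : Type} [AddCommGroup W] [Module ℂ W] (R : Matrix ι κ ℂ) (ξ η : κ → W) :
    scalarAct R (fun k => ξ k + η k) = fun i => scalarAct R ξ i + scalarAct R η i := by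
  funext i
  simp [scalarAct, Finset.sum_add_distrib]

theorem scalarAct_smul {W : Type} [AddCommGroup W] [Module ℂ W] (t : ℂ) (R : Matrix ι κ ℂ)
    (ξ : κ → W) (i : ι) : scalarAct (t • R) ξ i = t • scalarAct R ξ i := by
  simp [scalarAct, Finset.smul_sum, smul_smul]

theorem inner_scalarAct (A : Matrix I ι ℂ) (η : I → H) (ξ : ι → H) :
    ∑ i, ⟪η i, scalarAct A ξ i⟫_ℂ = ∑ k, ⟪scalarAct Aᴴ η k, ξ k⟫_ℂ := by
  simp only [scalarAct, inner_sum, sum_inner, inner_smul_left, inner_smul_right,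
    Matrix.conjTranspose_apply, RCLike.star_def, Complex.conj_conj]
  exact Finset.sum_comm

theorem sum_norm_sq_eq_inner (ξ : ι → H) : ((∑ i, ‖ξ i‖ ^ 2 : ℝ) : ℂ) = ∑ i, ⟪ξ i, ξ i⟫_ℂ := by
  rw [Complex.ofReal_sum]
  refine Finset.sum_congr rfl fun i _ => ?_
  rw [inner_self_eq_norm_sq_to_K, Complex.ofReal_pow]
  rfl

theorem sum_norm_sq_scalarAct [DecidableEq ι] {A : Matrix I ι ℂ} (hA : Aᴴ * A = 1) (ξ : ι → H) :
    ∑ i, ‖scalarAct A ξ i‖ ^ 2 = ∑ k, ‖ξ k‖ ^ 2 := by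
  have h1 : ((∑ i, ‖scalarAct A ξ i‖ ^ 2 : ℝ) : ℂ) = ((∑ k, ‖ξ k‖ ^ 2 : ℝ) : ℂ) := by
    rw [sum_norm_sq_eq_inner, sum_norm_sq_eq_inner, inner_scalarAct, scalarAct_scalarAct, hA,
      scalarAct_one]
  exact_mod_cast h1

theorem sum_norm_sq_scalarAct_conjTranspose_le [DecidableEq ι] {A : Matrix I ι ℂ}
    (hA : Aᴴ * A = 1) (η : I → H) :
    ∑ k, ‖scalarAct Aᴴ η k‖ ^ 2 ≤ ∑ i, ‖η i‖ ^ 2 := by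
  have h1 := sum_norm_sq_scalarAct hA (scalarAct Aᴴ η)
  have h2 := congrArg Complex.re (inner_scalarAct A η (scalarAct Aᴴ η))
  rw [← sum_norm_sq_eq_inner, Complex.ofReal_re, Complex.re_sum] at h2
  have h3 : 0 ≤ ∑ i, ‖η i - scalarAct A (scalarAct Aᴴ η) i‖ ^ 2 :=
    Finset.sum_nonneg fun i _ => sq_nonneg _
  simp only [norm_sub_sq (𝕜 := ℂ), RCLike.re_to_complex, Finset.sum_add_distrib,
    Finset.sum_sub_distrib, ← Finset.mul_sum] at h3
  linarith

theorem sum_norm_add_sq_le {δ : ℝ} (hδ : 0 < δ) (u v : ι → H) :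
    ∑ i, ‖u i + v i‖ ^ 2 ≤ (1 + δ) * ∑ i, ‖u i‖ ^ 2 + (1 + 1 / δ) * ∑ i, ‖v i‖ ^ 2 := by
  rw [Finset.mul_sum, Finset.mul_sum, ← Finset.sum_add_distrib]
  refine Finset.sum_le_sum fun i _ => ?_
  have h1 : ‖u i + v i‖ ^ 2 ≤ (‖u i‖ + ‖v i‖) ^ 2 := by
    gcongr
    exact norm_add_le _ _
  have h2 : (1 + δ) * ‖u i‖ ^ 2 + (1 + 1 / δ) * ‖v i‖ ^ 2 - (‖u i‖ + ‖v i‖) ^ 2 =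
      δ * (‖u i‖ - ‖v i‖ / δ) ^ 2 := by
    field_simp
    ring
  nlinarith [mul_nonneg hδ.le (sq_nonneg (‖u i‖ - ‖v i‖ / δ))]

theorem le_of_forall_half_pow {X c b C Q s : ℝ}
    (h : ∀ N : ℕ, X ≤ (1 + (1 / 2 : ℝ) ^ N) * (c ^ 2 * ((1 + (1 / 2 : ℝ) ^ N) * b ^ 2 +
      ((1 / 2 : ℝ) ^ N + ((1 / 2 : ℝ) ^ N) ^ 2) * C) * s) +
      ((1 / 2 : ℝ) ^ N + ((1 / 2 : ℝ) ^ N) ^ 2) * Q) : X ≤ c ^ 2 * b ^ 2 * s := by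
  let g : ℝ → ℝ := fun δ =>
    (1 + δ) * (c ^ 2 * ((1 + δ) * b ^ 2 + (δ + δ ^ 2) * C) * s) + (δ + δ ^ 2) * Q
  have hg : Continuous g := by fun_prop
  have h1 : Tendsto (fun N : ℕ => g ((1 / 2 : ℝ) ^ N)) atTop (𝓝 (g 0)) :=
    (hg.tendsto 0).comp (tendsto_pow_atTop_nhds_zero_of_lt_one (by norm_num) (by norm_num))
  have h2 : g 0 = c ^ 2 * b ^ 2 * s := by simp [g]
  rw [← h2]
  exact ge_of_tendsto' h1 h

end ScalarIsometry

section Coefficients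

variable {V : Type} [AddCommGroup V] [Module ℂ V] {j : V →ₗ[ℂ] (H →L[ℂ] H)}
variable {ι κ I : Type} [Fintype ι] [Fintype κ] [Fintype I]

theorem matBound_homogMatrix_iff {a b : V} {α β : Matrix ι ι ℂ} {z : κ → ι → V} {c : ℝ} :
    MatBound (fun r i => j (homogMatrix a b α β z r i)) c ↔ ∀ ξ : ι → H,
      ∑ i, ‖scalarAct α (fun k => j a (ξ k)) i + scalarAct β (fun k => j b (ξ k)) i‖ ^ 2 +
        ∑ l, ‖∑ k, j (z l k) (ξ k)‖ ^ 2 ≤ c ^ 2 * ∑ k, ‖ξ k‖ ^ 2 := by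
  refine forall_congr' fun ξ => ?_
  rw [Fintype.sum_sum_type]
  simp only [homogMatrix, Sum.elim_inl, Sum.elim_inr, map_add, map_smul, add_apply, smul_apply,
    Finset.sum_add_distrib, scalarAct]

/-- The matrix of coefficients `β` satisfies the estimate in `IsHomogContraction`. -/
def IsContractiveCoeff (j : V →ₗ[ℂ] (H →L[ℂ] H)) (e x y w : V) (c : ℝ) (β : Matrix ι ι ℂ) : Prop :=
  ∀ (κ : Type) [Fintype κ] (α : Matrix ι ι ℂ) (z : κ → ι → V) (b : ℝ), 0 ≤ b →
    MatBound (fun r i => j (homogMatrix e y α β z r i)) b →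
    MatBound (fun r i => j (homogMatrix x w α β ((c : ℂ) • z) r i)) (c * b)

variable {e x y w : V} {c : ℝ}

theorem sum_norm_sq_smul_entries (z : κ → ι → V) (t : ℝ) (ξ : ι → H) :
    ∑ l, ‖∑ k, j (((t : ℂ) • z) l k) (ξ k)‖ ^ 2 = t ^ 2 * ∑ l, ‖∑ k, j (z l k) (ξ k)‖ ^ 2 := by
  simp only [Pi.smul_apply, map_smul, smul_apply, ← Finset.smul_sum, norm_smul, mul_pow,
    Complex.norm_real, Real.norm_eq_abs, sq_abs, ← Finset.mul_sum]

theorem IsContractiveCoeff.of_isometry [DecidableEq ι] {A B : Matrix I ι ℂ} (hA : Aᴴ * A = 1)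
    (hB : Bᴴ * B = 1) {β : Matrix ι ι ℂ} {t : ℝ} (ht : 0 < t)
    (h : IsContractiveCoeff j e x y w c ((t : ℂ) • (A * β * Bᴴ))) :
    IsContractiveCoeff j e x y w c β := by
  intro κ _ α z b hb hz
  rw [matBound_homogMatrix_iff] at hz ⊢
  have key : ∀ (u v : V) (z : κ → ι → V) (ξ : I → H),
      ∑ i, ‖scalarAct ((t : ℂ) • (A * α * Bᴴ)) (fun k => j u (ξ k)) i +
          scalarAct ((t : ℂ) • (A * β * Bᴴ)) (fun k => j v (ξ k)) i‖ ^ 2 +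
        ∑ l, ‖∑ k, j (((t : ℂ) • fun l k => ∑ m, Bᴴ m k • z l m) l k) (ξ k)‖ ^ 2 =
      t ^ 2 * (∑ i, ‖scalarAct α (fun k => j u (scalarAct Bᴴ ξ k)) i +
          scalarAct β (fun k => j v (scalarAct Bᴴ ξ k)) i‖ ^ 2 +
        ∑ l, ‖∑ k, j (z l k) (scalarAct Bᴴ ξ k)‖ ^ 2) := fun u v z ξ => by
    rw [sum_norm_sq_smul_entries, mul_add]
    congr 1
    · rw [← sum_norm_sq_scalarAct hA, scalarAct_add, scalarAct_scalarAct, scalarAct_scalarAct]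
      have h1 : ∀ (u : V) (γ : Matrix ι ι ℂ),
          scalarAct (A * γ) (fun k => j u (scalarAct Bᴴ ξ k)) =
            scalarAct (A * γ * Bᴴ) fun k => j u (ξ k) := fun u γ => by
        rw [← scalarAct_scalarAct (A * γ) Bᴴ]
        exact congrArg _ (funext fun k => map_scalarAct (j u).toLinearMap Bᴴ ξ k)
      simp only [h1, scalarAct_smul, ← smul_add, norm_smul, mul_pow, Complex.norm_real,
        Real.norm_eq_abs, sq_abs, ← Finset.mul_sum]
    · congr 1
      refine Finset.sum_congr rfl fun l _ => ?_
      congr 2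
      simp only [scalarAct, map_sum, map_smul, sum_apply, smul_apply]
      exact Finset.sum_comm
  have hcz : (c : ℂ) • (t : ℂ) • (fun l k => ∑ m, Bᴴ m k • z l m) =
      (t : ℂ) • (fun l k => ∑ m, Bᴴ m k • ((c : ℂ) • z) l m) := by
    rw [smul_comm]
    congr 1
    funext l k
    simp only [Pi.smul_apply, Finset.smul_sum]
    exact Finset.sum_congr rfl fun m _ => smul_comm _ _ _
  have h1 := h κ ((t : ℂ) • (A * α * Bᴴ)) ((t : ℂ) • fun l k => ∑ m, Bᴴ m k • z l m) (t * b)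
    (by positivity) (matBound_homogMatrix_iff.2 fun ξ => ?_)
  · intro ξ
    have h2 := matBound_homogMatrix_iff.1 h1 (scalarAct B ξ)
    rw [hcz, key, scalarAct_scalarAct, hB, scalarAct_one, sum_norm_sq_scalarAct hB] at h2
    have h5 : t ^ 2 * (∑ i, ‖scalarAct α (fun k => j x (ξ k)) i +
        scalarAct β (fun k => j w (ξ k)) i‖ ^ 2 +
        ∑ l, ‖∑ k, j (((c : ℂ) • z) l k) (ξ k)‖ ^ 2) ≤
        t ^ 2 * ((c * b) ^ 2 * ∑ k, ‖ξ k‖ ^ 2) := h2.trans (le_of_eq (by ring))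
    exact le_of_mul_le_mul_left h5 (by positivity)
  · rw [key, mul_pow, mul_assoc]
    gcongr
    refine (hz _).trans ?_
    gcongr
    exact sum_norm_sq_scalarAct_conjTranspose_le hB ξ

end Coefficients

end UnitaryReduction

section Approximation

open scoped InnerProductSpace ComplexConjugate Matrix
open Filter Topology

variable {V : Type} [AddCommGroup V] [Module ℂ V] {j : V →ₗ[ℂ] (H →L[ℂ] H)}
variable {ι κ : Type} [Fintype ι] [Fintype κ] {e x y w : V} {c : ℝ}

theorem sum_norm_sq_scalarAct_le {R : Matrix ι κ ℂ} {ε : ℝ} (hR : ∀ i k, ‖R i k‖ ≤ ε)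
    (ξ : κ → H) : ∑ i, ‖scalarAct R ξ i‖ ^ 2 ≤
      ε ^ 2 * (Fintype.card ι * Fintype.card κ * ∑ k, ‖ξ k‖ ^ 2) := by
  have h1 : ∀ i, ‖scalarAct R ξ i‖ ^ 2 ≤ ε ^ 2 * (Fintype.card κ * ∑ k, ‖ξ k‖ ^ 2) := fun i => by
    have h2 : ‖scalarAct R ξ i‖ ≤ ε * ∑ k, ‖ξ k‖ := by
      rw [Finset.mul_sum]
      refine (norm_sum_le _ _).trans (Finset.sum_le_sum fun k _ => ?_)
      rw [norm_smul]
      gcongr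
      exact hR i k
    calc ‖scalarAct R ξ i‖ ^ 2 ≤ (ε * ∑ k, ‖ξ k‖) ^ 2 := by gcongr
      _ = ε ^ 2 * (∑ k, ‖ξ k‖) ^ 2 := mul_pow _ _ _
      _ ≤ _ := by
        gcongr
        exact sq_sum_le_card_mul_sum_sq
  refine (Finset.sum_le_sum fun i _ => h1 i).trans (le_of_eq ?_)
  rw [Finset.sum_const, Finset.card_univ, nsmul_eq_mul]
  ring

theorem IsContractiveCoeff.of_approx {β : Matrix ι ι ℂ}
    (h : ∀ N : ℕ, ∃ β' : Matrix ι ι ℂ, IsContractiveCoeff j e x y w c β' ∧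
      ∀ i k, ‖(β' - β) i k‖ ≤ (1 / 2 : ℝ) ^ N) : IsContractiveCoeff j e x y w c β := by
  intro κ _ α z b hb hz
  rw [matBound_homogMatrix_iff] at hz ⊢
  let n : ℝ := Fintype.card ι * Fintype.card ι
  have hn : 0 ≤ n := by positivity
  have hd : ∀ (R : Matrix ι ι ℂ) (ε : ℝ) (_ : ∀ i k, ‖R i k‖ ≤ ε) (v : V) (ξ : ι → H),
      ∑ i, ‖scalarAct R (fun k => j v (ξ k)) i‖ ^ 2 ≤
        ε ^ 2 * (n * ‖j v‖ ^ 2 * ∑ k, ‖ξ k‖ ^ 2) := fun R ε hR v ξ => by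
    refine (sum_norm_sq_scalarAct_le hR _).trans ?_
    rw [mul_assoc n]
    gcongr
    rw [Finset.mul_sum]
    refine Finset.sum_le_sum fun k _ => ?_
    rw [← mul_pow]
    gcongr
    exact (j v).le_opNorm _
  intro ξ
  rw [mul_pow]
  refine le_of_forall_half_pow (C := n * ‖j y‖ ^ 2) (Q := n * ‖j w‖ ^ 2 * ∑ k, ‖ξ k‖ ^ 2)
    fun N => ?_
  obtain ⟨β', hβ', hε⟩ := h N
  set ε : ℝ := (1 / 2) ^ N
  have hε0 : 0 < ε := by positivity
  have hεε : (1 + 1 / ε) * ε ^ 2 = ε + ε ^ 2 := by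
    field_simp
    ring
  have key : ∀ (β₁ β₂ : Matrix ι ι ℂ) (_ : ∀ i k, ‖(β₁ - β₂) i k‖ ≤ ε) (u v : V) (z : κ → ι → V)
      (ξ : ι → H), ∑ i, ‖scalarAct α (fun k => j u (ξ k)) i +
          scalarAct β₁ (fun k => j v (ξ k)) i‖ ^ 2 + ∑ l, ‖∑ k, j (z l k) (ξ k)‖ ^ 2 ≤
        (1 + ε) * (∑ i, ‖scalarAct α (fun k => j u (ξ k)) i +
          scalarAct β₂ (fun k => j v (ξ k)) i‖ ^ 2 + ∑ l, ‖∑ k, j (z l k) (ξ k)‖ ^ 2) +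
          (ε + ε ^ 2) * (n * ‖j v‖ ^ 2 * ∑ k, ‖ξ k‖ ^ 2) := fun β₁ β₂ h12 u v z ξ => by
    have h1 := sum_norm_add_sq_le hε0 (fun i => scalarAct α (fun k => j u (ξ k)) i +
      scalarAct β₂ (fun k => j v (ξ k)) i) fun i => scalarAct (β₁ - β₂) (fun k => j v (ξ k)) i
    have h2 : ∀ i, scalarAct α (fun k => j u (ξ k)) i + scalarAct β₂ (fun k => j v (ξ k)) i +
        scalarAct (β₁ - β₂) (fun k => j v (ξ k)) i =
        scalarAct α (fun k => j u (ξ k)) i + scalarAct β₁ (fun k => j v (ξ k)) i := fun i => by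
      simp only [scalarAct, Matrix.sub_apply, sub_smul, Finset.sum_sub_distrib]
      abel
    simp only [h2] at h1
    have h3 := mul_le_mul_of_nonneg_left (hd _ _ h12 v ξ)
      (by positivity : (0 : ℝ) ≤ 1 + 1 / ε)
    rw [← mul_assoc, hεε] at h3
    have h4 : 0 ≤ ε * ∑ l, ‖∑ k, j (z l k) (ξ k)‖ ^ 2 := by positivity
    linarith
  have h1 := matBound_homogMatrix_iff.1 (hβ' κ α z
    (Real.sqrt ((1 + ε) * b ^ 2 + (ε + ε ^ 2) * (n * ‖j y‖ ^ 2))) (Real.sqrt_nonneg _)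
    (matBound_homogMatrix_iff.2 fun ξ => ?_)) ξ
  · rw [mul_pow, Real.sq_sqrt (by positivity)] at h1
    refine (key β β' (fun i k => ?_) x w _ ξ).trans ?_
    · rw [← neg_sub, Matrix.neg_apply, norm_neg]
      exact hε i k
    · gcongr
  · rw [Real.sq_sqrt (by positivity)]
    refine (key β' β hε e y z ξ).trans ?_
    have h2 := mul_le_mul_of_nonneg_left (hz ξ) (by positivity : 0 ≤ 1 + ε)
    linarith

/-- The isometry repeating the `i`-th coordinate `p i` times, with weight `1 / √(p i)`. -/
def repeatIsometry [DecidableEq ι] (p : ι → ℕ) : Matrix (Σ i, Fin (p i)) ι ℂ :=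
  fun s k => if s.1 = k then ((Real.sqrt (p s.1))⁻¹ : ℝ) else 0

theorem repeatIsometry_conjTranspose_mul_self [DecidableEq ι] {p : ι → ℕ} (hp : ∀ i, 0 < p i) :
    (repeatIsometry p)ᴴ * repeatIsometry p = 1 := by
  ext i k
  rw [Matrix.mul_apply, Fintype.sum_sigma]
  simp only [Matrix.conjTranspose_apply, repeatIsometry, RCLike.star_def, apply_ite conj, map_zero,
    Complex.conj_ofReal, Finset.sum_const, Finset.card_univ, Fintype.card_fin]
  rw [Finset.sum_eq_single i (fun m _ hm => by simp [hm]) (by simp)]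
  rcases eq_or_ne i k with rfl | hik
  · have h1 : (p i : ℝ) ≠ 0 := by exact_mod_cast (hp i).ne'
    have h2 : (p i : ℝ) * ((Real.sqrt (p i))⁻¹ * (Real.sqrt (p i))⁻¹) = 1 := by
      rw [← mul_inv, Real.mul_self_sqrt (Nat.cast_nonneg _), mul_inv_cancel₀ h1]
    simp only [if_true, Matrix.one_apply_eq, nsmul_eq_mul]
    exact_mod_cast h2
  · simp [hik]

theorem repeatIsometry_diagonal [DecidableEq ι] {p : ι → ℕ} (hp : ∀ i, 0 < p i)
    (s t : Σ i, Fin (p i)) :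
    (repeatIsometry p * Matrix.diagonal (fun i => (p i : ℂ)) * (repeatIsometry p)ᴴ) s t =
      if s.1 = t.1 then 1 else 0 := by
  rw [Matrix.mul_apply]
  simp only [Matrix.mul_diagonal, Matrix.conjTranspose_apply, repeatIsometry, RCLike.star_def,
    apply_ite conj, map_zero, Complex.conj_ofReal]
  rw [Finset.sum_eq_single s.1 (fun m _ hm => by simp [hm.symm]) (by simp)]
  rcases eq_or_ne s.1 t.1 with hst | hst
  · have h1 : (p s.1 : ℝ) ≠ 0 := by exact_mod_cast (hp s.1).ne'
    have h2 : (Real.sqrt (p s.1))⁻¹ * (p s.1) * (Real.sqrt (p s.1))⁻¹ = 1 := by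
      rw [mul_right_comm, ← mul_inv, Real.mul_self_sqrt (Nat.cast_nonneg _), inv_mul_cancel₀ h1]
    rw [if_pos rfl, if_pos hst.symm, if_pos hst, ← hst]
    exact_mod_cast h2
  · rw [if_neg hst, if_neg (Ne.symm hst), mul_zero]

/-- The estimate holds for all coefficient matrices with entries zero and one. -/
def IsBinaryContraction (j : V →ₗ[ℂ] (H →L[ℂ] H)) (e x y w : V) (c : ℝ) : Prop :=
  ∀ (ι : Type) [Fintype ι] (β : Matrix ι ι ℂ), (∀ i k, β i k = 0 ∨ β i k = 1) →
    IsContractiveCoeff j e x y w c β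

theorem IsBinaryContraction.diagonal [DecidableEq ι] (h : IsBinaryContraction j e x y w c)
    {σ : ι → ℝ} (hσ : ∀ i, 0 ≤ σ i) :
    IsContractiveCoeff j e x y w c (Matrix.diagonal fun i => (σ i : ℂ)) := by
  refine IsContractiveCoeff.of_approx fun N => ?_
  let p : ι → ℕ := fun i => ⌊(2 : ℝ) ^ N * σ i⌋₊ + 1
  have hp : ∀ i, 0 < p i := fun i => Nat.succ_pos _
  refine ⟨Matrix.diagonal fun i => ((p i / 2 ^ N : ℝ) : ℂ), ?_, fun i k => ?_⟩
  · refine IsContractiveCoeff.of_isometry (repeatIsometry_conjTranspose_mul_self hp)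
      (repeatIsometry_conjTranspose_mul_self hp) (t := 2 ^ N) (by positivity) ?_
    have h1 : (((2 : ℝ) ^ N : ℝ) : ℂ) • (repeatIsometry p *
        (Matrix.diagonal fun i => ((p i / 2 ^ N : ℝ) : ℂ)) * (repeatIsometry p)ᴴ) =
        repeatIsometry p * Matrix.diagonal (fun i => (p i : ℂ)) * (repeatIsometry p)ᴴ := by
      rw [← Matrix.smul_mul, ← Matrix.mul_smul, ← Matrix.diagonal_smul]
      congr 3
      funext i
      simp only [Pi.smul_apply, smul_eq_mul]
      rw [← Complex.ofReal_mul, mul_div_cancel₀ _ (by positivity : (2 : ℝ) ^ N ≠ 0)]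
      simp
    rw [h1]
    refine h _ _ fun s t => ?_
    rw [repeatIsometry_diagonal hp]
    split_ifs <;> simp
  · rw [Matrix.sub_apply, Matrix.diagonal_apply, Matrix.diagonal_apply]
    split_ifs with hik
    · rw [← Complex.ofReal_sub, Complex.norm_real, Real.norm_eq_abs]
      have h2 : (0 : ℝ) < 2 ^ N := by positivity
      have h3 : (p i : ℝ) / 2 ^ N - σ i = (p i - 2 ^ N * σ i) / 2 ^ N := by
        field_simp
      have h4 : (p i : ℝ) = ⌊(2 : ℝ) ^ N * σ i⌋₊ + 1 := by simp [p]
      have h5 := Nat.floor_le (mul_nonneg h2.le (hσ i))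
      have h6 := Nat.lt_floor_add_one ((2 : ℝ) ^ N * σ i)
      rw [h3, abs_div, abs_of_pos h2, one_div, inv_pow, div_eq_mul_inv]
      refine mul_le_of_le_one_left (by positivity) ?_
      rw [abs_le]
      constructor <;> linarith
    · simp

end Approximation

section SingularValues

open scoped InnerProductSpace ComplexConjugate Matrix
open Filter Topology

variable {V : Type} [AddCommGroup V] [Module ℂ V] {j : V →ₗ[ℂ] (H →L[ℂ] H)}
variable {ι : Type} [Fintype ι] {e x y w : V} {c : ℝ}

open scoped ComplexOrder in
theorem Matrix.exists_isometry_diagonalization [DecidableEq ι] {β : Matrix ι ι ℂ}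
    (hβ : IsUnit β.det) : ∃ (A B : Matrix ι ι ℂ) (σ : ι → ℝ), Aᴴ * A = 1 ∧ Bᴴ * B = 1 ∧
      (∀ i, 0 ≤ σ i) ∧ A * β * Bᴴ = Matrix.diagonal fun i => (σ i : ℂ) := by
  have hpos : (βᴴ * β).PosDef := Matrix.PosDef.conjTranspose_mul_self β
    (Matrix.mulVec_injective_of_isUnit ((Matrix.isUnit_iff_isUnit_det β).2 hβ))
  have hG := hpos.isHermitian
  let U : Matrix ι ι ℂ := hG.eigenvectorUnitary
  have hU1 : Uᴴ * U = 1 := Unitary.coe_star_mul_self hG.eigenvectorUnitary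
  have hU2 : U * Uᴴ = 1 := Unitary.coe_mul_star_self hG.eigenvectorUnitary
  have hdiag : Uᴴ * (βᴴ * β) * U = Matrix.diagonal fun i => (hG.eigenvalues i : ℂ) := by
    have h1 := hG.conjStarAlgAut_star_eigenvectorUnitary
    rw [Unitary.conjStarAlgAut_apply] at h1
    rw [Unitary.coe_star, star_star] at h1
    exact h1
  let σ : ι → ℝ := fun i => Real.sqrt (hG.eigenvalues i)
  have hσ : ∀ i, 0 < σ i := fun i => Real.sqrt_pos.2 (hpos.eigenvalues_pos i)
  have hσσ : ∀ i, σ i * σ i = hG.eigenvalues i := fun i =>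
    Real.mul_self_sqrt (hpos.eigenvalues_pos i).le
  let S : Matrix ι ι ℂ := Matrix.diagonal fun i => ((σ i)⁻¹ : ℂ)
  have hS : Sᴴ = S := by
    rw [Matrix.diagonal_conjTranspose]
    congr 1
    funext i
    simp
  have hA : (S * Uᴴ * βᴴ) * (β * U * S) = 1 := by
    have h1 : (S * Uᴴ * βᴴ) * (β * U * S) = S * (Uᴴ * (βᴴ * β) * U) * S := by
      simp only [Matrix.mul_assoc]
    rw [h1, hdiag, Matrix.diagonal_mul_diagonal, Matrix.diagonal_mul_diagonal,
      ← Matrix.diagonal_one]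
    congr 1
    funext i
    have h2 : (σ i : ℂ) ≠ 0 := by exact_mod_cast (hσ i).ne'
    rw [← hσσ, Complex.ofReal_mul]
    field_simp
  refine ⟨S * Uᴴ * βᴴ, Uᴴ, σ, ?_, by rwa [Matrix.conjTranspose_conjTranspose],
    fun i => (hσ i).le, ?_⟩
  · rw [Matrix.conjTranspose_mul, Matrix.conjTranspose_mul, hS,
      Matrix.conjTranspose_conjTranspose, Matrix.conjTranspose_conjTranspose, ← Matrix.mul_assoc β]
    exact mul_eq_one_comm.1 hA
  · have h1 : S * Uᴴ * βᴴ * β * Uᴴᴴ = S * (Uᴴ * (βᴴ * β) * U) := by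
      simp only [Matrix.mul_assoc, Matrix.conjTranspose_conjTranspose]
    rw [h1, hdiag, Matrix.diagonal_mul_diagonal]
    congr 1
    funext i
    have h2 : (σ i : ℂ) ≠ 0 := by exact_mod_cast (hσ i).ne'
    rw [← hσσ, Complex.ofReal_mul]
    field_simp

theorem Matrix.exists_isUnit_det_add_smul_one [DecidableEq ι] (β : Matrix ι ι ℂ) {ε : ℝ}
    (hε : 0 < ε) : ∃ t : ℝ, 0 < t ∧ t ≤ ε ∧ IsUnit (β + (t : ℂ) • (1 : Matrix ι ι ℂ)).det := by
  have h0 : (-β).charpoly ≠ 0 := (Matrix.charpoly_monic _).ne_zero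
  have h1 : Set.Finite {t : ℝ | (-β).charpoly.IsRoot (t : ℂ)} :=
    (Polynomial.finite_setOfPred_isRoot h0).preimage Complex.ofReal_injective.injOn
  obtain ⟨t, ht, ht'⟩ := (Set.Ioc_infinite hε).exists_notMem_finite h1
  refine ⟨t, ht.1, ht.2, isUnit_iff_ne_zero.2 fun hdet => ht' ?_⟩
  change Polynomial.eval _ _ = 0
  rw [Matrix.eval_charpoly, ← hdet]
  congr 1
  rw [sub_neg_eq_add, add_comm, Matrix.smul_one_eq_diagonal]
  rfl

theorem IsBinaryContraction.isHomogContraction (h : IsBinaryContraction j e x y w c) :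
    IsHomogContraction j e x y w c := by
  classical
  have hunit : ∀ (ι : Type) [Fintype ι] (β : Matrix ι ι ℂ),
      IsUnit β.det →
      IsContractiveCoeff j e x y w c β := fun ι _ β hβ => by
    obtain ⟨A, B, σ, hA, hB, hσ, hd⟩ := Matrix.exists_isometry_diagonalization hβ
    refine IsContractiveCoeff.of_isometry hA hB one_pos ?_
    rw [Complex.ofReal_one, one_smul, hd]
    exact h.diagonal hσ
  intro ι κ _ _ α β z b hb hz
  refine IsContractiveCoeff.of_approx (fun N => ?_) κ α z b hb hz
  obtain ⟨t, ht0, ht, hdet⟩ := Matrix.exists_isUnit_det_add_smul_one (Matrix.of β)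
    (by positivity : (0 : ℝ) < (1 / 2) ^ N)
  refine ⟨_, hunit ι _ (by convert hdet), fun i k => ?_⟩
  change ‖((Matrix.of β + (t : ℂ) • (1 : Matrix ι ι ℂ)) - Matrix.of β) i k‖ ≤ _
  rw [add_sub_cancel_left, Matrix.smul_apply, Matrix.one_apply]
  split_ifs
  · simpa [abs_of_pos ht0] using ht
  · simp

end SingularValues

section Hadamard

open scoped InnerProductSpace ComplexConjugate Matrix
open Filter Topology

variable {V : Type} [AddCommGroup V] [Module ℂ V] {j : V →ₗ[ℂ] (H →L[ℂ] H)}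
variable {e x y w : V} {c : ℝ}

/-- The estimate in `IsHomogContraction` holds whenever each entry of the first block is either
`y` or a multiple of `e`. -/
def IsPureContraction (j : V →ₗ[ℂ] (H →L[ℂ] H)) (e x y w : V) (c : ℝ) : Prop :=
  ∀ (ι κ : Type) [Fintype ι] [Fintype κ] (α β : Matrix ι ι ℂ) (z : κ → ι → V) (b : ℝ), 0 ≤ b →
    (∀ i k, β i k = 0 ∨ β i k = 1 ∧ α i k = 0) →
    MatBound (fun r i => j (homogMatrix e y α β z r i)) b →
    MatBound (fun r i => j (homogMatrix x w α β ((c : ℂ) • z) r i)) (c * b)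

/-- The Walsh matrix, a Hadamard matrix of order `2 ^ n`. -/
def walshMatrix (n : ℕ) : Matrix (Fin n → Bool) (Fin n → Bool) ℂ :=
  fun s t => ∏ i, if s i && t i then -1 else 1

theorem walshMatrix_eq (n : ℕ) (s t : Fin n → Bool) :
    walshMatrix n s t = 1 ∨ walshMatrix n s t = -1 := by
  unfold walshMatrix
  refine Finset.prod_induction _ (fun a : ℂ => a = 1 ∨ a = -1) ?_ (Or.inl rfl) fun i _ => ?_
  · rintro a b (rfl | rfl) (rfl | rfl) <;> simp
  · split_ifs <;> simp

theorem walshMatrix_conjTranspose_mul_self (n : ℕ) :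
    (walshMatrix n)ᴴ * walshMatrix n =
      (2 ^ n : ℂ) • (1 : Matrix (Fin n → Bool) (Fin n → Bool) ℂ) := by
  ext t t'
  have h1 : ((walshMatrix n)ᴴ * walshMatrix n) t t' =
      ∑ s : Fin n → Bool, ∏ i,
        ((if s i && t i then -1 else 1) * (if s i && t' i then -1 else 1)) := by
    rw [Matrix.mul_apply]
    refine Finset.sum_congr rfl fun s _ => ?_
    rw [Finset.prod_mul_distrib, Matrix.conjTranspose_apply, walshMatrix, walshMatrix, star_prod]
    congr 1
    refine Finset.prod_congr rfl fun i _ => ?_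
    split_ifs <;> simp
  have h2 := Finset.prod_univ_sum (fun _ : Fin n => (Finset.univ : Finset Bool)) fun i b =>
    ((if b && t i then (-1 : ℂ) else 1) * (if b && t' i then -1 else 1))
  rw [Fintype.piFinset_univ] at h2
  rw [h1, ← h2, Matrix.smul_apply, Matrix.one_apply]
  split_ifs with h
  · subst h
    rw [Finset.prod_congr rfl fun i _ => show _ = (2 : ℂ) from ?_]
    · simp
    · cases t i <;> norm_num
  · obtain ⟨i, hi⟩ := Function.ne_iff.1 h
    rw [Finset.prod_eq_zero (Finset.mem_univ i), smul_zero]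
    revert hi
    cases t i <;> cases t' i <;> simp

theorem sum_norm_sq_walshMatrix (n : ℕ) (f : (Fin n → Bool) → H) :
    ∑ s, ‖∑ t, walshMatrix n s t • f t‖ ^ 2 = 2 ^ n * ∑ t, ‖f t‖ ^ 2 := by
  have h1 : ((∑ s, ‖scalarAct (walshMatrix n) f s‖ ^ 2 : ℝ) : ℂ) =
      ((2 ^ n * ∑ t, ‖f t‖ ^ 2 : ℝ) : ℂ) := by
    rw [Complex.ofReal_mul, sum_norm_sq_eq_inner, sum_norm_sq_eq_inner, inner_scalarAct,
      scalarAct_scalarAct, walshMatrix_conjTranspose_mul_self]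
    simp only [scalarAct_smul, scalarAct_one, inner_smul_left, ← Finset.mul_sum]
    simp [map_pow, Complex.conj_ofNat]
  exact_mod_cast h1

theorem IsPureContraction.isBinaryContraction (h : IsPureContraction j e x y w c) :
    IsBinaryContraction j e x y w c := by
  intro ι _ E hE κ _ α z b hb hz
  rw [matBound_homogMatrix_iff] at hz ⊢
  let q : V → V → (ι → H) → ι → H := fun u v ξ i =>
    ∑ k, (E i k • (j v - α i k • j u)) (ξ k)
  let L : V → V → (ι → H) → ι → H := fun u v ξ i =>
    scalarAct α (fun k => j u (ξ k)) i + scalarAct E (fun k => j v (ξ k)) i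
  obtain ⟨C, hC0, hC⟩ : ∃ C : ℝ, 0 ≤ C ∧ ∀ ξ, ∑ i, ‖q e y ξ i‖ ^ 2 ≤ C * ∑ k, ‖ξ k‖ ^ 2 :=
    ⟨_, sq_nonneg _, matBound_opMatNorm (fun i k => E i k • (j y - α i k • j e))⟩
  intro ξ
  rw [mul_pow]
  refine le_of_forall_half_pow (C := C) (Q := ∑ i, ‖q x w ξ i‖ ^ 2) fun N => ?_
  let S := Fin (2 * N) → Bool
  let W : S → S → ℂ := walshMatrix (2 * N)
  set δ : ℝ := (1 / 2) ^ N with hδ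
  have hδ0 : 0 < δ := by positivity
  let M : ℝ := 2 ^ (2 * N)
  have hM0 : 0 < M := by positivity
  have hMδ : (1 + 1 / δ) = M * (δ + δ ^ 2) := by
    have h1 : M * δ ^ 2 = 1 := by
      rw [hδ, ← pow_mul, mul_comm N 2, ← mul_pow]
      norm_num
    field_simp
    linear_combination (-1 - δ) * h1
  have hcard : (Fintype.card S : ℝ) = M := by simp [S, M]
  have hparseval : ∀ f : S → H, ∑ s, ‖∑ t, W s t • f t‖ ^ 2 = M * ∑ t, ‖f t‖ ^ 2 :=
    sum_norm_sq_walshMatrix _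
  have hparseval' : ∀ g : S → ι → H, ∑ s, ∑ i, ‖∑ t, W s t • g t i‖ ^ 2 =
      M * ∑ t, ∑ i, ‖g t i‖ ^ 2 := fun g => by
    rw [Finset.sum_comm, Finset.sum_comm (γ := S), Finset.mul_sum]
    exact Finset.sum_congr rfl fun i _ => hparseval fun t => g t i
  let α' : Matrix (ι × S) (ι × S) ℂ := fun p r => α p.1 r.1 * (1 - E p.1 r.1 * W p.2 r.2) / 2
  let β' : Matrix (ι × S) (ι × S) ℂ := fun p r => E p.1 r.1 * (1 + W p.2 r.2) / 2
  let z' : κ → ι × S → V := fun l r => ((Real.sqrt M / 2 : ℝ) : ℂ) • z l r.1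
  have hrow : ∀ (u v : V) (ζ : ι × S → H) (i : ι) (s : S),
      scalarAct α' (fun p => j u (ζ p)) (i, s) + scalarAct β' (fun p => j v (ζ p)) (i, s) =
        (1 / 2 : ℂ) • (L u v (fun k => ∑ t, ζ (k, t)) i +
          ∑ t, W s t • q u v (fun k => ζ (k, t)) i) := fun u v ζ i s => by
    simp only [scalarAct, L, q, Fintype.sum_prod_type, map_sum, Finset.smul_sum, α', β']
    rw [Finset.sum_comm (s := (Finset.univ : Finset S))]
    simp only [← Finset.sum_add_distrib, Finset.smul_sum]
    refine Finset.sum_congr rfl fun k _ => Finset.sum_congr rfl fun t _ => ?_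
    simp only [smul_apply, sub_apply]
    module
  have hzrow : ∀ (z : κ → ι → V) (ζ : ι × S → H),
      ∑ l, ‖∑ p : ι × S, j (((Real.sqrt M / 2 : ℝ) : ℂ) • z l p.1) (ζ p)‖ ^ 2 =
        M / 4 * ∑ l, ‖∑ k, j (z l k) (∑ t, ζ (k, t))‖ ^ 2 := fun z ζ => by
    rw [Finset.mul_sum]
    refine Finset.sum_congr rfl fun l _ => ?_
    have h1 : ∑ p : ι × S, j (((Real.sqrt M / 2 : ℝ) : ℂ) • z l p.1) (ζ p) =
        ((Real.sqrt M / 2 : ℝ) : ℂ) • ∑ k, j (z l k) (∑ t, ζ (k, t)) := by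
      simp only [Fintype.sum_prod_type, map_sum, map_smul, smul_apply, Finset.smul_sum]
    rw [h1, norm_smul, mul_pow, Complex.norm_real, Real.norm_eq_abs, sq_abs, div_pow,
      Real.sq_sqrt hM0.le]
    norm_num
  have hsum : ∀ ζ : ι × S → H, ∑ k, ‖∑ t, ζ (k, t)‖ ^ 2 ≤ M * ∑ p, ‖ζ p‖ ^ 2 := fun ζ => by
    rw [Fintype.sum_prod_type, Finset.mul_sum]
    refine Finset.sum_le_sum fun k _ => ?_
    calc ‖∑ t, ζ (k, t)‖ ^ 2 ≤ (∑ t, ‖ζ (k, t)‖) ^ 2 := by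
          gcongr
          exact norm_sum_le _ _
      _ ≤ _ := by
          have h1 := sq_sum_le_card_mul_sum_sq (s := Finset.univ) (f := fun t => ‖ζ (k, t)‖)
          rwa [Finset.card_univ, hcard] at h1
  have hhalf : ∀ v : H, ‖(1 / 2 : ℂ) • v‖ ^ 2 = 1 / 4 * ‖v‖ ^ 2 := fun v => by
    rw [norm_smul, mul_pow]
    norm_num
  let b' : ℝ := Real.sqrt (M ^ 2 / 4 * ((1 + δ) * b ^ 2 + (δ + δ ^ 2) * C))
  have hb' : b' ^ 2 = M ^ 2 / 4 * ((1 + δ) * b ^ 2 + (δ + δ ^ 2) * C) :=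
    Real.sq_sqrt (by positivity)
  have hB : MatBound (fun r i => j (homogMatrix e y α' β' z' r i)) b' := by
    rw [matBound_homogMatrix_iff]
    intro ζ
    rw [Fintype.sum_prod_type, Finset.sum_comm, hb', hzrow]
    simp only [hrow, hhalf, ← Finset.mul_sum]
    have h1 : ∀ s : S, ∑ i, ‖L e y (fun k => ∑ t, ζ (k, t)) i +
        ∑ t, W s t • q e y (fun k => ζ (k, t)) i‖ ^ 2 ≤ _ := fun s => sum_norm_add_sq_le hδ0 _ _
    have h2 := Finset.sum_le_sum fun s (_ : s ∈ Finset.univ) => h1 s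
    rw [Finset.sum_add_distrib, Finset.sum_const, Finset.card_univ, nsmul_eq_mul, hcard,
      ← Finset.mul_sum, hparseval' fun t => q e y fun k => ζ (k, t)] at h2
    have h3 : ∑ t : S, ∑ i, ‖q e y (fun k => ζ (k, t)) i‖ ^ 2 ≤ C * ∑ p, ‖ζ p‖ ^ 2 := by
      rw [Fintype.sum_prod_type, Finset.sum_comm (γ := ι), Finset.mul_sum]
      exact Finset.sum_le_sum fun t _ => hC _
    have h4 := (hz fun k => ∑ t, ζ (k, t)).trans
      (mul_le_mul_of_nonneg_left (hsum ζ) (sq_nonneg b))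
    rw [hMδ] at h2
    have h5 := mul_le_mul_of_nonneg_left h3 (by positivity : 0 ≤ M * (δ + δ ^ 2) * M)
    have h6 := mul_le_mul_of_nonneg_left h4 (by positivity : 0 ≤ M * (1 + δ))
    have h7 : 0 ≤ M * δ * ∑ l, ‖∑ k, j (z l k) (∑ t, ζ (k, t))‖ ^ 2 := by positivity
    change _ ≤ _ at h2
    simp only [L] at h2 ⊢
    nlinarith
  have hA := matBound_homogMatrix_iff.1 (h (ι × S) κ α' β' z' b' (Real.sqrt_nonneg _)
    (fun p r => ?_) hB) fun p => ξ p.1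
  · rw [sum_norm_sq_smul_entries, Fintype.sum_prod_type, Finset.sum_comm, mul_pow, hb', hzrow] at hA
    simp only [hrow, hhalf, ← Finset.mul_sum] at hA
    rw [sum_norm_sq_smul_entries]
    have hc1 : ∀ k, ∑ _t : S, ξ k = (M : ℂ) • ξ k := fun k => by
      rw [Finset.sum_const, Finset.card_univ, ← hcard, ← Nat.cast_smul_eq_nsmul ℂ]
      simp
    have hc2 : ∀ i, L x w (fun k => (M : ℂ) • ξ k) i = (M : ℂ) • L x w ξ i := fun i => by
      simp only [L, scalarAct, map_smul, smul_add, Finset.smul_sum, smul_comm (M : ℂ)]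
    have hc3 : ∑ p : ι × S, ‖ξ p.1‖ ^ 2 = M * ∑ k, ‖ξ k‖ ^ 2 := by
      simp only [Fintype.sum_prod_type, Finset.sum_const, Finset.card_univ, nsmul_eq_mul, hcard,
        Finset.mul_sum]
    have hM : ∀ v : H, ‖(M : ℂ) • v‖ ^ 2 = M ^ 2 * ‖v‖ ^ 2 := fun v => by
      rw [norm_smul, mul_pow, Complex.norm_real, Real.norm_eq_abs, sq_abs]
    simp only [hc1, hc2, hc3, map_smul, ← Finset.smul_sum, hM, ← Finset.mul_sum] at hA
    have h1 : ∀ s : S, ∑ i, ‖(M : ℂ) • L x w ξ i‖ ^ 2 ≤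
        (1 + δ) * ∑ i, ‖(M : ℂ) • L x w ξ i + ∑ t, W s t • q x w ξ i‖ ^ 2 +
          (1 + 1 / δ) * ∑ i, ‖∑ t, W s t • q x w ξ i‖ ^ 2 := fun s => by
      have h2 := sum_norm_add_sq_le hδ0
        (fun i => (M : ℂ) • L x w ξ i + ∑ t, W s t • q x w ξ i) fun i => -∑ t, W s t • q x w ξ i
      simpa only [add_neg_cancel_right, norm_neg] using h2
    have h2 := Finset.sum_le_sum fun s (_ : s ∈ Finset.univ) => h1 s
    rw [Finset.sum_add_distrib, Finset.sum_const, Finset.card_univ, nsmul_eq_mul, hcard,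
      ← Finset.mul_sum, ← Finset.mul_sum, hparseval' fun _ => q x w ξ, Finset.sum_const,
      Finset.card_univ, nsmul_eq_mul, hcard, hMδ] at h2
    simp only [hM, ← Finset.mul_sum] at h2
    change ∑ i, ‖L x w ξ i‖ ^ 2 + _ ≤ _
    have h3 := mul_le_mul_of_nonneg_left hA (by positivity : 0 ≤ 4 * (1 + δ))
    have h4 : 0 ≤ M ^ 3 * δ * c ^ 2 * ∑ l, ‖∑ k, j (z l k) (ξ k)‖ ^ 2 := by positivity
    refine le_of_mul_le_mul_left (a := M ^ 3) ?_ (by positivity)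
    linarith
  · rcases hE p.1 r.1 with h1 | h1
    · exact Or.inl (by simp [β', h1])
    · rcases walshMatrix_eq (2 * N) p.2 r.2 with h2 | h2
      · exact Or.inr (by simp [α', β', W, h1, h2])
      · exact Or.inl (by simp [β', W, h1, h2])

end Hadamard

section Products

open scoped InnerProductSpace ComplexConjugate Matrix
open Filter Topology

namespace PartialProduct

variable {V : Type*} [AddCommGroup V] [Module ℂ V] {e : V} (P : PartialProduct V e)

theorem mem_zero_left (v : V) : ((0 : V), v) ∈ P.D := by
  simpa using P.unit_left 0 v

theorem m_zero_right (x : V) : P.m x 0 = 0 := by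
  have h1 := P.m_add_right x 0 0 1 (zero_mem _) (zero_mem _)
  simpa using h1

theorem m_zero_left (x : V) : P.m 0 x = 0 := by
  have h1 := P.m_add_left x 0 0 1 (zero_mem _) (zero_mem _)
  simpa using h1

theorem m_smul_unit_right (x : V) (t : ℂ) : P.m x (t • e) = t • x := by
  have h1 := P.m_add_right x 0 e t (zero_mem _) (P.e_mem_R x)
  simpa [P.m_zero_right, P.m_unital_right] using h1

theorem m_smul_unit_left (x : V) (t : ℂ) : P.m (t • e) x = t • x := by
  have h1 := P.m_add_left x 0 e t (zero_mem _) (P.e_mem_L x)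
  simpa [P.m_zero_left, P.m_unital_left] using h1

end PartialProduct

theorem PartialProduct.Contractive.isPureContraction {V : Submodule ℂ (H →L[ℂ] H)} {e : V}
    {P : PartialProduct V e} (h : P.Contractive) (he : ‖(e : H →L[ℂ] H)‖ = 1) {x y : V}
    (hxy : (x, y) ∈ P.D) {c : ℝ} (hc : 0 ≤ c) (hxc : ‖(x : H →L[ℂ] H)‖ ≤ c) :
    IsPureContraction V.subtype e x y (P.m x y) c := by
  classical
  intro ι κ _ _ α β z b hb hpure hB
  let d : ι ⊕ κ → V := Sum.elim (fun _ => x) fun _ => (c : ℂ) • e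
  let A : ι ⊕ κ → ι ⊕ κ → V := fun p r => if p = r then d p else 0
  have hd : ∀ p, ‖(d p : H →L[ℂ] H)‖ ≤ c := by
    rintro (i | l)
    · exact hxc
    · change ‖(c : ℂ) • (e : H →L[ℂ] H)‖ ≤ c
      rw [norm_smul, he, mul_one, Complex.norm_real, Real.norm_eq_abs, abs_of_nonneg hc]
  have hA : MatBound (fun p r => (A p r : H →L[ℂ] H)) c := fun ξ => by
    rw [Finset.mul_sum]
    refine Finset.sum_le_sum fun p _ => ?_
    rw [Finset.sum_eq_single p (fun r _ hr => by simp [A, hr.symm]) (by simp), ← mul_pow]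
    gcongr
    refine ((A p p : H →L[ℂ] H).le_opNorm _).trans ?_
    gcongr
    simpa [A] using hd p
  have hrow : ∀ (p : ι ⊕ κ) (i : ι), (d p, homogMatrix e y α β z p i) ∈ P.D ∧
      P.m (d p) (homogMatrix e y α β z p i) =
        homogMatrix x (P.m x y) α β ((c : ℂ) • z) p i := by
    rintro (k | l) i
    · change (x, α k i • e + β k i • y) ∈ P.D ∧
        P.m x (α k i • e + β k i • y) = α k i • x + β k i • P.m x y
      rcases hpure k i with h1 | ⟨h1, h2⟩
      · simpa [h1] using ⟨P.unit_right _ x, P.m_smul_unit_right x _⟩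
      · simpa [h1, h2] using hxy
    · exact ⟨P.unit_left _ _, P.m_smul_unit_left _ _⟩
  have h1 := h (ι ⊕ κ) (ι ⊕ κ) ι A (homogMatrix e y α β z) c b hc hb (fun p r i => ?_) hA hB
  · refine (congrArg (MatBound · (c * b)) ?_).mp h1
    funext p i
    rw [Finset.sum_eq_single p (fun r _ hr => by simp [A, hr.symm, P.m_zero_left]) (by simp)]
    simp only [A, if_true, (hrow p i).2]
    rfl
  · by_cases hpr : p = r
    · simpa [A, hpr] using (hrow r i).1
    · simpa [A, hpr] using P.mem_zero_left _

theorem PartialProduct.Contractive.isHomogContraction {V : Submodule ℂ (H →L[ℂ] H)} {e : V}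
    {P : PartialProduct V e} (h : P.Contractive) (he : ‖(e : H →L[ℂ] H)‖ = 1) {x y : V}
    (hxy : (x, y) ∈ P.D) {c : ℝ} (hc : 0 ≤ c) (hxc : ‖(x : H →L[ℂ] H)‖ ≤ c) :
    IsHomogContraction V.subtype e x y (P.m x y) c :=
  (h.isPureContraction he hxy hc hxc).isBinaryContraction.isHomogContraction

end Products

section Ultrapower

open scoped InnerProductSpace ComplexConjugate Matrix
open Filter Topology

variable (H) in
/-- The bounded sequences in a Hilbert space. -/
def boundedSeq : Submodule ℂ (ℕ → H) where
  carrier := {ξ | ∃ C, ∀ n, ‖ξ n‖ ≤ C}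
  zero_mem' := ⟨0, fun n => by simp⟩
  add_mem' := fun ⟨C, hC⟩ ⟨D, hD⟩ => ⟨C + D, fun n => norm_add_le_of_le (hC n) (hD n)⟩
  smul_mem' := fun c _ ⟨C, hC⟩ => ⟨‖c‖ * C, fun n => by
    rw [Pi.smul_apply, norm_smul]
    gcongr
    exact hC n⟩

/-- The pointwise action of an operator on bounded sequences. -/
def boundedSeqMap (a : H →L[ℂ] H) : boundedSeq H →ₗ[ℂ] boundedSeq H where
  toFun ξ := ⟨fun n => a (ξ.1 n), by
    obtain ⟨C, hC⟩ := ξ.2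
    exact ⟨‖a‖ * C, fun n => a.le_of_opNorm_le_of_le le_rfl (hC n)⟩⟩
  map_add' ξ η := by ext n; exact map_add a _ _
  map_smul' c ξ := by ext n; exact map_smul a _ _

theorem boundedSeq.exists_tendsto_inner (U : Ultrafilter ℕ) (ξ η : boundedSeq H) :
    ∃ z : ℂ, Tendsto (fun n => ⟪ξ.1 n, η.1 n⟫_ℂ) U (𝓝 z) := by
  obtain ⟨C, hC⟩ := ξ.2
  obtain ⟨D, hD⟩ := η.2
  obtain ⟨z, -, hz⟩ := (isCompact_closedBall (0 : ℂ) (C * D)).ultrafilter_le_nhds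
    (U.map fun n => ⟪ξ.1 n, η.1 n⟫_ℂ) (by
      simp only [Ultrafilter.coe_map, le_principal_iff, mem_map]
      refine Filter.univ_mem' fun n => ?_
      simpa using (norm_inner_le_norm _ _).trans
        (mul_le_mul (hC n) (hD n) (norm_nonneg _) ((norm_nonneg _).trans (hC n))))
  exact ⟨z, hz⟩

theorem boundedSeq.exists_completion (U : Ultrafilter ℕ) :
    ∃ (K : Type) (_ : NormedAddCommGroup K) (_ : InnerProductSpace ℂ K) (_ : CompleteSpace K)
      (u : boundedSeq H →ₗ[ℂ] K), DenseRange u ∧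
        ∀ ξ η, Tendsto (fun n => ⟪ξ.1 n, η.1 n⟫_ℂ) U (𝓝 ⟪u ξ, u η⟫_ℂ) := by
  choose f hf using boundedSeq.exists_tendsto_inner (H := H) U
  let core : PreInnerProductSpace.Core ℂ (boundedSeq H) :=
    { inner := f
      conj_inner_symm := fun ξ η => tendsto_nhds_unique
        ((Complex.continuous_conj.tendsto _).comp (hf η ξ)) (by
          simpa only [Function.comp_def, inner_conj_symm] using hf ξ η)
      re_inner_nonneg := fun ξ => ge_of_tendsto' ((Complex.continuous_re.tendsto _).comp (hf ξ ξ))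
        fun n => inner_self_nonneg (𝕜 := ℂ)
      add_left := fun ξ η ζ => tendsto_nhds_unique (hf _ _) (by
        simpa only [inner_add_left, Submodule.coe_add, Pi.add_apply] using (hf ξ ζ).add (hf η ζ))
      smul_left := fun ξ η c => tendsto_nhds_unique (hf _ _) (by
        simpa only [inner_smul_left, Submodule.coe_smul, Pi.smul_apply]
          using (hf ξ η).const_mul (conj c)) }
  obtain ⟨K, _, _, _, u, hu, hd⟩ := core.exists_completion
  refine ⟨K, inferInstance, inferInstance, inferInstance, u, hd, fun ξ η => ?_⟩
  rw [hu]
  exact hf ξ η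

theorem boundedSeq.tendsto_sum_norm_sq {U : Ultrafilter ℕ} {K : Type} [NormedAddCommGroup K]
    [InnerProductSpace ℂ K] {u : boundedSeq H →ₗ[ℂ] K}
    (hu : ∀ ξ η, Tendsto (fun n => ⟪ξ.1 n, η.1 n⟫_ℂ) U (𝓝 ⟪u ξ, u η⟫_ℂ))
    {ι : Type} [Fintype ι] (ξ : ι → boundedSeq H) :
    Tendsto (fun n => ∑ i, ‖(ξ i).1 n‖ ^ 2) U (𝓝 (∑ i, ‖u (ξ i)‖ ^ 2)) :=
  tendsto_finsetSum _ fun i _ => by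
    simpa only [Function.comp_def, re_inner_self_complex]
      using (Complex.continuous_re.tendsto _).comp (hu (ξ i) (ξ i))

theorem MatBound.of_denseRange {K E : Type} [NormedAddCommGroup K] [InnerProductSpace ℂ K]
    [CompleteSpace K] [AddCommGroup E] [Module ℂ E] {u : E →ₗ[ℂ] K} (hd : DenseRange u)
    {ι κ : Type} [Fintype ι] [Fintype κ] {A : ι → κ → (K →L[ℂ] K)} {c : ℝ}
    (h : ∀ ξ : κ → E, ∑ i, ‖∑ k, A i k (u (ξ k))‖ ^ 2 ≤ c ^ 2 * ∑ k, ‖u (ξ k)‖ ^ 2) :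
    MatBound A c := fun ξ =>
  (DenseRange.piMap fun _ : κ => hd).induction_on
    (p := fun ξ : κ → K => ∑ i, ‖∑ k, A i k (ξ k)‖ ^ 2 ≤ c ^ 2 * ∑ k, ‖ξ k‖ ^ 2) ξ
    (isClosed_le (by fun_prop) (by fun_prop)) h

theorem boundedSeq.exists_action {U : Ultrafilter ℕ} {K : Type} [NormedAddCommGroup K]
    [InnerProductSpace ℂ K] [CompleteSpace K] {u : boundedSeq H →ₗ[ℂ] K} (hd : DenseRange u)
    (hu : ∀ ξ η, Tendsto (fun n => ⟪ξ.1 n, η.1 n⟫_ℂ) U (𝓝 ⟪u ξ, u η⟫_ℂ)) :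
    ∃ ρ : (H →L[ℂ] H) →ₗ[ℂ] (K →L[ℂ] K), (∀ a ξ, ρ a (u ξ) = u (boundedSeqMap a ξ)) ∧
      ∀ (ι κ : Type) [Fintype ι] [Fintype κ] (A : ι → κ → (H →L[ℂ] H)) (c : ℝ),
        MatBound A c → MatBound (fun i k => ρ (A i k)) c := by
  have hbd : ∀ (a : H →L[ℂ] H) ξ, ‖u.comp (boundedSeqMap a) ξ‖ ≤ ‖a‖ * ‖u ξ‖ := fun a ξ => by
    refine (pow_le_pow_iff_left₀ (norm_nonneg _) (by positivity) two_ne_zero).1 ?_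
    have h1 := boundedSeq.tendsto_sum_norm_sq hu fun _ : Unit => boundedSeqMap a ξ
    have h2 := (boundedSeq.tendsto_sum_norm_sq hu fun _ : Unit => ξ).const_mul (‖a‖ ^ 2)
    have h3 := le_of_tendsto_of_tendsto' h1 h2 fun n => by
      simp only [Finset.univ_unique, Finset.sum_singleton, ← mul_pow]
      gcongr
      exact a.le_opNorm _
    simpa [mul_pow] using h3
  choose R hR using fun a => LinearMap.exists_extend_of_denseRange u hd (u.comp (boundedSeqMap a))
    ‖a‖ (hbd a)
  replace hR : ∀ a ξ, R a (u ξ) = u (boundedSeqMap a ξ) := hR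
  refine ⟨{ toFun := R
            map_add' := fun a b => ContinuousLinearMap.ext_of_denseRange hd fun ξ => ?_
            map_smul' := fun c a => ContinuousLinearMap.ext_of_denseRange hd fun ξ => ?_ },
    hR, fun ι κ _ _ A c hA => MatBound.of_denseRange hd fun ξ => ?_⟩
  · rw [add_apply, hR, hR, hR, ← map_add]
    rfl
  · rw [RingHom.id_apply, smul_apply, hR, hR, ← map_smul]
    rfl
  · change ∑ i, ‖∑ k, R (A i k) (u (ξ k))‖ ^ 2 ≤ _
    simp only [hR, ← map_sum]
    refine le_of_tendsto_of_tendsto' (boundedSeq.tendsto_sum_norm_sq hu _)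
      ((boundedSeq.tendsto_sum_norm_sq hu ξ).const_mul (c ^ 2)) fun n => ?_
    have h1 := hA fun k => (ξ k).1 n
    simpa [boundedSeqMap] using h1

end Ultrapower

section Norming

open scoped InnerProductSpace ComplexConjugate Matrix
open Filter Topology

variable {V : Submodule ℂ (H →L[ℂ] H)} {e : V} {P : PartialProduct V e}
variable {ι κ : Type} [Fintype ι] [Fintype κ] {X : ι → κ → V} {t : ℝ}

/-- `t` is the norm of the matrix `X`. -/
def IsMatNorm (X : ι → κ → V) (t : ℝ) : Prop :=
  MatBound (fun i k => (X i k : H →L[ℂ] H)) t ∧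
    ∀ b, 0 ≤ b → MatBound (fun i k => (X i k : H →L[ℂ] H)) b → t ≤ b

open scoped Classical in
/-- The diagonal matrix `t e`. -/
def unitDiag (e : V) (t : ℝ) (ι : Type) : ι → ι → V :=
  fun i k => if i = k then (t : ℂ) • e else 0

theorem sum_unitDiag_apply (e : V) (t : ℝ) (ξ : ι → H) (i : ι) :
    ∑ k, (unitDiag e t ι i k : H →L[ℂ] H) (ξ k) = (t : ℂ) • (e : H →L[ℂ] H) (ξ i) := by
  rw [Finset.sum_eq_single i (fun k _ hk => by simp [unitDiag, hk.symm]) (by simp)]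
  simp [unitDiag]

theorem sum_norm_sq_unitDiag_le (he : ‖(e : H →L[ℂ] H)‖ = 1) (t : ℝ) (ξ : ι → H) :
    ∑ i, ‖∑ k, (unitDiag e t ι i k : H →L[ℂ] H) (ξ k)‖ ^ 2 ≤ t ^ 2 * ∑ k, ‖ξ k‖ ^ 2 := by
  rw [Finset.mul_sum]
  refine Finset.sum_le_sum fun i _ => ?_
  rw [sum_unitDiag_apply, norm_smul, mul_pow, Complex.norm_real, Real.norm_eq_abs, sq_abs]
  gcongr
  simpa [he] using (e : H →L[ℂ] H).le_opNorm (ξ i)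

/-- The row matrix `[X, t e]`. -/
def rowExtend (e : V) (X : ι → κ → V) (t : ℝ) : ι → κ ⊕ ι → V :=
  fun i => Sum.elim (X i) (unitDiag e t ι i)

/-- The column matrix `[t e; X]`. -/
def colExtend (e : V) (X : ι → κ → V) (t : ℝ) : κ ⊕ ι → κ → V :=
  Sum.elim (unitDiag e t κ) X

theorem two_mul_sq_le (h : P.Contractive) (hX : IsMatNorm X t) (ht : 0 < t) {a b : ℝ} (ha : 0 ≤ a)
    (hb : 0 ≤ b) (hA : MatBound (fun i k => (rowExtend e X t i k : H →L[ℂ] H)) a)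
    (hB : MatBound (fun i k => (colExtend e X t i k : H →L[ℂ] H)) b) : 2 * t ^ 2 ≤ a * b := by
  have h1 := h ι (κ ⊕ ι) κ (rowExtend e X t) (colExtend e X t) a b ha hb ?_ hA hB
  · have h2 : ∀ i k, ∑ r, P.m (rowExtend e X t i r) (colExtend e X t r k) =
        ((2 * t : ℝ) : ℂ) • X i k := fun i k => by
      rw [Fintype.sum_sum_type, Finset.sum_eq_single k
        (fun r _ hr => by simp [rowExtend, colExtend, unitDiag, hr, P.m_zero_right]) (by simp),
        Finset.sum_eq_single i
        (fun r _ hr => by simp [rowExtend, colExtend, unitDiag, hr.symm, P.m_zero_left]) (by simp)]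
      simp only [rowExtend, colExtend, unitDiag, Sum.elim_inl, Sum.elim_inr, if_true,
        P.m_smul_unit_right, P.m_smul_unit_left, ← add_smul]
      congr 1
      push_cast
      ring
    simp only [h2] at h1
    have h3 := hX.2 (a * b / (2 * t)) (by positivity) fun ξ => by
      have h4 := h1 ξ
      simp only [Submodule.coe_smul, smul_apply, ← Finset.smul_sum, norm_smul, mul_pow,
        Complex.norm_real, Real.norm_eq_abs, sq_abs, ← Finset.mul_sum] at h4
      rw [div_pow, div_mul_eq_mul_div, le_div_iff₀ (by positivity)]
      linarith
    rw [le_div_iff₀ (by positivity)] at h3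
    linarith
  · rintro i (r | r) k
    · simp only [rowExtend, colExtend, unitDiag, Sum.elim_inl]
      split_ifs
      · exact P.unit_right _ _
      · simpa using P.unit_right 0 (X i r)
    · simp only [rowExtend, colExtend, unitDiag, Sum.elim_inr]
      split_ifs
      · exact P.unit_left _ _
      · exact P.mem_zero_left _

theorem matBound_rowExtend (he : ‖(e : H →L[ℂ] H)‖ = 1) (hX : IsMatNorm X t) :
    MatBound (fun i k => (rowExtend e X t i k : H →L[ℂ] H)) (Real.sqrt 2 * t) := fun ξ => by
  simp only [Fintype.sum_sum_type, rowExtend, Sum.elim_inl, Sum.elim_inr]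
  refine (sum_norm_add_sq_le one_pos _ _).trans ?_
  rw [mul_pow, Real.sq_sqrt zero_le_two]
  have h1 := hX.1 fun k => ξ (Sum.inl k)
  have h2 := sum_norm_sq_unitDiag_le he t fun i => ξ (Sum.inr i)
  linarith

theorem matBound_colExtend (he : ‖(e : H →L[ℂ] H)‖ = 1) (hX : IsMatNorm X t) :
    MatBound (fun i k => (colExtend e X t i k : H →L[ℂ] H)) (Real.sqrt 2 * t) := fun ξ => by
  simp only [Fintype.sum_sum_type, colExtend, Sum.elim_inl, Sum.elim_inr]
  rw [mul_pow, Real.sq_sqrt zero_le_two]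
  have h1 := hX.1 ξ
  have h2 := sum_norm_sq_unitDiag_le he t ξ
  linarith

theorem sqrt_two_mul_le {b : ℝ} (ht : 0 < t) (h : 2 * t ^ 2 ≤ Real.sqrt 2 * t * b) :
    Real.sqrt 2 * t ≤ b := by
  have h1 : Real.sqrt 2 * Real.sqrt 2 = 2 := Real.mul_self_sqrt zero_le_two
  refine le_of_mul_le_mul_left (a := Real.sqrt 2 * t) ?_ (by positivity)
  calc Real.sqrt 2 * t * (Real.sqrt 2 * t) = Real.sqrt 2 * Real.sqrt 2 * t ^ 2 := by ring
    _ = 2 * t ^ 2 := by rw [h1]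
    _ ≤ _ := h

theorem PartialProduct.Contractive.isMatNorm_rowExtend (h : P.Contractive)
    (he : ‖(e : H →L[ℂ] H)‖ = 1) (hX : IsMatNorm X t) (ht : 0 < t) :
    IsMatNorm (rowExtend e X t) (Real.sqrt 2 * t) := by
  refine ⟨matBound_rowExtend he hX, fun b hb hB => sqrt_two_mul_le ht ?_⟩
  rw [mul_comm (Real.sqrt 2 * t)]
  exact two_mul_sq_le h hX ht hb (by positivity) hB (matBound_colExtend he hX)

theorem PartialProduct.Contractive.isMatNorm_colExtend (h : P.Contractive)
    (he : ‖(e : H →L[ℂ] H)‖ = 1) (hX : IsMatNorm X t) (ht : 0 < t) :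
    IsMatNorm (colExtend e X t) (Real.sqrt 2 * t) :=
  ⟨matBound_colExtend he hX, fun _ hb hB => sqrt_two_mul_le ht
    (two_mul_sq_le h hX ht (by positivity) hb (matBound_rowExtend he hX) hB)⟩

/-- Almost norming vectors for `[√2 t e; X, t e]` are almost fixed by `e`, and are almost of the
form `(η, X η / t)`. -/
theorem PartialProduct.Contractive.exists_almost_norming (h : P.Contractive)
    (he : ‖(e : H →L[ℂ] H)‖ = 1) (hX : IsMatNorm X t) (ht : 0 < t) {δ : ℝ} (hδ : 0 < δ)
    (hδ1 : δ ≤ 1) : ∃ η : κ ⊕ ι → H, ∑ k, ‖η k‖ ^ 2 = 1 ∧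
      1 - δ ^ 2 ≤ ∑ k, ‖(e : H →L[ℂ] H) (η k)‖ ^ 2 ∧
      ∑ i, ‖∑ k, (X i k : H →L[ℂ] H) (η (Sum.inl k)) -
        (t : ℂ) • (e : H →L[ℂ] H) (η (Sum.inr i))‖ ^ 2 ≤ t ^ 2 * δ ^ 2 ∧
      2 - δ ^ 2 ≤ 4 * (1 + δ) * ∑ i, ‖η (Sum.inr i)‖ ^ 2 + (δ + δ ^ 2) := by
  have hG := h.isMatNorm_rowExtend he hX ht
  have hB := h.isMatNorm_colExtend he hG (by positivity)
  set s : ℝ := Real.sqrt 2 * t with hs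
  have hss : s ^ 2 = 2 * t ^ 2 := by rw [hs, mul_pow, Real.sq_sqrt zero_le_two]
  have h22 : Real.sqrt 2 * s = 2 * t := by
    rw [hs, ← mul_assoc, Real.mul_self_sqrt zero_le_two]
  rw [h22] at hB
  have hpos : 0 ≤ 4 * t ^ 2 - t ^ 2 * δ ^ 2 := by
    have h1 : t ^ 2 * δ ^ 2 ≤ t ^ 2 * 1 := by
      gcongr
      exact pow_le_one₀ hδ.le hδ1
    linarith [sq_nonneg t]
  let b : ℝ := Real.sqrt (4 * t ^ 2 - t ^ 2 * δ ^ 2)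
  have hb2 : b ^ 2 = 4 * t ^ 2 - t ^ 2 * δ ^ 2 := Real.sq_sqrt hpos
  have hb : ¬ MatBound (fun i k => (colExtend e (rowExtend e X t) s i k : H →L[ℂ] H)) b :=
    fun hc => by
      have h1 := hB.2 b (Real.sqrt_nonneg _) hc
      have h2 : 0 < t ^ 2 * δ ^ 2 := by positivity
      have h3 : (2 * t) ^ 2 ≤ b ^ 2 := by gcongr
      linarith
  obtain ⟨ξ, hξ⟩ : ∃ ξ : κ ⊕ ι → H, ¬ _ := not_forall.1 hb
  rw [not_le] at hξ
  have hn : 0 < ∑ k, ‖ξ k‖ ^ 2 := by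
    refine (Finset.sum_nonneg fun k _ => sq_nonneg _).lt_of_ne fun h0 => ?_
    have h1 := hB.1 ξ
    rw [← h0, mul_zero] at h1 hξ
    exact absurd h1 hξ.not_ge
  let r : ℝ := (Real.sqrt (∑ k, ‖ξ k‖ ^ 2))⁻¹
  have hr : r ^ 2 * ∑ k, ‖ξ k‖ ^ 2 = 1 := by
    simp only [r, inv_pow, Real.sq_sqrt hn.le]
    exact inv_mul_cancel₀ hn.ne'
  have hr0 : 0 < r := inv_pos.2 (Real.sqrt_pos.2 hn)
  obtain ⟨η, hη1, hη⟩ : ∃ η : κ ⊕ ι → H, ∑ k, ‖η k‖ ^ 2 = 1 ∧ b ^ 2 <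
      ∑ i, ‖∑ k, (colExtend e (rowExtend e X t) s i k : H →L[ℂ] H) (η k)‖ ^ 2 := by
    refine ⟨fun k => (r : ℂ) • ξ k, ?_, ?_⟩
    · simpa only [norm_smul, mul_pow, Complex.norm_real, Real.norm_eq_abs, sq_abs, ← Finset.mul_sum]
        using hr
    · simp only [map_smul, ← Finset.smul_sum, norm_smul, mul_pow, Complex.norm_real,
        Real.norm_eq_abs, sq_abs, ← Finset.mul_sum]
      calc b ^ 2 = r ^ 2 * (b ^ 2 * ∑ k, ‖ξ k‖ ^ 2) := by linear_combination (-b ^ 2) * hr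
        _ < _ := by gcongr
  clear hξ hn hr hr0
  have hes : ∑ k, ‖(e : H →L[ℂ] H) (η k)‖ ^ 2 ≤ 1 := by
    rw [← hη1]
    gcongr with k
    simpa [he] using (e : H →L[ℂ] H).le_opNorm (η k)
  rw [Fintype.sum_sum_type] at hη
  simp only [colExtend, rowExtend, Sum.elim_inl, Sum.elim_inr, sum_unitDiag_apply, norm_smul,
    mul_pow, Complex.norm_real, Real.norm_eq_abs, sq_abs, ← Finset.mul_sum, hss, hb2] at hη
  let p : ι → H := fun i => ∑ k, (X i k : H →L[ℂ] H) (η (Sum.inl k))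
  let q : ι → H := fun i => (t : ℂ) • (e : H →L[ℂ] H) (η (Sum.inr i))
  have hpq : ∀ i, ∑ k, ((Sum.elim (X i) (unitDiag e t ι i) k : V) : H →L[ℂ] H) (η k) =
      p i + q i := fun i => by
    rw [Fintype.sum_sum_type]
    exact congrArg (p i + ·) (sum_unitDiag_apply e t _ i)
  simp only [hpq] at hη
  rw [Fintype.sum_sum_type] at hη1
  have h1 : ∑ i, ‖p i‖ ^ 2 ≤ t ^ 2 * ∑ k, ‖η (Sum.inl k)‖ ^ 2 := hX.1 fun k => η (Sum.inl k)
  have h2 : ∑ i, ‖q i‖ ^ 2 ≤ t ^ 2 * ∑ i, ‖η (Sum.inr i)‖ ^ 2 := by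
    simpa only [sum_unitDiag_apply] using sum_norm_sq_unitDiag_le he t fun i => η (Sum.inr i)
  have h3 : ∑ i, ‖p i + q i‖ ^ 2 + ∑ i, ‖p i - q i‖ ^ 2 =
      2 * (∑ i, ‖p i‖ ^ 2 + ∑ i, ‖q i‖ ^ 2) := by
    simp only [← Finset.sum_add_distrib, Finset.mul_sum]
    refine Finset.sum_congr rfl fun i _ => ?_
    simpa only [sq] using parallelogram_law_with_norm ℂ (p i) (q i)
  have h4 : t ^ 2 * (∑ k, ‖η (Sum.inl k)‖ ^ 2 + ∑ i, ‖η (Sum.inr i)‖ ^ 2) = t ^ 2 := by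
    rw [hη1, mul_one]
  have h5 : 0 ≤ ∑ i, ‖p i - q i‖ ^ 2 := Finset.sum_nonneg fun i _ => sq_nonneg _
  have ht2 : 0 < t ^ 2 := by positivity
  have h6 : t ^ 2 * ∑ k, ‖(e : H →L[ℂ] H) (η k)‖ ^ 2 ≤ t ^ 2 * 1 := by gcongr
  have h7 : ∑ i, ‖p i - q i‖ ^ 2 ≤ t ^ 2 * δ ^ 2 := by linarith
  refine ⟨η, by rwa [Fintype.sum_sum_type], ?_, h7, ?_⟩
  · refine le_of_mul_le_mul_left (a := t ^ 2) ?_ ht2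
    have h8 : 0 ≤ t ^ 2 * δ ^ 2 := by positivity
    linarith
  · have h8 := sum_norm_add_sq_le hδ (fun i => (2 : ℂ) • q i) fun i => p i - q i
    have h9 : ∀ i, (2 : ℂ) • q i + (p i - q i) = p i + q i := fun i => by module
    have h10 : ∀ v : H, ‖(2 : ℂ) • v‖ ^ 2 = 4 * ‖v‖ ^ 2 := fun v => by
      rw [norm_smul, mul_pow]
      norm_num
    simp only [h9, h10, ← Finset.mul_sum] at h8
    have h11 := mul_le_mul_of_nonneg_left h7 (by positivity : 0 ≤ 1 + 1 / δ)
    have h12 : (1 + 1 / δ) * (t ^ 2 * δ ^ 2) = t ^ 2 * (δ + δ ^ 2) := by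
      field_simp
      ring
    have h13 := mul_le_mul_of_nonneg_left h2 (by positivity : 0 ≤ 4 * (1 + δ))
    refine le_of_mul_le_mul_left (a := t ^ 2) ?_ ht2
    linarith

end Norming

section UnitalEmbedding

open scoped InnerProductSpace ComplexConjugate Matrix
open Filter Topology

theorem ContinuousLinearMap.adjoint_apply_apply_eq_self {L : Type} [NormedAddCommGroup L]
    [InnerProductSpace ℂ L] [CompleteSpace L] {E : H →L[ℂ] L} (hE : ∀ x, ‖E x‖ ≤ ‖x‖) {x : H}
    (hx : ‖x‖ ^ 2 ≤ ‖E x‖ ^ 2) : adjoint E (E x) = x := by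
  have h1 : ‖adjoint E (E x)‖ ≤ ‖E x‖ := by
    refine (adjoint E).le_of_opNorm_le (c := 1) ?_ _ |>.trans (one_mul _).le
    rw [LinearIsometryEquiv.norm_map]
    exact E.opNorm_le_bound zero_le_one fun x => by simpa using hE x
  have h2 : ‖adjoint E (E x) - x‖ ^ 2 ≤ 0 := by
    rw [norm_sub_sq (𝕜 := ℂ), adjoint_inner_left, inner_self_eq_norm_sq]
    have h3 : ‖adjoint E (E x)‖ ^ 2 ≤ ‖E x‖ ^ 2 := by gcongr
    linarith
  have h4 : ‖adjoint E (E x) - x‖ = 0 := by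
    have := sq_nonneg ‖adjoint E (E x) - x‖
    exact pow_eq_zero_iff two_ne_zero |>.1 (le_antisymm h2 this)
  exact sub_eq_zero.1 (norm_eq_zero.1 h4)

theorem matBound_abs {ι κ : Type} [Fintype ι] [Fintype κ] {A : ι → κ → (H →L[ℂ] H)} {c : ℝ} :
    MatBound A |c| ↔ MatBound A c := by
  simp only [MatBound, sq_abs]

theorem PartialProduct.Contractive.exists_norming {V : Submodule ℂ (H →L[ℂ] H)} {e : V}
    {P : PartialProduct V e} (h : P.Contractive) (he : ‖(e : H →L[ℂ] H)‖ = 1) {K : Type}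
    [NormedAddCommGroup K] [InnerProductSpace ℂ K] [CompleteSpace K] {u : boundedSeq H →ₗ[ℂ] K}
    (hu : ∀ ξ η, Tendsto (fun n => ⟪ξ.1 n, η.1 n⟫_ℂ) (hyperfilter ℕ : Ultrafilter ℕ)
      (𝓝 ⟪u ξ, u η⟫_ℂ))
    {ρ : (H →L[ℂ] H) →ₗ[ℂ] (K →L[ℂ] K)} (hρ : ∀ a ξ, ρ a (u ξ) = u (boundedSeqMap a ξ))
    {ι κ : Type} [Fintype ι] [Fintype κ] {X : ι → κ → V} {t : ℝ} (hX : IsMatNorm X t)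
    (ht : 0 < t) : ∃ η : κ ⊕ ι → K, ∑ k, ‖η k‖ ^ 2 = 1 ∧
      1 ≤ ∑ k, ‖ρ e (η k)‖ ^ 2 ∧
      (∀ i, ∑ k, ρ (X i k) (η (Sum.inl k)) = (t : ℂ) • ρ e (η (Sum.inr i))) ∧
      1 / 2 ≤ ∑ i, ‖η (Sum.inr i)‖ ^ 2 := by
  let U : Ultrafilter ℕ := hyperfilter ℕ
  choose η hη1 hη2 hη3 hη4 using fun N : ℕ => h.exists_almost_norming he hX ht
    (by positivity : (0 : ℝ) < (1 / 2) ^ N) (pow_le_one₀ (by norm_num) (by norm_num))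
  have hlim : ∀ g : ℝ → ℝ, Continuous g →
      Tendsto (fun N : ℕ => g ((1 / 2 : ℝ) ^ N)) U (𝓝 (g 0)) := fun g hg =>
    ((hg.tendsto 0).comp (tendsto_pow_atTop_nhds_zero_of_lt_one (by norm_num)
      (by norm_num))).mono_left Nat.hyperfilter_le_atTop
  let η' : κ ⊕ ι → boundedSeq H := fun k => ⟨fun N => η N k, 1, fun N => by
    refine (sq_le_one_iff₀ (norm_nonneg _)).1 ?_
    rw [← hη1 N]
    exact Finset.single_le_sum (f := fun k => ‖η N k‖ ^ 2) (fun k _ => sq_nonneg _)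
      (Finset.mem_univ k)⟩
  refine ⟨fun k => u (η' k), ?_, ?_, fun i => ?_, ?_⟩
  · refine tendsto_nhds_unique (boundedSeq.tendsto_sum_norm_sq hu η') ?_
    simp only [η', hη1]
    exact tendsto_const_nhds
  · simp only [hρ]
    have h1 := hlim (fun δ => 1 - δ ^ 2) (by fun_prop)
    have h2 := le_of_tendsto_of_tendsto' h1 (boundedSeq.tendsto_sum_norm_sq hu
      fun k => boundedSeqMap (e : H →L[ℂ] H) (η' k)) hη2
    simpa using h2
  · let ζ : ι → boundedSeq H := fun i => ∑ k, boundedSeqMap (X i k : H →L[ℂ] H) (η' (Sum.inl k)) -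
      (t : ℂ) • boundedSeqMap (e : H →L[ℂ] H) (η' (Sum.inr i))
    have hζ : ∀ i N, (ζ i).1 N = ∑ k, (X i k : H →L[ℂ] H) (η N (Sum.inl k)) -
        (t : ℂ) • (e : H →L[ℂ] H) (η N (Sum.inr i)) := fun i N => by
      simp [ζ, boundedSeqMap, η', Finset.sum_apply]
    have h1 := hlim (fun δ => t ^ 2 * δ ^ 2) (by fun_prop)
    have h2 := le_of_tendsto_of_tendsto' (boundedSeq.tendsto_sum_norm_sq hu ζ) h1 fun N => by
      simp only [hζ]
      exact hη3 N
    have h3 : ‖u (ζ i)‖ ^ 2 ≤ 0 := by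
      refine (Finset.single_le_sum (f := fun i => ‖u (ζ i)‖ ^ 2) (fun i _ => sq_nonneg _)
        (Finset.mem_univ i)).trans (h2.trans (le_of_eq ?_))
      simp
    have h4 : u (ζ i) = 0 := by
      rw [← norm_eq_zero, ← pow_eq_zero_iff two_ne_zero]
      exact le_antisymm h3 (sq_nonneg _)
    simp only [hρ]
    rw [map_sub, map_sum, map_smul, sub_eq_zero] at h4
    exact h4
  · have h1 := hlim (fun δ => 2 - δ ^ 2) (by fun_prop)
    have h2 := ((hlim (fun δ => 4 * (1 + δ)) (by fun_prop)).mul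
      (boundedSeq.tendsto_sum_norm_sq hu fun i => η' (Sum.inr i))).add
      (hlim (fun δ => δ + δ ^ 2) (by fun_prop))
    have h3 := le_of_tendsto_of_tendsto' h1 h2 hη4
    norm_num at h3
    linarith

theorem PartialProduct.Contractive.exists_unital_embedding {V : Submodule ℂ (H →L[ℂ] H)} {e : V}
    {P : PartialProduct V e} (h : P.Contractive) (he : ‖(e : H →L[ℂ] H)‖ = 1) :
    ∃ (K : Type) (_ : NormedAddCommGroup K) (_ : InnerProductSpace ℂ K) (_ : CompleteSpace K)
      (j : V →ₗ[ℂ] (K →L[ℂ] K)), j e = 1 ∧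
      ∀ (ι κ : Type) [Fintype ι] [Fintype κ] (A : ι → κ → V) (c : ℝ),
        MatBound (fun i k => j (A i k)) c ↔ MatBound (fun i k => (A i k : H →L[ℂ] H)) c := by
  obtain ⟨L, _, _, _, u, hd, hu⟩ := boundedSeq.exists_completion (H := H) (hyperfilter ℕ)
  obtain ⟨ρ, hρ, hρb⟩ := boundedSeq.exists_action hd hu
  let E : L →L[ℂ] L := ρ e
  have hE : ∀ x, ‖E x‖ ≤ ‖x‖ := fun x => by
    have h1 := hρb Unit Unit (fun _ _ => (e : H →L[ℂ] H)) 1 (fun ξ => by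
      have h2 := (e : H →L[ℂ] H).le_opNorm (ξ ())
      rw [he, one_mul] at h2
      simpa using pow_le_pow_left₀ (norm_nonneg _) h2 2) fun _ => x
    exact (pow_le_pow_iff_left₀ (norm_nonneg _) (norm_nonneg _) two_ne_zero).1 (by simpa using h1)
  let D : L →L[ℂ] L := 1 - ContinuousLinearMap.adjoint E ∘L E
  let K : Submodule ℂ L := LinearMap.ker D.toLinearMap
  have : CompleteSpace K := (ContinuousLinearMap.isClosed_ker D).completeSpace_coe
  have hK : ∀ x : L, x ∈ K ↔ ContinuousLinearMap.adjoint E (E x) = x := fun x => by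
    change x - ContinuousLinearMap.adjoint E (E x) = 0 ↔ _
    rw [sub_eq_zero, eq_comm]
  let T : K →L[ℂ] L := E ∘L K.subtypeL
  have hT : ∀ x, ‖T x‖ ≤ ‖x‖ := fun x => hE x
  have hT' : ∀ y, ‖ContinuousLinearMap.adjoint T y‖ ≤ ‖y‖ := fun y => by
    refine (ContinuousLinearMap.adjoint T).le_of_opNorm_le (c := 1) ?_ _ |>.trans (one_mul _).le
    rw [LinearIsometryEquiv.norm_map]
    exact T.opNorm_le_bound zero_le_one fun x => by simpa using hT x
  have hTT : ∀ x, ContinuousLinearMap.adjoint T (T x) = x := fun x => by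
    refine ext_inner_left ℂ fun y => ?_
    rw [ContinuousLinearMap.adjoint_inner_right]
    change ⟪E y, E x⟫_ℂ = ⟪(y : L), x⟫_ℂ
    rw [← ContinuousLinearMap.adjoint_inner_right, (hK x).1 x.2]
  let j : V →ₗ[ℂ] (K →L[ℂ] K) :=
    { toFun := fun v => ContinuousLinearMap.adjoint T ∘L ρ v ∘L K.subtypeL
      map_add' := fun v w => by ext x; simp
      map_smul' := fun c v => by ext x; simp }
  have hj : ∀ v x, j v x = ContinuousLinearMap.adjoint T (ρ v x) := fun v x => rfl
  refine ⟨K, inferInstance, inferInstance, inferInstance, j,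
    ContinuousLinearMap.ext fun x => (hj e x).trans (hTT x), fun ι κ _ _ A c => ⟨fun hA => ?_,
    fun hA ξ => ?_⟩⟩
  · rw [← matBound_abs] at hA ⊢
    have hc := abs_nonneg c
    let t := opMatNorm fun i k => (A i k : H →L[ℂ] H)
    have hX : IsMatNorm A t :=
      ⟨matBound_opMatNorm _, fun b hb => (opMatNorm_le_iff _ hb).2⟩
    refine hX.1.mono (opMatNorm_nonneg _) ?_
    obtain ht | ht := (opMatNorm_nonneg fun i k => (A i k : H →L[ℂ] H)).eq_or_lt
    · exact ht.symm.le.trans hc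
    obtain ⟨η, hη1, hη2, hη3, hη4⟩ := h.exists_norming he hu hρ hX ht
    have hEη : ∀ k, ‖E (η k)‖ ^ 2 ≤ ‖η k‖ ^ 2 := fun k => by gcongr; exact hE _
    have hη : ∀ k, η k ∈ K := fun k => by
      refine (hK _).2 (ContinuousLinearMap.adjoint_apply_apply_eq_self hE (le_of_eq ?_))
      exact ((Finset.sum_eq_sum_iff_of_le fun k _ => hEη k).1
        (le_antisymm (Finset.sum_le_sum fun k _ => hEη k) (hη1.trans_le hη2)) k
        (Finset.mem_univ k)).symm
    let ζ : κ ⊕ ι → K := fun k => ⟨η k, hη k⟩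
    have hζ : ∀ i, ∑ k, j (A i k) (ζ (Sum.inl k)) = (t : ℂ) • ζ (Sum.inr i) := fun i => by
      simp only [hj, ← map_sum]
      change ContinuousLinearMap.adjoint T (∑ k, ρ (A i k) (η (Sum.inl k))) = _
      rw [hη3, map_smul]
      exact congrArg _ (hTT (ζ (Sum.inr i)))
    have h1 := hA fun k => ζ (Sum.inl k)
    simp only [hζ, norm_smul, mul_pow, ← Finset.mul_sum, Complex.norm_real, Real.norm_eq_abs,
      sq_abs] at h1
    change t ^ 2 * ∑ i, ‖η (Sum.inr i)‖ ^ 2 ≤ _ * ∑ k, ‖η (Sum.inl k)‖ ^ 2 at h1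
    rw [Fintype.sum_sum_type] at hη1
    refine (pow_le_pow_iff_left₀ ht.le hc two_ne_zero).1 ?_
    rw [sq_abs]
    nlinarith [sq_nonneg t, sq_nonneg c]
  · refine le_trans ?_ (hρb ι κ _ c hA fun k => (ξ k : L))
    refine Finset.sum_le_sum fun i _ => ?_
    simp only [hj, ← map_sum]
    gcongr
    exact hT' _

end UnitalEmbedding

/-- **Abstract characterization of products of unital operator spaces.**
Let `V ⊆ B(H)` be a linear subspace, `e ∈ V` with `‖e‖ = 1`, and `m : D → V` a partial
product.  Then `m` is completely contractive (on valid pairs of matrices) if and only if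
there is a Hilbert space `K` and a completely isometric linear map `π : V → B(K)` with
`π(e) = I` and `π(m(a,b)) = π(a) π(b)` for all `(a, b) ∈ D`. -/
theorem partialProduct_completelyContractive_iff_representable
    (V : Submodule ℂ (H →L[ℂ] H)) (e : ↥V) (he : ‖(e : H →L[ℂ] H)‖ = 1)
    (P : PartialProduct ↥V e) :
    (∀ (n k l : ℕ) (A : Matrix (Fin n) (Fin k) ↥V) (B : Matrix (Fin k) (Fin l) ↥V),
        P.ValidPair A B → subMatNorm (P.odot A B) ≤ subMatNorm A * subMatNorm B) ↔
    (∃ (K : Type) (_ : NormedAddCommGroup K) (_ : InnerProductSpace ℂ K) (_ : CompleteSpace K)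
        (π : ↥V →ₗ[ℂ] (K →L[ℂ] K)),
        π e = 1 ∧
        (∀ (n k : ℕ) (A : Matrix (Fin n) (Fin k) ↥V), opMatNorm (A.map ⇑π) = subMatNorm A) ∧
        (∀ a b : ↥V, (a, b) ∈ P.D → π (P.m a b) = π a * π b)) := by
  refine ⟨fun h => ?_, fun ⟨K, _, _, _, π, _, hπ, hm⟩ n k l A B hD =>
    P.contractive_of_representation π hπ hm n k l A B hD⟩
  have hC := P.contractive_of_forall_fin h
  obtain ⟨L, _, _, _, j, hje, hj⟩ := hC.exists_unital_embedding he
  obtain ⟨K, _, _, _, π, hπe, hπ, hπm⟩ := exists_representation_of_isHomogContraction j hje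
  refine ⟨K, inferInstance, inferInstance, inferInstance, π, hπe, fun n k A => ?_,
    fun a b hab => ?_⟩
  · have hA : ∀ c, MatBound (A.map π) c ↔ MatBound (A.map fun v => (v : H →L[ℂ] H)) c :=
      fun c => (hπ _ _ A c).trans (hj _ _ A c)
    exact le_antisymm
      ((opMatNorm_le_iff _ (opMatNorm_nonneg _)).2 ((hA _).2 (matBound_opMatNorm _)))
      ((opMatNorm_le_iff _ (opMatNorm_nonneg _)).2 ((hA _).1 (matBound_opMatNorm _)))
  · refine hπm a b _ (max ‖(a : H →L[ℂ] H)‖ 1) (by positivity) ?_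
    intro ι κ _ _ α β z b' hb' hz
    exact (hj _ _ _ _).2 (hC.isHomogContraction he hab (by positivity) (le_max_left _ _)
      ι κ α β z b' hb' ((hj _ _ _ _).1 hz))
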